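/- For every pair (Γ₁,Γ₃) ⊢ [n,n+2], letting α be the box of Γ₃ ∖ Γ₁ with minimal coordinate sum u+v and, in case of a tie, minimal second coordinate v, the set Γ₂ := Γ₁ ∪ {α} is a Young diagram, so s(Γ₁,Γ₃) := (Γ₁,Γ₂,Γ₃) is a triple ⊢ [n,n+1,n+2]; moreover, for every n ≥ 0, ∑_{(Γ₁,Γ₃)⊢[n,n+2]} q^{pos_{1+}(s(Γ₁,Γ₃))} = (1+q)·f_n(q) − q·f_{n−1}(q) as polynomials in q (with f_{−1} := 0). Equivalently ∑_{n≥0} ( ∑_{(Γ₁,Γ₃)⊢[n,n+2]} q^{pos_{1+}(s(Γ₁,Γ₃))} ) z^n = (1+q−qz)/((1−zq)(1−z²q²)) · ∏_{m≥1} 1/(1−z^m q^{m−1}); this is the generating function of the Poincaré polynomials of Hilb^{n,n+2}(0). -/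

import Mathlib

/-!
Statement 1: for a pair (Γ₁,Γ₃) ⊢ [n,n+2], adding to Γ₁ the box α of Γ₃ ∖ Γ₁ of minimal
coordinate sum (ties broken by minimal second coordinate) again yields a Young diagram Γ₂,
so s(Γ₁,Γ₃) := (Γ₁,Γ₂,Γ₃) ⊢ [n,n+1,n+2]; and
Σ_{(Γ₁,Γ₃)⊢[n,n+2]} q^{pos_{1+}(s(Γ₁,Γ₃))} = (1+q)·f_n(q) − q·f_{n−1}(q) (with f_{−1} := 0).
-/

open Polynomial

/-- The hook difference of a box `c` with respect to a finite set `s` of boxes. -/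
def hookDiff (s : Finset (ℕ × ℕ)) (c : ℕ × ℕ) : ℤ :=
  ((s.filter fun d => d.2 = c.2 ∧ c.1 < d.1).card : ℤ)
    - ((s.filter fun d => d.1 = c.1 ∧ c.2 < d.2).card : ℤ)

/-- `pos_{1+}` of a triple of nested Young diagrams, given the cells `s₁` of `Γ₁`,
the cells `s₂` of `Γ₂`, the box `b₁` of `Γ₂ ∖ Γ₁` and the box `b₂` of `Γ₃ ∖ Γ₂`. -/
def posOne (s₁ s₂ : Finset (ℕ × ℕ)) (b₁ b₂ : ℕ × ℕ) : ℕ :=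
  (s₁.filter fun c => hookDiff s₁ c ≠ 0 ∧ hookDiff s₁ c ≠ 1).card
    + (s₁.filter fun c =>
        (hookDiff s₁ c = 0 ∧ c.1 = b₁.1) ∨ (hookDiff s₁ c = 1 ∧ c.2 = b₁.2)).card
    + (s₂.filter fun c =>
        (hookDiff s₂ c = 0 ∧ c.1 = b₂.1) ∨ (hookDiff s₂ c = 1 ∧ c.2 = b₂.2)).card
    + (if b₁.1 + b₁.2 + 2 < b₂.1 + b₂.2
          ∨ (b₂.1 + b₂.2 = b₁.1 + b₁.2 + 2 ∧ b₁.2 < b₂.2) then 1 else 0)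

/-- A pair of nested Young diagrams `(Γ₁,Γ₃) ⊢ [n,n+2]`, recorded together with the two
boxes `α, β` of `Γ₃ ∖ Γ₁`, labelled so that `α` is the box with minimal coordinate sum
`u+v` and, in case of a tie, minimal second coordinate `v`. -/
structure PairFlag (n : ℕ) where
  Γ₁ : YoungDiagram
  Γ₃ : YoungDiagram
  α : ℕ × ℕ
  β : ℕ × ℕ
  card₁ : Γ₁.card = n
  not_mem_α : α ∉ Γ₁
  not_mem_β : β ∉ Γ₁
  ne : α ≠ β
  cells₃ : Γ₃.cells = insert α (insert β Γ₁.cells)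
  min : α.1 + α.2 < β.1 + β.2 ∨ (α.1 + α.2 = β.1 + β.2 ∧ α.2 < β.2)

/-- `f_n(q) = Σ q^{n−ℓ(ν)}`, summed over all triples `(a,b,ν)` with `a + 2b + |ν| = n`. -/
noncomputable def fPoly (n : ℕ) : Polynomial ℤ :=
  ∑ p ∈ ((Finset.range (n + 1)) ×ˢ (Finset.range (n + 1))).filter
      (fun p => p.1 + 2 * p.2 ≤ n),
    ∑ ν : Nat.Partition (n - p.1 - 2 * p.2), (X : Polynomial ℤ) ^ (n - ν.parts.card)

namespace PF

/-- Gaussian binomials. -/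
noncomputable def qb (p : ℝ) : ℕ → ℕ → ℝ
  | _, 0 => 1
  | 0, _ + 1 => 0
  | n + 1, k + 1 => qb p n k + p ^ (k + 1) * qb p n (k + 1)

/-- The q-integer. -/
noncomputable def qi (p : ℝ) (n : ℕ) : ℝ := ∑ i ∈ Finset.range n, p ^ i

/-- The q-factorial. -/
noncomputable def qf (p : ℝ) (n : ℕ) : ℝ := ∏ i ∈ Finset.range n, qi p (i + 1)

/-- The products `∏ (y + p^j)`. -/
noncomputable def Rp (p y : ℝ) (a : ℕ) : ℝ := ∏ j ∈ Finset.range a, (y + p ^ j)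

variable {p : ℝ}

@[simp] lemma qb_zero_right (n : ℕ) : qb p n 0 = 1 := by cases n <;> simp [qb]
@[simp] lemma qb_zero_succ (k : ℕ) : qb p 0 (k + 1) = 0 := by simp [qb]
lemma qb_succ_succ (n k : ℕ) :
    qb p (n + 1) (k + 1) = qb p n k + p ^ (k + 1) * qb p n (k + 1) := by simp [qb]

lemma qb_eq_zero : ∀ {n k : ℕ}, n < k → qb p n k = 0
  | 0, k + 1, _ => by simp
  | n + 1, k + 1, h => by
    rw [qb_succ_succ, qb_eq_zero (by omega : n < k), qb_eq_zero (by omega : n < k + 1)]; simp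

@[simp] lemma qb_self : ∀ n : ℕ, qb p n n = 1
  | 0 => by simp
  | n + 1 => by rw [qb_succ_succ, qb_self n, qb_eq_zero (Nat.lt_succ_self n)]; simp

@[simp] lemma qi_zero : qi p 0 = 0 := by simp [qi]
@[simp] lemma qi_one : qi p 1 = 1 := by simp [qi]
lemma qi_succ (n : ℕ) : qi p (n + 1) = qi p n + p ^ n := by simp [qi, Finset.sum_range_succ]
lemma qi_add (m n : ℕ) : qi p (m + n) = qi p m + p ^ m * qi p n := by
  induction n with
  | zero => simp
  | succ n ih => rw [← add_assoc, qi_succ, ih, qi_succ, pow_add]; ring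
lemma qi_pos (hp : 0 < p) (n : ℕ) : 0 < qi p (n + 1) := by
  rw [qi]; exact Finset.sum_pos (fun i _ => by positivity) ⟨0, by simp⟩
lemma qi_mul (n : ℕ) : (1 - p) * qi p n = 1 - p ^ n := by
  induction n with
  | zero => simp
  | succ n ih => rw [qi_succ, mul_add, ih, pow_succ]; ring

lemma qf_succ (n : ℕ) : qf p (n + 1) = qf p n * qi p (n + 1) := by
  simp [qf, Finset.prod_range_succ]
@[simp] lemma qf_zero : qf p 0 = 1 := by simp [qf]
lemma qf_pos (hp : 0 < p) (n : ℕ) : 0 < qf p n :=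
  Finset.prod_pos fun i _ => qi_pos hp i

lemma qb_fact (m k : ℕ) : qb p (m + k) k * (qf p k * qf p m) = qf p (m + k) := by
  induction k generalizing m with
  | zero => simp
  | succ k ihk =>
    induction m with
    | zero => simp
    | succ m ihm =>
      have h1 := ihk (m + 1)
      have e1 : m + 1 + (k + 1) = (m + 1 + k) + 1 := by ring
      have e2 : m + (k + 1) = m + 1 + k := by ring
      rw [e2] at ihm
      rw [e1, qb_succ_succ, qf_succ (m + 1 + k)]
      have h3 : qi p (m + 1 + k + 1) = qi p (k + 1) + p ^ (k + 1) * qi p (m + 1) := by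
        rw [← qi_add]; congr 1; ring
      rw [h3, mul_add, ← h1]
      nth_rewrite 2 [h1]
      rw [← ihm, qf_succ k, qf_succ m]; ring

lemma qb_pos (hp : 0 < p) (m k : ℕ) : 0 < qb p (m + k) k := by
  have h := qb_fact (p := p) m k
  have := qf_pos hp (m + k)
  have h2 := mul_pos (qf_pos hp k) (qf_pos hp m)
  rw [← h] at this
  exact (pos_iff_pos_of_mul_pos this).mpr h2

lemma qb_eq (hp : 0 < p) (m k : ℕ) : qb p (m + k) k = qf p (m + k) / (qf p k * qf p m) := by
  have := qf_pos hp k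
  have := qf_pos hp m
  rw [eq_div_iff (by positivity), qb_fact]

lemma qb_symm (hp : 0 < p) (m k : ℕ) : qb p (m + k) k = qb p (m + k) m := by
  rw [qb_eq hp, add_comm m k, qb_eq hp, mul_comm]

lemma qb_mul (hp : 0 < p) (a b c : ℕ) :
    qb p (a + b + c) (b + c) * qb p (b + c) c = qb p (a + b + c) c * qb p (a + b) b := by
  have := qf_pos hp a
  have := qf_pos hp b
  have := qf_pos hp c
  have := qf_pos hp (b + c)
  have := qf_pos hp (a + b)
  rw [add_assoc, qb_eq hp, qb_eq hp, ← add_assoc, qb_eq hp, qb_eq hp]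
  field_simp

/-- the multinomial exchange used for shifting boxes -/
lemma qb_exch (hp : 0 < p) (c k e : ℕ) :
    qb p (c + (k + e) - 1) (k + e) * qb p (k + e) k
      = qb p (c + k - 1) k * qb p (c + (k + e) - 1) e := by
  cases c with
  | zero =>
    rcases Nat.eq_zero_or_pos k with rfl | hk
    · rcases Nat.eq_zero_or_pos e with rfl | he
      · simp
      · simp
    · rw [qb_eq_zero (by omega : 0 + (k + e) - 1 < k + e), qb_eq_zero (by omega : 0 + k - 1 < k)]
      simp
  | succ c =>
    have e1 : c + 1 + (k + e) - 1 = c + k + e := by omega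
    have e2 : c + 1 + k - 1 = c + k := by omega
    rw [e1, e2, ← qb_symm hp k e, qb_mul hp c k e, mul_comm]

lemma qb_succ_succ' (hp : 0 < p) (m k : ℕ) :
    qb p (m + k + 1) (k + 1) = p ^ m * qb p (m + k) k + qb p (m + k) (k + 1) := by
  cases m with
  | zero => simp [qb_eq_zero (Nat.lt_succ_self k)]
  | succ m =>
    have h1 : qb p (m + 1 + k + 1) (k + 1) = qb p (m + 1 + k + 1) (m + 1) := by
      rw [add_assoc, qb_symm hp (m + 1) (k + 1)]
    have h2 : qb p (m + 1 + k) k = qb p (m + 1 + k) (m + 1) := qb_symm hp _ _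
    have h3 : qb p (m + 1 + k) (k + 1) = qb p (m + 1 + k) m := by
      rw [show m + 1 + k = m + (k + 1) by ring, qb_symm hp m (k + 1)]
    rw [h1, h2, h3, qb_succ_succ]; ring

lemma qbinom_thm (hp : 0 < p) (y : ℝ) (a : ℕ) :
    ∑ c ∈ Finset.range (a + 1), y ^ (a - c) * p ^ (c.choose 2) * qb p a c = Rp p y a := by
  induction a with
  | zero => simp [Rp]
  | succ a ih =>
    have hR : Rp p y (a + 1) = Rp p y a * (y + p ^ a) := by simp [Rp, Finset.prod_range_succ]
    rw [hR, ← ih, Finset.sum_range_succ']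
    have key : ∀ c ∈ Finset.range (a + 1),
        y ^ (a + 1 - (c + 1)) * p ^ ((c + 1).choose 2) * qb p (a + 1) (c + 1)
          = y ^ (a - c) * p ^ (c.choose 2) * qb p a c * p ^ a
            + y ^ (a - c) * p ^ ((c + 1).choose 2) * qb p a (c + 1) := by
      intro c hc
      obtain ⟨m, rfl⟩ : ∃ m, a = m + c := ⟨a - c, by simp at hc; omega⟩
      rw [qb_succ_succ' hp, Nat.succ_sub_succ, Nat.choose_succ_succ' c 1, Nat.choose_one_right,
        pow_add, pow_add]
      ring
    rw [Finset.sum_congr rfl key, Finset.sum_add_distrib, mul_add, ← Finset.sum_mul]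
    rw [Finset.sum_range_succ (fun c => y ^ (a - c) * p ^ ((c + 1).choose 2) * qb p a (c + 1)),
      qb_eq_zero (Nat.lt_succ_self a)]
    have hy : (∑ c ∈ Finset.range (a + 1), y ^ (a - c) * p ^ (c.choose 2) * qb p a c) * y
        = (∑ c ∈ Finset.range a, y ^ (a - (c + 1)) * p ^ ((c + 1).choose 2) * qb p a (c + 1)
          + y ^ a) * y := by
      rw [Finset.sum_range_succ']; simp
    rw [hy]
    rw [add_mul _ _ y, Finset.sum_mul (f := fun c => y ^ (a - (c + 1)) * p ^ ((c + 1).choose 2) * qb p a (c + 1))]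
    have k2 : ∀ c ∈ Finset.range a, y ^ (a - (c + 1)) * p ^ ((c + 1).choose 2) * qb p a (c + 1) * y
        = y ^ (a - c) * p ^ ((c + 1).choose 2) * qb p a (c + 1) := by
      intro c hc
      have : a - c = (a - (c + 1)) + 1 := by simp at hc; omega
      rw [this, pow_succ]; ring
    rw [Finset.sum_congr rfl k2]
    simp [pow_succ]
    ring

lemma qvdm' (hp : 0 < p) (c b k : ℕ) :
    qb p (c + b) k = ∑ x ∈ Finset.HasAntidiagonal.antidiagonal k, p ^ (x.1 * (b - x.2)) * qb p c x.1 * qb p b x.2 := by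
  induction c generalizing k with
  | zero =>
    cases k with
    | zero => simp
    | succ k => rw [Finset.Nat.sum_antidiagonal_succ]; simp
  | succ c ih =>
    cases k with
    | zero => simp
    | succ k =>
      by_cases hk : k ≤ c + b
      · obtain ⟨m, hm⟩ : ∃ m, c + b = m + k := ⟨c + b - k, by omega⟩
        rw [show c + 1 + b = c + b + 1 by ring, hm, qb_succ_succ' hp, ← hm, ih k, ih (k + 1),
          Finset.Nat.sum_antidiagonal_succ, Finset.Nat.sum_antidiagonal_succ]
        simp only [Finset.mul_sum, Nat.succ_eq_add_one]
        rw [add_left_comm, ← Finset.sum_add_distrib]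
        congr 1
        · simp
        apply Finset.sum_congr rfl
        rintro ⟨i, j⟩ hij
        have hij := Finset.HasAntidiagonal.mem_antidiagonal.mp hij; simp only at hij
        by_cases hi : i ≤ c
        · by_cases hj : j ≤ b
          · obtain ⟨u, rfl⟩ : ∃ u, c = u + i := ⟨c - i, by omega⟩
            simp only
            rw [qb_succ_succ' hp u i]
            have : m = u + (b - j) := by omega
            rw [this, add_mul, one_mul, pow_add, pow_add]; ring
          · simp [qb_eq_zero (by omega : b < j)]
        · simp [qb_eq_zero (by omega : c < i), qb_eq_zero (by omega : c < i + 1),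
            qb_eq_zero (by omega : c + 1 < i + 1)]
      · rw [qb_eq_zero (by omega)]
        symm
        apply Finset.sum_eq_zero
        rintro ⟨i, j⟩ hij
        have hij := Finset.HasAntidiagonal.mem_antidiagonal.mp hij; simp only at hij
        by_cases hi : i ≤ c + 1
        · simp [qb_eq_zero (by omega : b < j)]
        · simp [qb_eq_zero (by omega : c + 1 < i)]

/-- q-Vandermonde -/
lemma qvdm (hp : 0 < p) (c b : ℕ) :
    qb p (c + b) (b + 1)
      = ∑ r ∈ Finset.range (b + 1), p ^ ((r + 1) * r) * qb p c (r + 1) * qb p b r := by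
  rw [qvdm' hp, Finset.Nat.sum_antidiagonal_succ]
  rw [qb_eq_zero (Nat.lt_succ_self b), Finset.Nat.sum_antidiagonal_eq_sum_range_succ_mk]
  simp only [mul_zero, zero_add, Nat.succ_eq_add_one]
  apply Finset.sum_congr rfl
  intro r hr
  obtain ⟨m, rfl⟩ : ∃ m, b = m + r := ⟨b - r, by simp at hr; omega⟩
  simp only [Nat.add_sub_cancel]
  rw [← qb_symm hp m r]
  congr 4
  omega

end PF

namespace PF
variable {p : ℝ}

/-- shifted products -/
noncomputable def Rt (p y : ℝ) (s m : ℕ) : ℝ := ∏ j ∈ Finset.range m, (y + p ^ (s + j))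

lemma Rp_add (y : ℝ) (s m : ℕ) : Rp p y (s + m) = Rp p y s * Rt p y s m := by
  simp [Rp, Rt, Finset.prod_range_add]

lemma choose_two_add (s d : ℕ) : (s + d).choose 2 = s.choose 2 + d.choose 2 + d * s := by
  induction d with
  | zero => simp
  | succ d ih =>
    rw [← add_assoc, Nat.choose_succ_succ' (s + d) 1, ih, Nat.choose_succ_succ' d 1]
    simp only [Nat.choose_one_right]; ring

lemma qbinom_shift (hp : 0 < p) (y : ℝ) (s m : ℕ) :
    ∑ d ∈ Finset.range (m + 1), y ^ (m - d) * p ^ ((s + d).choose 2) * qb p m d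
      = p ^ (s.choose 2) * Rt p y s m := by
  have h := qbinom_thm hp (y / p ^ s) m
  have e1 : Rt p y s m = (p ^ s) ^ m * Rp p (y / p ^ s) m := by
    have e0 : (p ^ s) ^ m = ∏ _j ∈ Finset.range m, p ^ s := by simp
    rw [Rt, Rp, e0, ← Finset.prod_mul_distrib]
    apply Finset.prod_congr rfl
    intro j _
    rw [pow_add]; field_simp
  rw [e1, ← h, Finset.mul_sum, Finset.mul_sum]
  apply Finset.sum_congr rfl
  intro d hd
  obtain ⟨k, rfl⟩ : ∃ k, m = k + d := ⟨m - d, by simp at hd; omega⟩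
  rw [choose_two_add, Nat.add_sub_cancel, pow_add, pow_add, pow_add, div_pow, mul_comm d s, pow_mul]
  field_simp

lemma inner_sum (hp : 0 < p) (y : ℝ) (a s t : ℕ) :
    ∑ c ∈ Finset.range (a + 1), y ^ (a - c) * p ^ ((c + t).choose 2) * (qb p a c * qb p c s)
      = qb p a s * (p ^ ((s + t).choose 2) * Rt p y (s + t) (a - s)) := by
  by_cases hs : s ≤ a
  · obtain ⟨m, rfl⟩ : ∃ m, a = s + m := ⟨a - s, by omega⟩
    rw [Nat.add_sub_cancel_left, ← qbinom_shift hp y, add_assoc s m, Finset.sum_range_add,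
      Finset.sum_eq_zero, zero_add, Finset.mul_sum]
    · apply Finset.sum_congr rfl
      intro d hd
      obtain ⟨k, rfl⟩ : ∃ k, m = k + d := ⟨m - d, by simp at hd; omega⟩
      have h := qb_mul hp k d s
      rw [show s + (k + d) = k + d + s by ring, show s + d = d + s by ring, h]
      rw [show k + d + s - (d + s) = k + d - d by omega, show d + s + t = s + t + d by ring]
      ring
    · intro c hc
      rw [qb_eq_zero (by simpa using hc : c < s)]; simp
  · rw [qb_eq_zero (by omega : a < s), zero_mul]
    apply Finset.sum_eq_zero
    intro c hc
    rw [qb_eq_zero (by simp at hc; omega : c < s)]; simp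

noncomputable def edge (p : ℝ) (a b : ℕ) : ℝ := p ^ (a.choose 2) * qb p (a + b - 1) b
noncomputable def Xk (p : ℝ) (a b k : ℕ) : ℝ :=
  p ^ ((a - k).choose 2) * qb p a k * qb p (a - k + b - 1) b
noncomputable def Yk (p : ℝ) (a b k : ℕ) : ℝ :=
  p ^ ((b - k).choose 2) * qb p (b - 1) k * qb p (a + (b - k) - 1) (b - k)
noncomputable def Xe (p y : ℝ) (a b : ℕ) : ℝ := ∑ k ∈ Finset.range (a + 1), y ^ k * Xk p a b k
noncomputable def Ye (p y : ℝ) (a b : ℕ) : ℝ := ∑ k ∈ Finset.range (b + 1), y ^ k * Yk p a b k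

lemma Xk_big {a b k : ℕ} (h : a < k) : Xk p a b k = 0 := by simp [Xk, qb_eq_zero h]
lemma Yk_big {a b k : ℕ} (h : b < k) : Yk p a b k = 0 := by
  simp [Yk, qb_eq_zero (by omega : b - 1 < k)]
lemma Xk_zero (a b : ℕ) : Xk p a b 0 = edge p a b := by simp [Xk, edge]

lemma Xe_zero_right (hp : 0 < p) (y : ℝ) (a : ℕ) : Xe p y a 0 = Rp p y a := by
  rw [Xe, ← qbinom_thm hp, ← Finset.sum_range_reflect]
  apply Finset.sum_congr rfl
  intro c hc
  obtain ⟨m, rfl⟩ : ∃ m, a = m + c := ⟨a - c, by simp at hc; omega⟩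
  have e : m + c + 1 - 1 - c = m := by omega
  rw [e]
  simp only [Xk, qb_zero_right, Nat.add_sub_cancel_left, Nat.add_sub_cancel]
  rw [qb_symm hp m c]; ring

@[simp] lemma Ye_zero_right (y : ℝ) (a : ℕ) : Ye p y a 0 = 1 := by simp [Ye, Yk]

lemma Xe_succ (hp : 0 < p) (y : ℝ) (a b : ℕ) : Xe p y a (b + 1) =
    ∑ r ∈ Finset.range (b + 1), p ^ ((r + 1) * r) * qb p b r * (qb p a (r + 1) *
      (p ^ ((r + 1).choose 2) * Rt p y (r + 1) (a - (r + 1)))) := by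
  have : ∀ r, qb p a (r + 1) * (p ^ ((r + 1).choose 2) * Rt p y (r + 1) (a - (r + 1)))
      = ∑ c ∈ Finset.range (a + 1), y ^ (a - c) * p ^ (c.choose 2) * (qb p a c * qb p c (r + 1)) :=
    fun r => (inner_sum hp y a (r + 1) 0).symm
  simp only [this, Finset.mul_sum]
  rw [Finset.sum_comm, Xe, ← Finset.sum_range_reflect]
  apply Finset.sum_congr rfl
  intro c hc
  obtain ⟨m, rfl⟩ : ∃ m, a = m + c := ⟨a - c, by simp at hc; omega⟩
  have e : m + c + 1 - 1 - c = m := by omega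
  have e2 : c + (b + 1) - 1 = c + b := by omega
  rw [e, Xk, Nat.add_sub_cancel_left, Nat.add_sub_cancel, e2, qvdm hp, ← qb_symm hp m c,
    Finset.mul_sum, Finset.mul_sum]
  exact Finset.sum_congr rfl fun r _ => by ring

lemma Ye_succ (hp : 0 < p) (y : ℝ) (a b : ℕ) : Ye p y a (b + 1) =
    ∑ r ∈ Finset.range (b + 1), p ^ ((r + 1) * r) * qb p a (r + 1) * (qb p b r *
      (p ^ ((r + 1).choose 2) * Rt p y (r + 1) (b - r))) := by
  have : ∀ r, qb p b r * (p ^ ((r + 1).choose 2) * Rt p y (r + 1) (b - r))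
      = ∑ c ∈ Finset.range (b + 1), y ^ (b - c) * p ^ ((c + 1).choose 2) * (qb p b c * qb p c r) :=
    fun r => (inner_sum hp y b r 1).symm
  simp only [this, Finset.mul_sum]
  rw [Finset.sum_comm, Ye, Finset.sum_range_succ, ← Finset.sum_range_reflect]
  have h0 : Yk p a (b + 1) (b + 1) = 0 := by simp [Yk, qb_eq_zero]
  rw [h0, mul_zero, add_zero]
  apply Finset.sum_congr rfl
  intro c hc
  obtain ⟨m, rfl⟩ : ∃ m, b = m + c := ⟨b - c, by simp at hc; omega⟩
  have e : m + c + 1 - 1 - c = m := by omega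
  have e2 : m + c + 1 - m = c + 1 := by omega
  have e3 : a + (c + 1) - 1 = a + c := by omega
  rw [e, Yk, e2, e3, Nat.add_sub_cancel, Nat.add_sub_cancel, qvdm hp, ← qb_symm hp m c,
    Finset.mul_sum, Finset.mul_sum]
  rw [Finset.range_eq_Ico, Finset.range_eq_Ico, 
    ← Finset.sum_Ico_consecutive _ (Nat.zero_le (c + 1)) (by omega : c + 1 ≤ m + c + 1)]
  rw [Finset.sum_eq_zero (s := Finset.Ico (c + 1) (m + c + 1)), add_zero]
  · exact Finset.sum_congr rfl fun r _ => by ring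
  · intro r hr
    rw [qb_eq_zero (by simp at hr; omega : c < r)]; simp

theorem edge_id (hp : 0 < p) (y : ℝ) (a b : ℕ) : Xe p y a b * Rp p y b = Ye p y a b * Rp p y a := by
  cases b with
  | zero => rw [Xe_zero_right hp]; simp [Rp]
  | succ b =>
    rw [Xe_succ hp, Ye_succ hp, Finset.sum_mul, Finset.sum_mul]
    apply Finset.sum_congr rfl
    intro r hr
    by_cases hra : r + 1 ≤ a
    · obtain ⟨m, rfl⟩ : ∃ m, a = r + 1 + m := ⟨a - (r + 1), by omega⟩
      obtain ⟨k, rfl⟩ : ∃ k, b = r + k := ⟨b - r, by simp at hr; omega⟩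
      rw [Rp_add y (r + 1) m, show r + k + 1 = r + 1 + k by ring, Rp_add y (r + 1) k, Nat.add_sub_cancel_left,
        Nat.add_sub_cancel_left]
      ring
    · rw [qb_eq_zero (by omega : a < r + 1)]; simp

lemma Rp_neg {a : ℕ} (h : 2 ≤ a) : Rp p (-p) a = 0 :=
  Finset.prod_eq_zero (Finset.mem_range.mpr h) (by simp)

lemma Xe_neg_one (hp : 0 < p) {a : ℕ} (h : 2 ≤ a) : Xe p (-p) a 1 = 0 := by
  rw [Xe_succ hp]
  have : Rt p (-p) 1 (a - 1) = 0 :=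
    Finset.prod_eq_zero (Finset.mem_range.mpr (by omega : 0 < a - 1)) (by simp)
  simp [this]

end PF

namespace PF
variable {p : ℝ}

/-- content vectors -/
noncomputable def BB (N : ℕ) (n : ℤ) : Finset (ℕ → ℕ) :=
  (Finset.piAntidiag (Finset.range (N + 1)) (N + 1)).filter
    fun b => 2 * (∑ j ∈ Finset.range (N + 1), (j : ℤ) * b j) + 2 * n = N * (N + 1)

lemma mem_BB {N : ℕ} {n : ℤ} {b : ℕ → ℕ} : b ∈ BB N n ↔
    (∑ j ∈ Finset.range (N + 1), b j = N + 1 ∧ ∀ j, N < j → b j = 0) ∧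
    2 * (∑ j ∈ Finset.range (N + 1), (j : ℤ) * b j) + 2 * n = N * (N + 1) := by
  rw [BB, Finset.mem_filter, Finset.mem_piAntidiag]
  apply and_congr_left
  intro _
  apply and_congr_right
  intro _
  constructor
  · intro h j hj
    by_contra hb
    have := h j hb
    simp at this; omega
  · intro h j hj
    by_contra hb
    exact hj (h j (by simp at hb; omega))

/-- X-weights -/
noncomputable def wtX (p : ℝ) (N : ℕ) (b κ : ℕ → ℕ) : ℝ :=
  ∏ j ∈ Finset.range (N + 1), Xk p (b j) (b (j + 1)) (κ j)

/-- Y-weights -/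
noncomputable def wtY (p : ℝ) (N : ℕ) (b κ : ℕ → ℕ) : ℝ :=
  ∏ j ∈ Finset.range (N + 1), (p ^ ((b j - κ (j + 1)).choose 2) * qb p (b j - 1) (κ (j + 1)) *
    qb p (b j + (b (j + 1) - κ (j + 2)) - 1) (b (j + 1) - κ (j + 2)))

lemma wtX_eq_wtY (hp : 0 < p) (N : ℕ) (b κ : ℕ → ℕ) (h0 : κ 0 = 0) (hN : ∀ j, N < j → κ j = 0)
    (hle : ∀ j, κ j ≤ b j) :
    wtX p N b κ = wtY p N (fun j => b j - κ j + κ (j + 1)) κ := by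
  have e1 : ∏ j ∈ Finset.range (N + 1), qb p (b j) (κ j)
      = ∏ j ∈ Finset.range (N + 1), qb p (b (j + 1)) (κ (j + 1)) := by
    rw [Finset.prod_range_succ', Finset.prod_range_succ, h0, hN (N + 1) (by omega)]
    simp
  have e2 : wtX p N b κ = ∏ j ∈ Finset.range (N + 1), (p ^ ((b j - κ j).choose 2) *
      (qb p (b j - κ j + b (j + 1) - 1) (b (j + 1)) * qb p (b (j + 1)) (κ (j + 1)))) := by
    simp only [Finset.prod_mul_distrib, ← e1]
    simp only [wtX, Xk, Finset.prod_mul_distrib]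
    ring
  rw [e2, wtY]
  apply Finset.prod_congr rfl
  intro j _
  have h := qb_exch hp (b j - κ j) (κ (j + 1)) (b (j + 1) - κ (j + 1))
  rw [Nat.add_sub_cancel' (hle (j + 1))] at h
  rw [h]
  have e3 : b j - κ j + κ (j + 1) - κ (j + 1) = b j - κ j := by omega
  have e4 : b (j + 1) - κ (j + 1) + κ (j + 1 + 1) - κ (j + 2) = b (j + 1) - κ (j + 1) := by
    have : κ (j + 1 + 1) = κ (j + 2) := rfl
    omega
  simp only [e3, e4]
  have e5 : b j - κ j + κ (j + 1) + (b (j + 1) - κ (j + 1)) - 1 = b j - κ j + b (j + 1) - 1 := by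
    have := hle (j + 1)
    omega
  rw [e5]; ring

lemma sum_shift (N : ℕ) (κ : ℕ → ℕ) (h0 : κ 0 = 0) (hN : ∀ j, N < j → κ j = 0) :
    ∑ j ∈ Finset.range (N + 1), κ (j + 1) = ∑ j ∈ Finset.range (N + 1), κ j := by
  rw [Finset.sum_range_succ, Finset.sum_range_succ' κ, h0, hN (N + 1) (by omega)]

lemma sum_shift' (N : ℕ) (κ : ℕ → ℕ) (h0 : κ 0 = 0) (hN : ∀ j, N < j → κ j = 0) :
    (∑ j ∈ Finset.range (N + 1), (j : ℤ) * κ (j + 1))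
      = (∑ j ∈ Finset.range (N + 1), (j : ℤ) * κ j) - ∑ j ∈ Finset.range (N + 1), (κ j : ℤ) := by
  have h1 : (∑ j ∈ Finset.range (N + 1), ((j + 1 : ℕ) : ℤ) * κ (j + 1))
      = ∑ j ∈ Finset.range (N + 1), (j : ℤ) * κ j := by
    rw [Finset.sum_range_succ' (fun j => (j : ℤ) * κ j), Finset.sum_range_succ,
      hN (N + 1) (by omega)]
    simp
  have h2 := sum_shift N κ h0 hN
  rw [← h1]
  have h3 : (∑ j ∈ Finset.range (N + 1), (κ j : ℤ)) = ∑ j ∈ Finset.range (N + 1), (κ (j + 1) : ℤ) := by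
    exact_mod_cast h2.symm
  rw [h3, ← Finset.sum_sub_distrib]
  exact Finset.sum_congr rfl fun j _ => by push_cast; ring

theorem shift (hp : 0 < p) (N : ℕ) (n : ℤ) (κ : ℕ → ℕ) (h0 : κ 0 = 0) (hN : ∀ j, N < j → κ j = 0)
    (ψ : (ℕ → ℕ) → ℝ) :
    ∑ b ∈ BB N n, wtX p N b κ * ψ b
      = ∑ b ∈ BB N (n + ∑ j ∈ Finset.range (N + 1), (κ j : ℤ)),
          wtY p N b κ * ψ (fun j => b j - κ (j + 1) + κ j) := by
  classical
  rw [← Finset.sum_filter_of_ne (p := fun b => ∀ j, κ j ≤ b j),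
    ← Finset.sum_filter_of_ne (p := fun b => ∀ j, κ (j + 1) ≤ b j)
      (f := fun b => wtY p N b κ * ψ (fun j => b j - κ (j + 1) + κ j))]
  rotate_left
  · intro b hb hne j
    by_contra hlt
    apply hne
    by_cases hj : j < N + 1
    · rw [wtY, Finset.prod_eq_zero (Finset.mem_range.mpr hj), zero_mul]
      rw [qb_eq_zero (by omega : b j - 1 < κ (j + 1))]; simp
    · rw [hN (j + 1) (by omega)] at hlt; omega
  · intro b hb hne j
    by_contra hlt
    apply hne
    by_cases hj : j < N + 1
    · rw [wtX, Finset.prod_eq_zero (Finset.mem_range.mpr hj), zero_mul]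
      exact Xk_big (by omega)
    · rw [hN j (by omega)] at hlt; omega
  apply Finset.sum_nbij' (fun b j => b j - κ j + κ (j + 1)) (fun b j => b j - κ (j + 1) + κ j)
  · intro b hb
    rw [Finset.mem_filter, mem_BB] at hb ⊢
    obtain ⟨⟨⟨hs, hz⟩, hw⟩, hle⟩ := hb
    have hc : ∀ j, ((b j - κ j + κ (j + 1) : ℕ) : ℤ) = b j - κ j + κ (j + 1) := by
      intro j; have := hle j; omega
    refine ⟨⟨⟨?_, ?_⟩, ?_⟩, ?_⟩
    · apply Nat.cast_injective (R := ℤ)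
      rw [Nat.cast_sum]
      simp only [hc, Finset.sum_add_distrib, Finset.sum_sub_distrib]
      have := sum_shift N κ h0 hN
      zify at this hs
      rw [this, hs]; push_cast; ring
    · intro j hj
      simp only [hz j hj, hN (j + 1) (by omega)]; omega
    · simp only [hc, mul_add, mul_sub, Finset.sum_add_distrib, Finset.sum_sub_distrib,
        sum_shift' N κ h0 hN]
      linarith
    · intro j; simp
  · intro b hb
    rw [Finset.mem_filter, mem_BB] at hb ⊢
    obtain ⟨⟨⟨hs, hz⟩, hw⟩, hle⟩ := hb
    have hc : ∀ j, ((b j - κ (j + 1) + κ j : ℕ) : ℤ) = b j - κ (j + 1) + κ j := by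
      intro j; have := hle j; omega
    refine ⟨⟨⟨?_, ?_⟩, ?_⟩, ?_⟩
    · apply Nat.cast_injective (R := ℤ)
      rw [Nat.cast_sum]
      simp only [hc, Finset.sum_add_distrib, Finset.sum_sub_distrib]
      have := sum_shift N κ h0 hN
      zify at this hs
      rw [this, hs]; push_cast; ring
    · intro j hj
      simp only [hz j hj, hN j (by omega)]; omega
    · simp only [hc, mul_add, mul_sub, Finset.sum_add_distrib, Finset.sum_sub_distrib,
        sum_shift' N κ h0 hN]
      linarith
    · intro j; simp
  · intro b hb
    rw [Finset.mem_filter] at hb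
    funext j
    have := hb.2 j
    simp only; omega
  · intro b hb
    rw [Finset.mem_filter] at hb
    funext j
    have := hb.2 j
    simp only; omega
  · intro b hb
    rw [Finset.mem_filter] at hb
    rw [wtX_eq_wtY hp N b κ h0 hN hb.2]
    congr 2
    funext j
    have := hb.2 j
    simp only; omega

/-- legit content vectors -/
def Legit (b : ℕ → ℕ) : Prop := ∀ j, b j = 0 → b (j + 1) = 0

lemma Xk_zero_left {b k : ℕ} (hb : b ≠ 0) : Xk p 0 b k = 0 := by
  rcases Nat.eq_zero_or_pos k with rfl | hk
  · simp [Xk, qb_eq_zero (by omega : b - 1 < b)]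
  · exact Xk_big hk
lemma Yk_zero_left {b k : ℕ} (hb : b ≠ 0) : Yk p 0 b k = 0 := by
  by_cases hk : k ≤ b - 1
  · simp [Yk, qb_eq_zero (by omega : b - k - 1 < b - k)]
  · simp [Yk, qb_eq_zero (by omega : b - 1 < k)]

lemma prod_nonlegit {N : ℕ} {b : ℕ → ℕ} (hz : ∀ j, N < j → b j = 0) (hb : ¬ Legit b)
    (f : ℕ → ℕ → ℕ → ℝ) (hf : ∀ j b, b ≠ 0 → f j 0 b = 0) :
    ∏ j ∈ Finset.range (N + 1), f j (b j) (b (j + 1)) = 0 := by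
  simp only [Legit, not_forall] at hb
  obtain ⟨j, h1, h2⟩ := hb
  by_cases hj : j < N + 1
  · apply Finset.prod_eq_zero (Finset.mem_range.mpr hj)
    rw [h1, hf _ _ h2]
  · exact absurd (hz (j + 1) (by omega)) h2

lemma wtY_eq (N : ℕ) (b κ : ℕ → ℕ) (hN : ∀ j, N < j → κ j = 0) (hz : ∀ j, N < j → b j = 0) :
    wtY p N b κ = p ^ ((b 0 - κ 1).choose 2) * qb p (b 0 - 1) (κ 1) *
      ∏ j ∈ Finset.range (N + 1), Yk p (b j) (b (j + 1)) (κ (j + 2)) := by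
  have h : ∏ j ∈ Finset.range (N + 1), (p ^ ((b j - κ (j + 1)).choose 2) * qb p (b j - 1) (κ (j + 1)))
      = p ^ ((b 0 - κ 1).choose 2) * qb p (b 0 - 1) (κ 1) * ∏ j ∈ Finset.range (N + 1),
        (p ^ ((b (j + 1) - κ (j + 2)).choose 2) * qb p (b (j + 1) - 1) (κ (j + 2))) := by
    rw [Finset.prod_range_succ', Finset.prod_range_succ _ N, hN (N + 2) (by omega),
      hz (N + 1) (by omega)]
    simp
    ring
  rw [wtY, Finset.prod_mul_distrib, h]
  simp only [Yk, Finset.prod_mul_distrib]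
  ring

lemma Legit.zero_of_le {b : ℕ → ℕ} (h : Legit b) {i j : ℕ} (hij : i ≤ j) (hi : b i = 0) : b j = 0 := by
  induction hij with
  | refl => exact hi
  | step _ ih => exact h _ ih

lemma abel (b : ℕ → ℕ) (M : ℕ) :
    ∑ j ∈ Finset.range M, j * b j + ∑ j ∈ Finset.range M, ∑ i ∈ Finset.range (j + 1), b i
      = M * ∑ i ∈ Finset.range M, b i := by
  induction M with
  | zero => simp
  | succ M ih =>
    rw [Finset.sum_range_succ, Finset.sum_range_succ (fun j => ∑ i ∈ Finset.range (j + 1), b i)]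
    have : ∑ i ∈ Finset.range (M + 1), b i = ∑ i ∈ Finset.range M, b i + b M := Finset.sum_range_succ _ _
    rw [this]
    linarith

lemma sum_gauss (N : ℕ) : 2 * ∑ j ∈ Finset.range (N + 1), ((j : ℤ) + 1) = (N + 1) * (N + 2) := by
  induction N with
  | zero => simp
  | succ N ih => rw [Finset.sum_range_succ, mul_add, ih]; push_cast; ring

lemma n_eq {N : ℕ} {n : ℤ} {b : ℕ → ℕ} (hb : b ∈ BB N n) :
    n = ∑ j ∈ Finset.range (N + 1), ((∑ i ∈ Finset.range (j + 1), (b i : ℤ)) - ((j : ℤ) + 1)) := by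
  rw [mem_BB] at hb
  obtain ⟨⟨hs, hz⟩, hw⟩ := hb
  have h := abel b (N + 1)
  have g := sum_gauss N
  rw [hs] at h
  zify at h
  rw [Finset.sum_sub_distrib]
  push_cast at h
  nlinarith

lemma Legit.partial {N : ℕ} {n : ℤ} {b : ℕ → ℕ} (hb : b ∈ BB N n) (hl : Legit b) {j : ℕ}
    (hj : j < N + 1) : j + 1 ≤ ∑ i ∈ Finset.range (j + 1), b i := by
  rw [mem_BB] at hb
  obtain ⟨⟨hs, hz⟩, hw⟩ := hb
  by_cases h0 : b j = 0
  · have : ∑ i ∈ Finset.range (N + 1), b i = ∑ i ∈ Finset.range (j + 1), b i := by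
      symm
      apply Finset.sum_subset
      · simpa using by omega
      · intro i _ hi
        exact hl.zero_of_le (by simp at hi; omega : j ≤ i) h0
    omega
  · calc j + 1 = ∑ i ∈ Finset.range (j + 1), 1 := by simp
      _ ≤ _ := Finset.sum_le_sum fun i hi => by
        by_contra hlt
        exact h0 (hl.zero_of_le (by simp at hi; omega : i ≤ j) (by omega))

lemma Legit.partial' {N : ℕ} {n : ℤ} {b : ℕ → ℕ} (hb : b ∈ BB N n) (hl : Legit b) {j k : ℕ}
    (hj : j < N) (hk : k ≤ j) (hbk : b k ≠ 1) : j + 2 ≤ ∑ i ∈ Finset.range (j + 1), b i := by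
  rw [mem_BB] at hb
  obtain ⟨⟨hs, hz⟩, hw⟩ := hb
  by_cases h0 : b j = 0
  · have : ∑ i ∈ Finset.range (N + 1), b i = ∑ i ∈ Finset.range (j + 1), b i := by
      symm
      apply Finset.sum_subset
      · simpa using by omega
      · intro i _ hi
        exact hl.zero_of_le (by simp at hi; omega : j ≤ i) h0
    omega
  · have hpos : ∀ i ≤ j, 1 ≤ b i := fun i hi => by
      by_contra hlt
      exact h0 (hl.zero_of_le hi (by omega))
    have : ∑ i ∈ Finset.range (j + 1), 1 < ∑ i ∈ Finset.range (j + 1), b i :=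
      Finset.sum_lt_sum (fun i hi => hpos i (by simp at hi; omega))
        ⟨k, by simp; omega, by have := hpos k hk; omega⟩
    simp at this; omega

lemma Legit.nonneg {N : ℕ} {n : ℤ} {b : ℕ → ℕ} (hb : b ∈ BB N n) (hl : Legit b) : 0 ≤ n := by
  rw [n_eq hb]
  apply Finset.sum_nonneg
  intro j hj
  have := hl.partial hb (Finset.mem_range.mp hj)
  zify at this
  linarith

lemma Legit.ones {N : ℕ} {n : ℤ} {b : ℕ → ℕ} (hb : b ∈ BB N n) (hl : Legit b) (hn : n + 3 ≤ N) {k : ℕ}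
    (hk : k ≤ 2) : b k = 1 := by
  by_contra hbk
  have h1 := n_eq hb
  have hn0 := hl.nonneg hb
  obtain ⟨M, rfl⟩ : ∃ M, N = 2 + M := ⟨N - 2, by omega⟩
  rw [Finset.sum_range_succ] at h1
  rw [Finset.sum_range_add] at h1
  have hp1 : ∀ j < 2 + M + 1, 0 ≤ (∑ i ∈ Finset.range (j + 1), (b i : ℤ)) - ((j : ℤ) + 1) := by
    intro j hj
    have := hl.partial hb hj
    zify at this
    linarith
  have h2 : 0 ≤ ∑ j ∈ Finset.range 2, ((∑ i ∈ Finset.range (j + 1), (b i : ℤ)) - ((j : ℤ) + 1)) :=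
    Finset.sum_nonneg fun j hj => hp1 j (by simp at hj; omega)
  have h3 := hp1 (2 + M) (by omega)
  have h4 : ∑ j ∈ Finset.range M, (1 : ℤ) ≤
      ∑ x ∈ Finset.range M, (∑ i ∈ Finset.range (2 + x + 1), (b i : ℤ) - (((2 + x : ℕ) : ℤ) + 1)) := by
    apply Finset.sum_le_sum
    intro j hj
    have := hl.partial' hb (j := 2 + j) (k := k) (by simp at hj; omega) (by omega) hbk
    zify at this
    push_cast at this ⊢
    linarith
  rw [Finset.sum_const, Finset.card_range, nsmul_one] at h4
  push_cast at hn h1 h3 h4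
  linarith

lemma Legit.last {N : ℕ} {n : ℤ} {b : ℕ → ℕ} (hb : b ∈ BB N n) (hl : Legit b) : b N ≤ 1 := by
  have hs := (mem_BB.mp hb).1.1
  rcases Nat.eq_zero_or_pos N with rfl | hN
  · simp at hs; omega
  · obtain ⟨M, rfl⟩ : ∃ M, N = M + 1 := ⟨N - 1, by omega⟩
    have := hl.partial hb (j := M) (by omega)
    rw [Finset.sum_range_succ] at hs
    omega

end PF

namespace PF
variable {p : ℝ}

def KK (N : ℕ) : Finset (Fin N → ℕ) := Fintype.piFinset fun _ => Finset.range (N + 2)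

def kext {N : ℕ} (g : Fin N → ℕ) (j : ℕ) : ℕ :=
  if h : 1 ≤ j ∧ j ≤ N then g ⟨j - 1, by omega⟩ else 0

@[simp] lemma kext_zero {N : ℕ} (g : Fin N → ℕ) : kext g 0 = 0 := by simp [kext]
lemma kext_big {N : ℕ} (g : Fin N → ℕ) (j : ℕ) (h : N < j) : kext g j = 0 := by
  rw [kext, dif_neg]; omega
@[simp] lemma kext_succ {N : ℕ} (g : Fin N → ℕ) (i : Fin N) : kext g (i + 1) = g i := by
  rw [kext, dif_pos (by omega)]; congr 1

lemma kext_sum {N : ℕ} (g : Fin N → ℕ) : ∑ j ∈ Finset.range (N + 1), kext g j = ∑ i, g i := by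
  rw [Finset.sum_range_succ', kext_zero, add_zero, Finset.sum_range]
  simp

lemma kk_prod (N : ℕ) (y : ℝ) (F : ℕ → ℕ → ℝ) :
    ∑ g ∈ KK N, y ^ (∑ i, g i) * ∏ i ∈ Finset.range N, F i (kext g (i + 1))
      = ∏ i ∈ Finset.range N, ∑ k ∈ Finset.range (N + 2), y ^ k * F i k := by
  rw [Finset.prod_range, Finset.prod_univ_sum, KK]
  apply Finset.sum_congr rfl
  intro g _
  rw [Finset.prod_range, Finset.prod_mul_distrib, Finset.prod_pow_eq_pow_sum]
  simp

noncomputable def EE (p : ℝ) (N : ℕ) (κ : ℕ → ℕ) (n : ℤ) : ℝ := ∑ b ∈ BB N n, wtX p N b κ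

noncomputable def theta (p : ℝ) (N : ℕ) (y : ℝ) (n : ℤ) : ℝ :=
  ∑ b ∈ BB N n, edge p (b 0) (b 1) * ∏ i ∈ Finset.range N, Xe p y (b (i + 1)) (b (i + 2))

lemma BB_le {N : ℕ} {n : ℤ} {b : ℕ → ℕ} (hb : b ∈ BB N n) (j : ℕ) : b j ≤ N + 1 := by
  rw [mem_BB] at hb
  by_cases hj : j < N + 1
  · rw [← hb.1.1]
    exact Finset.single_le_sum (f := b) (fun i _ => Nat.zero_le _) (Finset.mem_range.mpr hj)
  · rw [hb.1.2 j (by omega)]; omega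

lemma Xe_eq (y : ℝ) {a b M : ℕ} (h : a ≤ M) :
    Xe p y a b = ∑ k ∈ Finset.range (M + 1), y ^ k * Xk p a b k := by
  apply Finset.sum_subset
  · simpa using by omega
  · intro k _ hk
    rw [Xk_big (by simp at hk; omega), mul_zero]

lemma Ye_eq (y : ℝ) {a b M : ℕ} (h : b ≤ M) :
    Ye p y a b = ∑ k ∈ Finset.range (M + 1), y ^ k * Yk p a b k := by
  apply Finset.sum_subset
  · simpa using by omega
  · intro k _ hk
    rw [Yk_big (by simp at hk; omega), mul_zero]

lemma wtX_kext {N : ℕ} (b : ℕ → ℕ) (g : Fin N → ℕ) : wtX p N b (kext g) =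
    edge p (b 0) (b 1) * ∏ i ∈ Finset.range N, Xk p (b (i + 1)) (b (i + 2)) (kext g (i + 1)) := by
  rw [wtX, Finset.prod_range_succ', kext_zero, Xk_zero]; ring

lemma theta_eq (N : ℕ) (y : ℝ) (n : ℤ) :
    theta p N y n = ∑ g ∈ KK N, y ^ (∑ i, g i) * EE p N (kext g) n := by
  simp only [EE, Finset.mul_sum]
  rw [Finset.sum_comm, theta]
  apply Finset.sum_congr rfl
  intro b hb
  have := kk_prod N y (fun i k => Xk p (b (i + 1)) (b (i + 2)) k)
  rw [Finset.prod_congr rfl fun i _ => Xe_eq y (BB_le hb (i + 1)), ← this, Finset.mul_sum]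
  apply Finset.sum_congr rfl
  intro g _
  rw [wtX_kext]; ring

lemma wtX_nonlegit {N : ℕ} {b : ℕ → ℕ} (hz : ∀ j, N < j → b j = 0) (hb : ¬ Legit b) (κ : ℕ → ℕ) :
    wtX p N b κ = 0 :=
  prod_nonlegit hz hb (fun j a b => Xk p a b (κ j)) fun _ _ h => Xk_zero_left h

lemma EE_neg {N : ℕ} {n : ℤ} (hn : n < 0) (κ : ℕ → ℕ) : EE p N κ n = 0 := by
  apply Finset.sum_eq_zero
  intro b hb
  apply wtX_nonlegit (mem_BB.mp hb).1.2
  intro hl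
  have := hl.nonneg hb
  omega

lemma EE_shift (hp : 0 < p) (N : ℕ) (n : ℤ) {g : Fin N → ℕ} :
    EE p N (kext g) (n - (∑ i, g i : ℕ)) = ∑ b ∈ BB N n, wtY p N b (kext g) := by
  have h := shift hp N (n - (∑ i, g i : ℕ)) (kext g) (kext_zero g) (kext_big g) (fun _ => 1)
  simp only [mul_one] at h
  rw [EE, h]
  have : (∑ j ∈ Finset.range (N + 1), (kext g j : ℤ)) = (∑ i, g i : ℕ) := by
    rw [← kext_sum]; push_cast; rfl
  rw [this, sub_add_cancel]

lemma Ye_one (y : ℝ) (a : ℕ) : Ye p y a 1 = Yk p a 1 0 := by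
  rw [Ye, Finset.sum_range_succ, Finset.sum_range_succ]
  simp [Yk]

lemma telescope (hp : 0 < p) {y : ℝ} (b : ℕ → ℕ) (M : ℕ) :
    (∏ i ∈ Finset.range M, Xe p y (b i) (b (i + 1))) * Rp p y (b M)
      = Rp p y (b 0) * ∏ i ∈ Finset.range M, Ye p y (b i) (b (i + 1)) := by
  induction M with
  | zero => simp
  | succ M ih =>
    rw [Finset.prod_range_succ, mul_assoc, edge_id hp, Finset.prod_range_succ]
    calc _ = (∏ i ∈ Finset.range M, Xe p y (b i) (b (i + 1))) * Rp p y (b M)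
          * Ye p y (b M) (b (M + 1)) := by ring
      _ = _ := by rw [ih]; ring

lemma sumY (N : ℕ) (y : ℝ) {n : ℤ} {b : ℕ → ℕ} (hb : b ∈ BB N n) (hl : Legit b)
    (hn : n + 3 ≤ N) :
    ∑ g ∈ KK N, y ^ (∑ i, g i) * wtY p N b (kext g)
      = ∏ i ∈ Finset.range N, Ye p y (b i) (b (i + 1)) := by
  have hn0 := hl.nonneg hb
  obtain ⟨M, rfl⟩ : ∃ M, N = M + 1 := ⟨N - 1, by omega⟩
  have hz := (mem_BB.mp hb).1.2
  have h0 : b 0 = 1 := hl.ones hb hn (by omega)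
  have hlast := hl.last hb
  let F : ℕ → ℕ → ℝ := fun i k => match i with
    | 0 => p ^ ((b 0 - k).choose 2) * qb p (b 0 - 1) k
    | i + 1 => Yk p (b i) (b (i + 1)) k
  have hY : Ye p y (b M) (b (M + 1)) = Yk p (b M) (b (M + 1)) 0 := by
    interval_cases h : b (M + 1)
    · simp [Yk]
    · exact Ye_one y _
  have hw : ∀ g ∈ KK (M + 1), y ^ (∑ i, g i) * wtY p (M + 1) b (kext g)
      = Ye p y (b M) (b (M + 1)) * 
        (y ^ (∑ i, g i) * ∏ i ∈ Finset.range (M + 1), F i (kext g (i + 1))) := by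
    intro g _
    rw [wtY_eq _ _ _ (kext_big g) hz, Finset.prod_range_succ' _ M]
    rw [Finset.prod_range_succ _ (M + 1), Finset.prod_range_succ _ M, kext_big g (M + 2) (by omega),
      kext_big g (M + 1 + 2) (by omega), hz (M + 1 + 1) (by omega), hY]
    have : Yk p (b (M + 1)) 0 0 = 1 := by simp [Yk]
    rw [this]
    simp only [F]
    ring
  rw [Finset.sum_congr rfl hw, ← Finset.mul_sum, kk_prod, Finset.prod_range_succ', 
    Finset.prod_range_succ _ M, mul_comm]
  congr 1
  have h1 : ∑ k ∈ Finset.range (M + 1 + 2), y ^ k * F 0 k = 1 := by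
    rw [Finset.sum_eq_single 0]
    · simp [F, h0]
    · intro k _ hk
      obtain ⟨k, rfl⟩ := Nat.exists_eq_succ_of_ne_zero hk
      simp [F, h0]
    · simp
  rw [h1, mul_one]
  apply Finset.prod_congr rfl
  intro i _
  rw [Ye_eq y (BB_le hb (i + 1))]

lemma theta_rec (hp : 0 < p) (N : ℕ) (y : ℝ) {n : ℤ} (hn : n + 3 ≤ N) :
    theta p N y n = (1 + y) * ∑ g ∈ KK N, y ^ (∑ i, g i) * EE p N (kext g) (n - (∑ i, g i : ℕ)) := by
  simp only [EE_shift hp, Finset.mul_sum]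
  have hsw : ∑ g ∈ KK N, ∑ b ∈ BB N n, (1 + y) * (y ^ (∑ i, g i) * wtY p N b (kext g))
      = ∑ b ∈ BB N n, (1 + y) * ∑ g ∈ KK N, y ^ (∑ i, g i) * wtY p N b (kext g) := by
    rw [Finset.sum_comm]; simp only [Finset.mul_sum]
  rw [hsw, theta]
  apply Finset.sum_congr rfl
  intro b hb
  have hz := (mem_BB.mp hb).1.2
  by_cases hl : Legit b
  · rw [sumY N y hb hl hn]
    have hn0 := hl.nonneg hb
    have h0 : b 0 = 1 := hl.ones hb hn (by omega)
    have h1 : b 1 = 1 := hl.ones hb hn (by omega)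
    have ht := telescope hp (y := y) (fun i => b (i + 1)) N
    simp only [hz (N + 1) (by omega), zero_add, h1] at ht
    have e0 : Rp p y 0 = 1 := by simp [Rp]
    have e1 : Rp p y 1 = 1 + y := by simp [Rp, add_comm]
    rw [e0, mul_one, e1] at ht
    rw [ht, h0, h1]
    have e2 : edge p 1 1 = 1 := by simp [edge]
    have e3 : Ye p y 1 1 = 1 := by rw [Ye_one]; simp [Yk]
    rw [e2, one_mul]
    obtain ⟨M, rfl⟩ : ∃ M, N = M + 1 := ⟨N - 1, by omega⟩
    rw [Finset.prod_range_succ, hz (M + 1 + 1) (by omega), Ye_zero_right, Finset.prod_range_succ' _ M]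
    simp only [zero_add, h0, h1, e3]
  · rw [Finset.sum_eq_zero, mul_zero]
    · have : (∏ i ∈ Finset.range (N + 1), if i = 0 then edge p (b i) (b (i + 1)) else
          Xe p y (b i) (b (i + 1))) = 0 := by
        apply prod_nonlegit hz hl (fun i a c => if i = 0 then edge p a c else Xe p y a c)
        intro j c hc
        simp [Xe, Xk_zero_left hc, ← Xk_zero]
      rw [Finset.prod_range_succ'] at this
      simpa [mul_comm] using this
    · intro g _
      rw [wtY_eq _ _ _ (kext_big g) hz, 
        prod_nonlegit hz hl (fun j a c => Yk p a c (kext g (j + 2)))]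
      · simp
      · intro j c hc; exact Yk_zero_left hc

/-- elementary symmetric type sums -/
noncomputable def eps (p : ℝ) (N k : ℕ) (n : ℤ) : ℝ :=
  ∑ g ∈ (KK N).filter (fun g => ∑ i, g i = k), EE p N (kext g) n

lemma eps_neg {N k : ℕ} {n : ℤ} (hn : n < 0) : eps p N k n = 0 :=
  Finset.sum_eq_zero fun _ _ => EE_neg hn _

lemma KK_sum {N : ℕ} {g : Fin N → ℕ} (hg : g ∈ KK N) : ∑ i, g i < N * (N + 1) + 1 := by
  rw [KK, Fintype.mem_piFinset] at hg
  have : ∑ i, g i ≤ ∑ _i : Fin N, (N + 1) := Finset.sum_le_sum fun i _ => by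
    have := hg i; simp at this; omega
  simp at this; omega

lemma eps_big {N k : ℕ} {n : ℤ} (hk : N * (N + 1) + 1 ≤ k) : eps p N k n = 0 := by
  rw [eps, Finset.filter_false_of_mem, Finset.sum_empty]
  intro g hg
  have := KK_sum hg
  omega

lemma KK_fiber (N : ℕ) (f : (Fin N → ℕ) → ℝ) {M : ℕ} (hM : N * (N + 1) + 1 ≤ M) :
    ∑ g ∈ KK N, f g = ∑ k ∈ Finset.range M, ∑ g ∈ (KK N).filter (fun g => ∑ i, g i = k), f g := by
  symm
  apply Finset.sum_fiberwise_of_maps_to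
  intro g hg
  have := KK_sum hg
  simp only [Finset.mem_range]; omega

lemma theta_eps (N : ℕ) (y : ℝ) (n : ℤ) {M : ℕ} (hM : N * (N + 1) + 1 ≤ M) :
    theta p N y n = ∑ k ∈ Finset.range M, y ^ k * eps p N k n := by
  rw [theta_eq, KK_fiber N _ hM]
  apply Finset.sum_congr rfl
  intro k _
  rw [eps, Finset.mul_sum]
  apply Finset.sum_congr rfl
  intro g hg
  rw [(Finset.mem_filter.mp hg).2]

lemma theta_eps' (hp : 0 < p) (N : ℕ) (y : ℝ) {n : ℤ} (hn : n + 3 ≤ N) {M : ℕ}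
    (hM : N * (N + 1) + 1 ≤ M) :
    theta p N y n = (1 + y) * ∑ k ∈ Finset.range M, y ^ k * eps p N k (n - k) := by
  rw [theta_rec hp N y hn, KK_fiber N _ hM]
  congr 1
  apply Finset.sum_congr rfl
  intro k _
  rw [eps, Finset.mul_sum]
  apply Finset.sum_congr rfl
  intro g hg
  rw [(Finset.mem_filter.mp hg).2]

theorem eps_rec (hp : 0 < p) (N k : ℕ) {n : ℤ} (hn : n + 3 ≤ N) :
    eps p N (k + 1) n = eps p N (k + 1) (n - (k + 1)) + eps p N k (n - k) := by
  open Polynomial in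
  let M := N * (N + 1) + 1 + k + 1
  have hM : N * (N + 1) + 1 ≤ M := by omega
  let P : Polynomial ℝ := ∑ i ∈ Finset.range M, X ^ i * C (eps p N i n)
  let Q : Polynomial ℝ := ∑ i ∈ Finset.range M, X ^ i * C (eps p N i (n - i))
  have hPQ : P = (1 + X) * Q := by
    apply Polynomial.funext
    intro y
    have h1 := theta_eps (p := p) N y n hM
    have h2 := theta_eps' hp N y hn hM
    rw [h1] at h2
    simp only [P, Q, eval_mul, eval_add, eval_one, eval_X, eval_finset_sum, eval_pow, eval_C]
    exact h2
  have hc := congrArg (fun R => coeff R (k + 1)) hPQ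
  simp only [add_mul, one_mul, coeff_add, coeff_X_mul] at hc
  simp only [P, Q, finset_sum_coeff, coeff_mul_C, coeff_X_pow] at hc
  simp only [ite_mul, one_mul, zero_mul, Finset.sum_ite_eq, Finset.mem_range] at hc
  rw [if_pos (by omega), if_pos (by omega), if_pos (by omega)] at hc
  rw [hc]; push_cast; ring

end PF

namespace PF
variable {p : ℝ}

lemma theta_neg (hp : 0 < p) {N : ℕ} {n : ℤ} (hn : n + 3 ≤ N) (hN : 3 ≤ N) :
    theta p N (-p) n = if n = 0 then 1 - p else 0 := by
  let o : ℕ → ℕ := fun j => if j ≤ N then 1 else 0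
  have hg := sum_gauss N
  have ho1 : ∑ j ∈ Finset.range (N + 1), o j = N + 1 := by
    rw [Finset.sum_congr rfl (g := fun _ => 1)]
    · simp
    · intro j hj; simp at hj; simp [o]; omega
  have ho2 : ∑ j ∈ Finset.range (N + 1), (j : ℤ) * o j = ∑ j ∈ Finset.range (N + 1), ((j : ℤ) + 1) - (N + 1) := by
    rw [Finset.sum_congr rfl (g := fun j : ℕ => (j : ℤ))]
    · simp [Finset.sum_add_distrib]
    · intro j hj; simp at hj; simp [o]; omega
  have ho : o ∈ BB N n ↔ n = 0 := by
    rw [mem_BB, ho2]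
    constructor
    · rintro ⟨_, h⟩; nlinarith
    · intro h
      refine ⟨⟨ho1, fun j hj => by simp [o]; omega⟩, ?_⟩
      rw [h]; nlinarith
  have hval : edge p (o 0) (o 1) * ∏ i ∈ Finset.range N, Xe p (-p) (o (i + 1)) (o (i + 2)) = 1 - p := by
    obtain ⟨M, rfl⟩ : ∃ M, N = M + 1 := ⟨N - 1, by omega⟩
    have e2 : edge p 1 1 = 1 := by simp [edge]
    rw [Finset.prod_range_succ, Finset.prod_eq_one]
    · simp [o, e2, Xe_zero_right hp, Rp]; ring
    · intro i hi
      have : i < M := by simpa using hi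
      have h1 : o (i + 1) = 1 := by simp [o]; omega
      have h2 : o (i + 2) = 1 := by simp [o]; omega
      rw [h1, h2, Xe, Finset.sum_range_succ, Finset.sum_range_succ]
      simp [Xk]
  have key : ∀ b ∈ BB N n, b ≠ o →
      edge p (b 0) (b 1) * ∏ i ∈ Finset.range N, Xe p (-p) (b (i + 1)) (b (i + 2)) = 0 := by
    intro b hb hbo
    by_contra hne
    apply hbo
    have hz := (mem_BB.mp hb).1.2
    have hs := (mem_BB.mp hb).1.1
    have hl : Legit b := by
      by_contra hl
      apply hne
      have : (∏ i ∈ Finset.range (N + 1), if i = 0 then edge p (b i) (b (i + 1)) else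
          Xe p (-p) (b i) (b (i + 1))) = 0 := by
        apply prod_nonlegit hz hl (fun i a c => if i = 0 then edge p a c else Xe p (-p) a c)
        intro j c hc
        simp [Xe, Xk_zero_left hc, ← Xk_zero]
      rw [Finset.prod_range_succ'] at this
      simpa [mul_comm] using this
    have h0 : b 0 = 1 := hl.ones hb hn (by omega)
    have hne2 := right_ne_zero_of_mul hne
    rw [Finset.prod_ne_zero_iff] at hne2
    have hle1 : ∀ d j, 1 ≤ j → j + d = N + 1 → b j ≤ 1 := by
      intro d
      induction d with
      | zero => intro j _ hj; rw [hz j (by omega)]; omega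
      | succ d ih =>
        intro j hj1 hj
        have h1 := ih (j + 1) (by omega) (by omega)
        obtain ⟨i, rfl⟩ : ∃ i, j = i + 1 := ⟨j - 1, by omega⟩
        have h2 := hne2 i (by simp; omega)
        by_contra hge
        apply h2
        have hc : b (i + 2) = 0 ∨ b (i + 2) = 1 := by
          have : b (i + 2) ≤ 1 := h1
          omega
        rcases hc with hc | hc
        · rw [hc, Xe_zero_right hp, Rp_neg (by omega)]
        · rw [hc, Xe_neg_one hp (by omega)]
    have hle : ∀ j ∈ Finset.range (N + 1), b j ≤ o j := by
      intro j hj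
      have hj : j < N + 1 := by simpa using hj
      have : o j = 1 := by simp [o]; omega
      rw [this]
      rcases Nat.eq_zero_or_pos j with rfl | hpos
      · omega
      · exact hle1 (N + 1 - j) j hpos (by omega)
    have := (Finset.sum_eq_sum_iff_of_le hle).mp (by rw [hs, ho1])
    funext j
    by_cases hj : j < N + 1
    · exact this j (by simpa using hj)
    · rw [hz j (by omega)]; simp [o]; omega
  rw [theta]
  split_ifs with h
  · rw [Finset.sum_eq_single o key, hval]
    intro hh; exact absurd (ho.mpr h) hh
  · apply Finset.sum_eq_zero
    intro b hb
    apply key b hb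
    rintro rfl
    exact h (ho.mp hb)

noncomputable def AA (p : ℝ) (N : ℕ) (j : ℕ) (m : ℤ) : ℝ :=
  ∑ k ∈ Finset.range (N * (N + 1) + 1), (-p) ^ k * eps p N k (m - j * k)

lemma AA_eq (N j : ℕ) (m : ℤ) : AA p N j m =
    ∑ k ∈ Finset.range (N * (N + 1) + 1 + 1), (-p) ^ k * eps p N k (m - j * k) := by
  rw [Finset.sum_range_succ, eps_big le_rfl, mul_zero, add_zero, AA]

lemma AA_rec (hp : 0 < p) {N : ℕ} (j : ℕ) {m : ℤ} (hm : m + 3 ≤ N) :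
    AA p N j m = AA p N (j + 1) m - p * AA p N (j + 1) (m - j) := by
  rw [AA_eq, AA_eq N (j + 1) m, Finset.sum_range_succ', Finset.sum_range_succ' _ (N * (N + 1) + 1)]
  rw [AA, Finset.mul_sum, add_sub_right_comm, ← Finset.sum_sub_distrib]
  simp only [Nat.cast_zero, mul_zero]
  congr 1
  apply Finset.sum_congr rfl
  intro k _
  rw [eps_rec hp N k (by push_cast; nlinarith)]
  have e1 : m - (j : ℤ) * ((k + 1 : ℕ) : ℤ) - (k + 1) = m - ((j + 1 : ℕ) : ℤ) * ((k + 1 : ℕ) : ℤ) := by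
    push_cast; ring
  have e2 : m - (j : ℤ) * ((k + 1 : ℕ) : ℤ) - k = m - (j : ℤ) - ((j + 1 : ℕ) : ℤ) * (k : ℤ) := by
    push_cast; ring
  rw [e1, e2, pow_succ]; ring

lemma AA_neg {N : ℕ} (j : ℕ) {m : ℤ} (hm : m < 0) : AA p N j m = 0 := by
  apply Finset.sum_eq_zero
  intro k _
  rw [eps_neg (by nlinarith), mul_zero]

lemma AA_one (hp : 0 < p) (hp1 : p < 1) {N : ℕ} {m : ℤ} (hm : m + 3 ≤ N) (hN : 3 ≤ N) :
    AA p N 1 m = if m = 0 then 1 else 0 := by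
  have h := AA_rec hp 0 hm
  have h2 := theta_neg hp hm hN
  rw [theta_eps N (-p) m le_rfl] at h2
  have h3 : AA p N 0 m = if m = 0 then 1 - p else 0 := by
    rw [← h2, AA]; simp
  rw [h3] at h
  simp only [Nat.cast_zero, sub_zero, zero_add] at h
  have : (1 - p) ≠ 0 := by linarith
  apply mul_left_cancel₀ this
  rw [sub_mul, one_mul, ← h]
  split_ifs <;> ring

/-- partitions with bounded parts -/
noncomputable def Pp (p : ℝ) (j m : ℕ) : ℝ :=
  ∑ ν ∈ (Finset.univ : Finset (Nat.Partition m)).filter (fun ν => ∀ x ∈ ν.parts, x ≤ j),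
    p ^ (Multiset.card ν.parts)

lemma Pp_zero (m : ℕ) : Pp p 0 m = if m = 0 then 1 else 0 := by
  rw [Pp]
  split_ifs with h
  · subst h
    rw [Finset.filter_true_of_mem]
    · simp
    · intro ν _ x hx
      have := Multiset.le_sum_of_mem hx
      rw [ν.parts_sum] at this; exact this
  · apply Finset.sum_eq_zero
    intro ν hν
    exfalso
    apply h
    have hν := (Finset.mem_filter.mp hν).2
    rw [← ν.parts_sum]
    apply Multiset.sum_eq_zero
    intro x hx
    have := hν x hx
    omega

lemma Pp_lt {j m : ℕ} (h : m < j + 1) : Pp p (j + 1) m = Pp p j m := by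
  rw [Pp, Pp]
  congr 1
  ext ν
  simp only [Finset.mem_filter, Finset.mem_univ, true_and]
  constructor
  · intro hν x hx
    have := Multiset.le_sum_of_mem hx
    rw [ν.parts_sum] at this; omega
  · intro hν x hx
    have := hν x hx; omega

lemma Pp_ge (j m : ℕ) : Pp p (j + 1) (m + (j + 1)) = Pp p j (m + (j + 1)) + p * Pp p (j + 1) m := by
  classical
  rw [Pp, ← Finset.sum_filter_add_sum_filter_not _ (fun ν => j + 1 ∉ ν.parts)]
  congr 1
  · rw [Pp, Finset.filter_filter]
    congr 1
    ext ν
    simp only [Finset.mem_filter, Finset.mem_univ, true_and]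
    constructor
    · rintro ⟨h1, h2⟩ x hx
      have := h1 x hx
      by_contra hlt
      exact h2 ((by omega : x = j + 1) ▸ hx)
    · intro h
      exact ⟨fun x hx => by have := h x hx; omega, fun hx => by have := h _ hx; omega⟩
  · rw [Pp, Finset.mul_sum, Finset.filter_filter]
    symm
    refine Finset.sum_bij (fun ν _ => ⟨(j + 1) ::ₘ ν.parts, ?_, ?_⟩) ?_ ?_ ?_ ?_
    · intro i hi
      rcases Multiset.mem_cons.mp hi with rfl | h
      · omega
      · exact ν.parts_pos h
    · rw [Multiset.sum_cons, ν.parts_sum]; ring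
    · intro ν hν
      simp only [Finset.mem_filter, Finset.mem_univ, true_and] at hν ⊢
      refine ⟨?_, by simp⟩
      intro x hx
      rcases Multiset.mem_cons.mp hx with rfl | h
      · omega
      · exact hν x h
    · intro ν _ ν' _ h
      rw [Nat.Partition.ext_iff] at h ⊢
      simpa using h
    · intro ν hν
      simp only [Finset.mem_filter, Finset.mem_univ, true_and, not_not] at hν
      obtain ⟨h1, h2⟩ := hν
      obtain ⟨s, hs⟩ := Multiset.exists_cons_of_mem h2
      refine ⟨⟨s, ?_, ?_⟩, ?_, ?_⟩
      · intro i hi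
        exact ν.parts_pos (by rw [hs]; exact Multiset.mem_cons_of_mem hi)
      · have := ν.parts_sum
        rw [hs, Multiset.sum_cons] at this
        omega
      · simp only [Finset.mem_filter, Finset.mem_univ, true_and]
        intro x hx
        exact h1 x (by rw [hs]; exact Multiset.mem_cons_of_mem hx)
      · rw [Nat.Partition.ext_iff]; exact hs.symm
    · intro ν _
      simp [pow_succ, mul_comm]

lemma AA_Pp (hp : 0 < p) (hp1 : p < 1) {N : ℕ} (hN : 3 ≤ N) (j m : ℕ) (hm : m + 3 ≤ N) :
    AA p N (j + 1) m = Pp p j m := by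
  induction j generalizing m with
  | zero =>
    rw [zero_add, AA_one hp hp1 (by exact_mod_cast hm) hN, Pp_zero]; simp
  | succ j ih =>
    induction m using Nat.strong_induction_on with
    | _ m ihm =>
      have h := AA_rec hp (N := N) (j + 1) (m := m) (by exact_mod_cast hm)
      rw [ih m hm] at h
      by_cases hlt : m < j + 1
      · rw [AA_neg (N := N) (j + 1 + 1) (m := (m : ℤ) - ((j + 1 : ℕ) : ℤ)) (by push_cast; omega)] at h
        rw [Pp_lt hlt]; linarith
      · obtain ⟨r, rfl⟩ : ∃ r, m = r + (j + 1) := ⟨m - (j + 1), by omega⟩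
        have e : ((r + (j + 1) : ℕ) : ℤ) - ((j + 1 : ℕ) : ℤ) = (r : ℕ) := by push_cast; ring
        rw [e, ihm r (by omega) (by omega)] at h
        rw [Pp_ge]; linarith

/-- the partition sum -/
noncomputable def PP (p : ℝ) (m : ℕ) : ℝ := ∑ ν : Nat.Partition m, p ^ (Multiset.card ν.parts)

theorem eps_zero (hp : 0 < p) (hp1 : p < 1) {N : ℕ} (hN : 3 ≤ N) (m : ℕ) (hm : m + 3 ≤ N) :
    eps p N 0 m = PP p m := by
  have h := AA_Pp hp hp1 hN m m hm
  have h2 : Pp p m m = PP p m := by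
    rw [Pp, Finset.filter_true_of_mem]
    · rfl
    · intro ν _ x hx
      have := Multiset.le_sum_of_mem hx
      rw [ν.parts_sum] at this; exact this
  rw [← h2, ← h, AA, Finset.sum_range_succ', Finset.sum_eq_zero]
  · simp
  · intro k _
    rw [eps_neg, mul_zero]
    push_cast
    nlinarith

end PF

namespace PF
variable {p : ℝ}

lemma qb_down (hp : 0 < p) (m k : ℕ) :
    qb p (m + 1 + k) k * qi p (m + 1) = qb p (m + k) k * qi p (m + k + 1) := by
  have h1 := qf_pos hp m
  have h2 := qf_pos hp k
  have h3 := qi_pos hp m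
  rw [qb_eq hp, qb_eq hp, show m + 1 + k = m + k + 1 by ring, qf_succ, qf_succ]
  field_simp

lemma qb_diag (hp : 0 < p) (m k : ℕ) :
    qb p (m + (k + 1)) (k + 1) * qi p (k + 1) = qb p (m + k) k * qi p (m + k + 1) := by
  have h1 := qf_pos hp m
  have h2 := qf_pos hp k
  have h3 := qi_pos hp k
  rw [qb_eq hp, qb_eq hp, show m + (k + 1) = m + k + 1 by ring, qf_succ, qf_succ]
  field_simp

lemma qi_eq (hp1 : p < 1) (n : ℕ) : qi p n = (1 - p ^ n) / (1 - p) := by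
  rw [eq_div_iff (by linarith), mul_comm, qi_mul]

/-- ratios -/
noncomputable def rX (p : ℝ) (a b k : ℕ) : ℝ := Xk p a b k / edge p a b
noncomputable def rY (p : ℝ) (a b k : ℕ) : ℝ := Yk p a b k / Yk p a b 0

lemma edge_pos (hp : 0 < p) {a b : ℕ} (h : a = 0 → b = 0) : 0 < edge p a b := by
  cases a with
  | zero => simp [edge, h rfl]
  | succ a =>
    rw [edge, show a + 1 + b - 1 = a + b by omega]
    have := qb_pos hp a b
    positivity

lemma Yk0_pos (hp : 0 < p) {a b : ℕ} (h : a = 0 → b = 0) : 0 < Yk p a b 0 := by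
  cases a with
  | zero => simp [Yk, h rfl]
  | succ a =>
    rw [Yk, Nat.sub_zero, qb_zero_right, show a + 1 + b - 1 = a + b by omega]
    have := qb_pos hp a b
    positivity

lemma choose_pred (a : ℕ) : (a + 1).choose 2 = a.choose 2 + a := by
  rw [Nat.choose_succ_succ' a 1]; simp [add_comm]

/-- closed form of `x`, generic -/
lemma rX_one (hp : 0 < p) {a b : ℕ} (h : 1 ≤ a + b) :
    rX p (a + 1) b 1 = qi p (a + 1) * qi p a / (p ^ a * qi p (a + b)) := by
  have he := edge_pos hp (a := a + 1) (b := b) (by omega)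
  obtain ⟨c, hc⟩ : ∃ c, a + b = c + 1 := ⟨a + b - 1, by omega⟩
  have hq := qi_pos hp c
  rw [← hc] at hq
  rw [rX, div_eq_div_iff he.ne' (by positivity)]
  have e1 : qb p (a + 1) 1 = qi p (a + 1) := by
    have := qb_diag hp a 0
    simpa using this
  have key : qb p (a + b - 1) b * qi p (a + b) = qb p (a + b) b * qi p a := by
    cases a with
    | zero => rw [qb_eq_zero (by omega : 0 + b - 1 < b)]; simp
    | succ a =>
      have := qb_down hp a b
      rw [this, show a + 1 + b - 1 = a + b by omega, show a + 1 + b = a + b + 1 by ring]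
  rw [Xk, edge, Nat.add_sub_cancel, e1, show a + 1 + b - 1 = a + b by omega, choose_pred, pow_add]
  linear_combination (p ^ a.choose 2 * qi p (a + 1) * p ^ a) * key

lemma rX_one_zero (hp : 0 < p) : rX p 1 0 1 = 1 := by simp [rX, Xk, edge]
lemma rX_zero (b k : ℕ) (hk : k ≠ 0) : rX p 0 b k = 0 := by
  rw [rX, Xk_big (by omega)]; simp
lemma rY_zero (a k : ℕ) (hk : k ≠ 0) : rY p a 0 k = 0 := by
  rw [rY, Yk_big (by omega)]; simp

lemma rY_one (hp : 0 < p) (a b : ℕ) :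
    rY p (a + 1) (b + 1) 1 = qi p (b + 1) * qi p b / (p ^ b * qi p (a + b + 1)) := by
  have he := Yk0_pos hp (a := a + 1) (b := b + 1) (by omega)
  have hq := qi_pos hp (a + b)
  rw [rY, div_eq_div_iff he.ne' (by positivity)]
  have e1 : qb p b 1 = qi p b := by
    cases b with
    | zero => simp
    | succ b => simpa using qb_diag hp b 0
  have key := qb_diag hp a b
  rw [Yk, Yk, Nat.add_sub_cancel, e1, Nat.sub_zero, show a + 1 + b - 1 = a + b by omega,
    show a + 1 + (b + 1) - 1 = a + (b + 1) by omega, choose_pred, pow_add, qb_zero_right]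
  linear_combination (- p ^ b.choose 2 * qi p b * p ^ b) * key

lemma qb_two (hp : 0 < p) (a : ℕ) : qb p (a + 1) 2 * (1 + p) = qi p (a + 1) * qi p a := by
  cases a with
  | zero => simp [qb_eq_zero]
  | succ a =>
    have h := qb_diag hp a 1
    have h2 := qb_diag hp a 0
    simp [qi_succ] at h h2
    rw [show a + 1 + 1 = a + 2 by ring]
    have e : qi p (a + 1 + 1) = qi p a + p ^ a + p ^ (a + 1) := by rw [qi_succ, qi_succ]
    rw [show a + 2 = a + 1 + 1 by ring, e, qi_succ]
    rw [h2] at h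
    rw [show a + 1 + 1 = a + 2 by ring, h]; ring

lemma choose_pred2 (a : ℕ) : (a + 2).choose 2 = a.choose 2 + (2 * a + 1) := by
  rw [choose_pred, choose_pred]; ring

lemma rX_two (hp : 0 < p) {a b : ℕ} (h : 1 ≤ a + b) :
    rX p (a + 2) b 2 = qi p (a + 2) * qi p (a + 1) * qi p (a + 1) * qi p a
      / ((1 + p) * p ^ (2 * a + 1) * qi p (a + b + 1) * qi p (a + b)) := by
  have he := edge_pos hp (a := a + 2) (b := b) (by omega)
  obtain ⟨c, hc⟩ : ∃ c, a + b = c + 1 := ⟨a + b - 1, by omega⟩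
  have hq := qi_pos hp c
  rw [← hc] at hq
  have hq2 := qi_pos hp (a + b)
  rw [rX, div_eq_div_iff he.ne' (by positivity)]
  have e1 := qb_two hp (a + 1)
  have key : qb p (a + b - 1) b * qi p (a + b) = qb p (a + b) b * qi p a := by
    cases a with
    | zero => rw [qb_eq_zero (by omega : 0 + b - 1 < b)]; simp
    | succ a =>
      have := qb_down hp a b
      rw [this, show a + 1 + b - 1 = a + b by omega, show a + 1 + b = a + b + 1 by ring]
  have key2 := qb_down hp a b
  rw [Xk, edge, Nat.add_sub_cancel, show a + 2 + b - 1 = a + 1 + b by omega, choose_pred2, pow_add]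
  rw [show a + 1 + 1 = a + 2 by ring] at e1
  linear_combination (p ^ a.choose 2 * p ^ (2 * a + 1) * qb p (a + b - 1) b * qi p (a + b + 1) * qi p (a + b)) * e1
    + (p ^ a.choose 2 * p ^ (2 * a + 1) * qi p (a + 2) * qi p (a + 1) * qi p (a + b + 1)) * key
    - (p ^ a.choose 2 * p ^ (2 * a + 1) * qi p (a + 2) * qi p (a + 1) * qi p a) * key2

lemma rY_two (hp : 0 < p) (a b : ℕ) :
    rY p (a + 1) (b + 2) 2 = qi p (b + 2) * qi p (b + 1) * qi p (b + 1) * qi p b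
      / ((1 + p) * p ^ (2 * b + 1) * qi p (a + b + 2) * qi p (a + b + 1)) := by
  have he := Yk0_pos hp (a := a + 1) (b := b + 2) (by omega)
  have hq := qi_pos hp (a + b)
  have hq2 := qi_pos hp (a + b + 1)
  rw [show a + b + 1 + 1 = a + b + 2 by ring] at hq2
  rw [rY, div_eq_div_iff he.ne' (by positivity)]
  have e1 := qb_two hp b
  have key := qb_diag hp a b
  have key2 := qb_diag hp a (b + 1)
  rw [show a + (b + 1) + 1 = a + b + 2 by ring, show b + 1 + 1 = b + 2 by ring] at key2
  rw [Yk, Yk, Nat.add_sub_cancel, Nat.sub_zero, show a + 1 + b - 1 = a + b by omega,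
    show a + 1 + (b + 2) - 1 = a + (b + 2) by omega, choose_pred2, pow_add, qb_zero_right,
    show b + 2 - 1 = b + 1 by omega]
  linear_combination (p ^ b.choose 2 * p ^ (2 * b + 1) * qb p (a + b) b * qi p (a + b + 2) * qi p (a + b + 1)) * e1
    - (p ^ b.choose 2 * p ^ (2 * b + 1) * qi p (b + 1) * qi p b * qi p (a + b + 2)) * key
    - (p ^ b.choose 2 * p ^ (2 * b + 1) * qi p (b + 1) * qi p (b + 1) * qi p b) * key2

/-- potential -/
noncomputable def phi (p : ℝ) (a : ℕ) : ℝ :=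
  p ^ 2 / (p ^ a) ^ 2 * qi p a
    - (1 - p) * (p ^ 3 / (p ^ a) ^ 2) * qi p a * ((1 - p ^ a / p) / (1 - p)) / (1 + p)

lemma pow_lt_one' (hp : 0 < p) (hp1 : p < 1) (n : ℕ) : p ^ (n + 1) < 1 :=
  pow_lt_one₀ hp.le hp1 (by omega)

/-- the per-edge identity -/
lemma edge_phi (hp : 0 < p) (hp1 : p < 1) (a b : ℕ) (hab : a = 0 → b = 0) :
    p / p ^ a * rX p a b 1 - p / p ^ b * rY p a b 1 - (1 - p) * (rX p a b 2 - rY p a b 2)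
      = phi p a - phi p b := by
  have h1p : 1 - p ≠ 0 := by linarith
  have h1p' : 1 + p ≠ 0 := by linarith
  have hpne := hp.ne'
  rcases a with _ | _ | a
  · rw [hab rfl, rX_zero _ _ one_ne_zero, rX_zero _ _ two_ne_zero, rY_zero _ _ one_ne_zero,
      rY_zero _ _ two_ne_zero]; ring
  · have hX2 : rX p (0 + 1) b 2 = 0 := by rw [rX, Xk_big (by omega)]; simp
    rw [hX2]
    rcases b with _ | _ | b
    · rw [zero_add, rX_one_zero hp, rY_zero _ _ one_ne_zero, rY_zero _ _ two_ne_zero]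
      simp [phi]; field_simp; ring
    · have : rY p (0 + 1) (0 + 1) 2 = 0 := by rw [rY, Yk_big (by omega)]; simp
      rw [this, rX_one hp (by omega), rY_one hp]
      simp
    · rw [rX_one hp (by omega), rY_one hp, rY_two hp]
      have hh : p ^ (2 * b + 1) = p ^ b * p ^ b * p := by ring
      simp only [hh, phi, qi_eq hp1, zero_add, pow_zero, pow_succ, pow_add]
      have h1 := pow_lt_one' hp hp1 b
      have h2 := pow_lt_one' hp hp1 (b + 1)
      rw [pow_succ, pow_succ] at h2
      rw [pow_succ] at h1
      have hB : 0 < p ^ b := by positivity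
      generalize p ^ b = B at *
      have : 1 - B * p ≠ 0 := by linarith
      have : 1 - p * B ≠ 0 := by linarith
      have : 1 - B * p * p ≠ 0 := by linarith
      have : 1 - B * p ^ 2 ≠ 0 := by nlinarith
      have : 1 - p ^ 2 * B ≠ 0 := by nlinarith
      field_simp
      ring
  · rcases b with _ | _ | b
    · rw [rX_one hp (by omega), rY_zero _ _ one_ne_zero, rY_zero _ _ two_ne_zero]
      have hX2 : rX p (a + 2) 0 2 = qi p (a + 2) * qi p (a + 1) / ((1 + p) * p ^ (2 * a + 1)) := by
        have := qb_two hp (a + 1)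
        rw [rX, Xk, edge, Nat.add_sub_cancel, choose_pred2, pow_add, show a + 1 + 1 = a + 2 by ring] at *
        rw [← this, qb_zero_right, qb_zero_right]
        field_simp
      rw [show a + 1 + 1 = a + 2 by ring, hX2]
      have hh : p ^ (2 * a + 1) = p ^ a * p ^ a * p := by ring
      simp only [hh, phi, qi_eq hp1, zero_add, add_zero, pow_zero, pow_succ, pow_add]
      have h1 := pow_lt_one' hp hp1 a
      rw [pow_succ] at h1
      have hA : 0 < p ^ a := by positivity
      generalize p ^ a = A at *
      have : 1 - A * p ≠ 0 := by linarith
      have : 1 - p * A ≠ 0 := by linarith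
      field_simp
      ring
    · have : rY p (a + 1 + 1) (0 + 1) 2 = 0 := by
        rw [rY, Yk, qb_eq_zero (by omega)]; simp
      rw [this, rX_one hp (by omega), rY_one hp, show a + 1 + 1 = a + 2 by ring, rX_two hp (by omega)]
      have hh : p ^ (2 * a + 1) = p ^ a * p ^ a * p := by ring
      simp only [hh, phi, qi_eq hp1, zero_add, add_zero, pow_zero, pow_succ, pow_add]
      have h1 := pow_lt_one' hp hp1 a
      have h2 := pow_lt_one' hp hp1 (a + 1)
      rw [pow_succ, pow_succ] at h2
      rw [pow_succ] at h1
      have hA : 0 < p ^ a := by positivity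
      generalize p ^ a = A at *
      have : 1 - A * p ≠ 0 := by linarith
      have : 1 - p * A ≠ 0 := by linarith
      have : 1 - A * p * p ≠ 0 := by linarith
      have : 1 - A * p ^ 2 ≠ 0 := by nlinarith
      have : 1 - p ^ 2 * A ≠ 0 := by nlinarith
      field_simp
      ring
    · rw [rX_one hp (by omega), rY_one hp, show a + 1 + 1 = a + 2 by ring, rX_two hp (by omega),
        show a + 2 = a + 1 + 1 by ring, rY_two hp]
      have hh' : p ^ (2 * b + 1) = p ^ b * p ^ b * p := by ring
      have hh : p ^ (2 * a + 1) = p ^ a * p ^ a * p := by ring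
      simp only [hh, hh', phi, qi_eq hp1, zero_add, add_zero, pow_zero, pow_succ, pow_add]
      have h1 := pow_lt_one' hp hp1 (a + b + 1)
      have h2 := pow_lt_one' hp hp1 (a + b + 2)
      have h1 : p ^ a * p ^ b * p * p < 1 := by
        calc _ = p ^ (a + b + 1 + 1) := by ring
          _ < 1 := h1
      have h2 : p ^ a * p ^ b * p * p * p < 1 := by
        calc _ = p ^ (a + b + 2 + 1) := by ring
          _ < 1 := h2
      have hA : 0 < p ^ a := by positivity
      have hB : 0 < p ^ b := by positivity
      generalize p ^ a = A at *
      generalize p ^ b = B at *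
      have : 1 - A * B * p * p ≠ 0 := by linarith
      have : 1 - A * B * p * p * p ≠ 0 := by linarith
      have : 1 - p ^ 2 * A * B ≠ 0 := by nlinarith
      have : 1 - A * p ^ 2 * B ≠ 0 := by nlinarith
      have : 1 - p ^ 3 * A * B ≠ 0 := by nlinarith
      have : 1 - A * p ^ 3 * B ≠ 0 := by nlinarith
      have : 1 - A * p * (B * p) ≠ 0 := by
        have : A * p * (B * p) = A * B * p * p := by ring
        linarith
      have : 1 - A * p * (B * p) * p ≠ 0 := by
        have : A * p * (B * p) * p = A * B * p * p * p := by ring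
        linarith
      have : 1 - A * p * (B * p * p) ≠ 0 := by
        have : A * p * (B * p * p) = A * B * p * p * p := by ring
        linarith
      field_simp
      ring

end PF

namespace PF
variable {p : ℝ}

/-- point mass -/
def dl (i k : ℕ) : ℕ → ℕ := fun j => if j = i then k else 0

lemma dl_zero_iff (i : ℕ) : dl i 0 = 0 := by funext j; simp [dl]

lemma dl_sum {N i k : ℕ} (hi : i ≤ N) : ∑ j ∈ Finset.range (N + 1), ((dl i k j : ℕ) : ℤ) = k := by
  simp only [dl]
  rw [Finset.sum_eq_single i]
  · simp
  · intro j _ hj; simp [hj]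
  · intro h; simp at h; omega

/-- base weight -/
noncomputable def SS (p : ℝ) (N : ℕ) (b : ℕ → ℕ) : ℝ := wtX p N b 0

lemma SS_nonlegit {N : ℕ} {b : ℕ → ℕ} (hz : ∀ j, N < j → b j = 0) (hb : ¬ Legit b) : SS p N b = 0 :=
  wtX_nonlegit hz hb 0

lemma wtY_nonlegit {N : ℕ} {b κ : ℕ → ℕ} (hN : ∀ j, N < j → κ j = 0)
    (hz : ∀ j, N < j → b j = 0) (hb : ¬ Legit b) : wtY p N b κ = 0 := by
  rw [wtY_eq N b κ hN hz, prod_nonlegit hz hb (fun j a b => Yk p a b (κ (j + 2)))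
    fun _ _ h => Yk_zero_left h, mul_zero]

lemma wtX_rX (hp : 0 < p) {N : ℕ} {b : ℕ → ℕ} (hz : ∀ j, N < j → b j = 0) (κ : ℕ → ℕ) :
    wtX p N b κ = SS p N b * ∏ j ∈ Finset.range (N + 1), rX p (b j) (b (j + 1)) (κ j) := by
  by_cases hb : Legit b
  · rw [SS, wtX, wtX, ← Finset.prod_mul_distrib]
    refine Finset.prod_congr rfl fun j _ => ?_
    have := edge_pos hp (hb j)
    rw [rX, Pi.zero_apply, Xk_zero]; field_simp
  · rw [SS_nonlegit hz hb, wtX_nonlegit hz hb, zero_mul]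

lemma rX_k0 (hp : 0 < p) {a b : ℕ} (h : a = 0 → b = 0) : rX p a b 0 = 1 := by
  rw [rX, Xk_zero, div_self (edge_pos hp h).ne']

lemma wtX_dl (hp : 0 < p) {N : ℕ} {b : ℕ → ℕ} (hz : ∀ j, N < j → b j = 0) {i : ℕ} (k : ℕ) (hi : i ≤ N) :
    wtX p N b (dl i k) = SS p N b * rX p (b i) (b (i + 1)) k := by
  by_cases hb : Legit b
  · rw [wtX_rX hp hz]
    congr 1
    rw [Finset.prod_eq_single i]
    · simp [dl]
    · intro j _ hj
      simp [dl, hj, rX_k0 hp (hb j)]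
    · intro h; simp at h; omega
  · rw [SS_nonlegit hz hb, wtX_nonlegit hz hb, zero_mul]

lemma wtX_dl2 (hp : 0 < p) {N : ℕ} {b : ℕ → ℕ} (hz : ∀ j, N < j → b j = 0) {i i' : ℕ} (hi : i < i') (hi' : i' ≤ N) :
    wtX p N b (dl i 1 + dl i' 1) = SS p N b * (rX p (b i) (b (i + 1)) 1 * rX p (b i') (b (i' + 1)) 1) := by
  by_cases hb : Legit b
  · rw [wtX_rX hp hz]
    congr 1
    rw [← Finset.prod_subset (s₁ := {i, i'}) (by intro x; simp; omega), Finset.prod_pair (by omega)]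
    · simp [dl, hi.ne, hi.ne']
    · intro j _ hj
      simp at hj
      simp [dl, hj, rX_k0 hp (hb j)]
  · rw [SS_nonlegit hz hb, wtX_nonlegit hz hb, zero_mul]

lemma SS_Y (hp : 0 < p) {N : ℕ} {b : ℕ → ℕ} (hz : ∀ j, N < j → b j = 0) :
    SS p N b = p ^ ((b 0).choose 2) * ∏ j ∈ Finset.range (N + 1), Yk p (b j) (b (j + 1)) 0 := by
  rw [SS, wtX_eq_wtY hp N b 0 rfl (fun _ _ => rfl) (fun _ => Nat.zero_le _)]
  have : (fun j => b j - (0 : ℕ → ℕ) j + (0 : ℕ → ℕ) (j + 1)) = b := by funext j; simp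
  rw [this, wtY_eq N b 0 (fun _ _ => rfl) hz]
  simp

lemma wtY_dl (hp : 0 < p) {N : ℕ} {b : ℕ → ℕ} (hz : ∀ j, N < j → b j = 0) {i : ℕ} (k : ℕ) (hi : i + 2 ≤ N) :
    wtY p N b (dl (i + 2) k) = SS p N b * rY p (b i) (b (i + 1)) k := by
  by_cases hb : Legit b
  · rw [wtY_eq _ _ _ (by intro j hj; simp [dl]; omega) hz, SS_Y hp hz, mul_assoc, mul_assoc]
    simp only [dl, show (1 : ℕ) ≠ i + 2 by omega, if_false, Nat.sub_zero, qb_zero_right]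
    rw [one_mul]
    congr 1
    rw [Finset.prod_eq_mul_prod_diff_singleton_of_mem (i := i) (by simp; omega),
      Finset.prod_eq_mul_prod_diff_singleton_of_mem (i := i) (f := fun j => Yk p (b j) (b (j + 1)) 0) (by simp; omega)]
    have := Yk0_pos hp (hb i)
    rw [if_pos rfl, rY]
    have h2 : ∏ x ∈ Finset.range (N + 1) \ {i}, Yk p (b x) (b (x + 1)) (if x + 2 = i + 2 then k else 0)
        = ∏ x ∈ Finset.range (N + 1) \ {i}, Yk p (b x) (b (x + 1)) 0 := by
      refine Finset.prod_congr rfl fun x hx => ?_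
      rw [if_neg]
      simp at hx; omega
    rw [h2]; field_simp
  · rw [SS_nonlegit hz hb, wtY_nonlegit (by intro j hj; simp [dl]; omega) hz hb, zero_mul]

/-- ratio t -/
noncomputable def tt (p : ℝ) (a b : ℕ) : ℝ := qi p a / qi p (a + b - 1)

lemma rY_small (a : ℕ) {b : ℕ} (hb : b ≤ 1) : rY p a b 1 = 0 := by
  rw [rY, Yk, qb_eq_zero (by omega)]; simp

lemma rY_small2 (a : ℕ) {b : ℕ} (hb : b ≤ 2) : rY p a b 2 = 0 := by
  rw [rY, Yk, qb_eq_zero (by omega)]; simp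

lemma tri_id (hp : 0 < p) (a b f : ℕ) (h1 : a = 0 → b = 0) (h2 : b = 0 → f = 0) :
    rX p b f 1 * tt p a b - rY p a b 1 * tt p f b = p / p ^ b * (rX p b f 1 - rY p a b 1) := by
  rcases a with _ | a
  · rw [h1 rfl, rX_zero _ _ one_ne_zero, rY_zero _ _ one_ne_zero]; simp
  rcases b with _ | b
  · rw [rX_zero _ _ one_ne_zero, rY_zero _ _ one_ne_zero]; simp
  rw [rY_one hp, tt, tt, show a + 1 + (b + 1) - 1 = a + b + 1 by omega, show f + (b + 1) - 1 = b + f by omega]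
  rcases b with _ | b
  · rcases f with _ | f
    · have := qi_pos hp a
      rw [zero_add, rX_one_zero hp]; simp; field_simp
    · rw [rX_one hp (by omega)]; simp
  · rw [rX_one hp (by omega)]
    have e1 := qi_pos hp (b + f)
    have e2 := qi_pos hp (a + b + 1)
    rw [show a + (b + 1) + 1 = a + b + 1 + 1 by ring, show b + 1 + f = b + f + 1 by ring]
    have k1 := qi_add (p := p) (b + 1) f
    have k2 := qi_add (p := p) (b + 1) (a + 1)
    rw [show b + 1 + f = b + f + 1 by ring] at k1
    rw [show b + 1 + (a + 1) = a + b + 1 + 1 by ring] at k2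
    have hpb : p ^ (b + 1 + 1) = p ^ (b + 1) * p := pow_succ _ _
    rw [hpb]
    have : 0 < p ^ (b + 1) := by positivity
    generalize p ^ (b + 1) = P at *
    field_simp
    rw [k1, k2]; ring

lemma swap_id (hp : 0 < p) (g a b : ℕ) (h1 : g = 0 → a = 0) (h2 : a = 0 → b = 0) :
    rY p g a 1 * (qi p (a - 1) / qi p (a + b - 1)) = rX p a b 1 * (qi p (a - 1) / qi p (g + a - 1)) := by
  rcases g with _ | g
  · rw [h1 rfl, rX_zero _ _ one_ne_zero, rY_zero _ _ one_ne_zero]; simp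
  rcases a with _ | _ | a
  · simp
  · simp
  · rw [rY_one hp, rX_one hp (by omega), show g + 1 + (a + 1 + 1) - 1 = g + (a + 1) + 1 by omega,
      show a + 1 + 1 + b - 1 = a + 1 + b by omega]
    have e1 := qi_pos hp (g + (a + 1))
    have e2 := qi_pos hp (a + b)
    rw [show a + 1 + b = a + b + 1 by ring]
    field_simp

noncomputable def TT (p : ℝ) (N : ℕ) (n : ℤ) (i : ℕ) : ℝ :=
  ∑ b ∈ BB N n, wtX p N b (dl (i + 1) 1) * tt p (b i) (b (i + 1))

lemma TT_shift (hp : 0 < p) (N : ℕ) (n : ℤ) (i : ℕ) (hi : i + 3 ≤ N) :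
    TT p N (n - 2) (i + 2) = ∑ b ∈ BB N n, SS p N b * (rY p (b i) (b (i + 1)) 1 * tt p (b (i + 2)) (b (i + 1))) := by
  have hd : ∀ k ≤ N, ∀ j, N < j → dl k 1 j = 0 := by intro k hk j hj; simp [dl]; omega
  rw [TT, shift hp N (n - 2) (dl (i + 2 + 1) 1) (by simp [dl]) (hd _ (by omega)) (fun b => tt p (b (i + 2)) (b (i + 2 + 1))),
    dl_sum (by omega), show n - 2 + ((1 : ℕ) : ℤ) = n - 1 by push_cast; ring]
  have e1 : ∑ b ∈ BB N (n - 1), wtY p N b (dl (i + 2 + 1) 1) *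
      tt p (b (i + 2) - dl (i + 2 + 1) 1 (i + 2 + 1) + dl (i + 2 + 1) 1 (i + 2))
        (b (i + 2 + 1) - dl (i + 2 + 1) 1 (i + 2 + 1 + 1) + dl (i + 2 + 1) 1 (i + 2 + 1))
      = ∑ b ∈ BB N (n - 1), wtX p N b (dl (i + 2) 1) * (qi p (b (i + 2) - 1) / qi p (b (i + 1) + b (i + 2) - 1)) := by
    refine Finset.sum_congr rfl fun b hb => ?_
    have hz := (mem_BB.mp hb).1.2
    rw [show i + 2 + 1 = i + 1 + 2 by ring, wtY_dl hp hz _ (by omega), wtX_dl hp hz _ (by omega), mul_assoc, mul_assoc]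
    by_cases hl : Legit b
    · congr 1
      simp only [dl, if_true, show i + 1 + 2 + 1 ≠ i + 1 + 2 by omega, show i + 2 ≠ i + 1 + 2 by omega, if_false]
      rw [tt, ← swap_id hp (b (i + 1)) (b (i + 2)) _ (hl _) (hl _)]
      by_cases h : b (i + 2) ≤ 1
      · rw [show i + 1 + 1 = i + 2 by ring, rY_small _ h]; simp
      · rw [show b (i + 2) - 1 + 0 + (b (i + 1 + 2) - 0 + 1) - 1 = b (i + 2) + b (i + 2 + 1) - 1 by
          rw [show i + 1 + 2 = i + 2 + 1 by ring]; omega]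
        rfl
    · rw [SS_nonlegit hz hl]; simp
  rw [e1, shift hp N (n - 1) (dl (i + 2) 1) (by simp [dl]) (hd _ (by omega)) (fun b => (qi p (b (i + 2) - 1) / qi p (b (i + 1) + b (i + 2) - 1))),
    dl_sum (by omega), show n - 1 + ((1 : ℕ) : ℤ) = n by push_cast; ring]
  refine Finset.sum_congr rfl fun b hb => ?_
  have hz := (mem_BB.mp hb).1.2
  rw [wtY_dl hp hz _ (by omega), mul_assoc]
  by_cases h : b (i + 1) ≤ 1
  · rw [rY_small _ h]; simp
  · simp only [dl, if_true, show i + 2 + 1 ≠ i + 2 by omega, show i + 1 ≠ i + 2 by omega, show i + 1 + 1 = i + 2 by omega, if_false]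
    rw [tt, show b (i + 1) - 1 + 0 + (b (i + 2) - 0 + 1) - 1 = b (i + 2) + b (i + 1) - 1 by omega,
      show b (i + 2) - 0 + 1 - 1 = b (i + 2) by omega]

end PF

namespace PF
variable {p : ℝ}

lemma Legit.ge_one {N : ℕ} {n : ℤ} {b : ℕ → ℕ} (hb : b ∈ BB N n) (hl : Legit b) (h : b N = 1) :
    ∀ j ≤ N, b j = 1 := by
  have hs := (mem_BB.mp hb).1.1
  have h1 : ∀ j ∈ Finset.range (N + 1), 1 ≤ b j := by
    intro j hj
    by_contra h0
    have := hl.zero_of_le (Nat.lt_succ_iff.mp (Finset.mem_range.mp hj)) (by omega : b j = 0)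
    omega
  have h2 : ∑ j ∈ Finset.range (N + 1), 1 = ∑ j ∈ Finset.range (N + 1), b j := by rw [hs]; simp
  have := (Finset.sum_eq_sum_iff_of_le h1).mp h2
  intro j hj
  exact (this j (by simp; omega)).symm

lemma Legit.three {N : ℕ} {n : ℤ} {b : ℕ → ℕ} (hb : b ∈ BB N n) (hl : Legit b) (hn : n + 3 ≤ N) (hN : 3 ≤ N) :
    b 3 ≠ 0 := by
  intro h3
  have hs := (mem_BB.mp hb).1.1
  rw [Finset.sum_range_succ_comm, ← Finset.sum_range_succ_comm] at hs
  have : ∑ j ∈ Finset.range (N + 1), b j = ∑ j ∈ Finset.range 3, b j := by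
    symm
    apply Finset.sum_subset
    · intro j; simp; omega
    · intro j _ hj
      simp at hj
      exact hl.zero_of_le hj h3
  rw [this] at hs
  simp [Finset.sum_range_succ, hl.ones hb hn (by norm_num : 0 ≤ 2), hl.ones hb hn (by norm_num : 1 ≤ 2),
    hl.ones hb hn (by norm_num : 2 ≤ 2)] at hs
  omega

lemma rX_one_one (hp : 0 < p) {b : ℕ} (hb : b ≠ 0) : rX p 1 b 1 = 0 := by
  rw [show (1 : ℕ) = 0 + 1 from rfl, rX_one hp (by omega)]; simp

lemma rX_two_small {a b : ℕ} (h : a ≤ 1) : rX p a b 2 = 0 := by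
  rw [rX, Xk_big (by omega)]; simp

noncomputable def DD (p : ℝ) (N : ℕ) (n : ℤ) : ℝ :=
  ∑ b ∈ BB N n, SS p N b * (∑ i ∈ Finset.range N, rX p (b (i + 1)) (b (i + 2)) 1 * tt p (b i) (b (i + 1))
    - (1 - p) * ∑ i ∈ Finset.range (N + 1), rX p (b i) (b (i + 1)) 2)

lemma DD_neg {N : ℕ} {n : ℤ} (hn : n < 0) : DD p N n = 0 := by
  apply Finset.sum_eq_zero
  intro b hb
  rw [SS_nonlegit (mem_BB.mp hb).1.2, zero_mul]
  intro hl
  have := hl.nonneg hb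
  omega

lemma TT_eq (hp : 0 < p) {N : ℕ} {n : ℤ} {i : ℕ} (hi : i < N) : TT p N n i =
    ∑ b ∈ BB N n, SS p N b * (rX p (b (i + 1)) (b (i + 2)) 1 * tt p (b i) (b (i + 1))) := by
  refine Finset.sum_congr rfl fun b hb => ?_
  rw [wtX_dl hp (mem_BB.mp hb).1.2 _ (by omega), mul_assoc]

lemma TT_zero (hp : 0 < p) {N : ℕ} {n : ℤ} (hn : n + 3 ≤ N) (hN : 3 ≤ N) {i : ℕ} (hi : i < 2) : TT p N n i = 0 := by
  rw [TT_eq hp (by omega)]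
  apply Finset.sum_eq_zero
  intro b hb
  by_cases hl : Legit b
  · have h1 := hl.ones hb hn (by omega : i + 1 ≤ 2)
    have h2 : b (i + 2) ≠ 0 := by
      intro h
      exact hl.three hb hn hN (hl.zero_of_le (by omega) h)
    rw [h1, rX_one_one hp h2]; simp
  · rw [SS_nonlegit (mem_BB.mp hb).1.2 hl, zero_mul]

lemma last_y (hp : 0 < p) {N : ℕ} {n : ℤ} {b : ℕ → ℕ} (hb : b ∈ BB N n) (hl : Legit b) {i : ℕ} (hi : N ≤ i + 2) (hN : 3 ≤ N) :
    rY p (b i) (b (i + 1)) 1 * tt p (b (i + 2)) (b (i + 1)) = 0 := by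
  have hz := (mem_BB.mp hb).1.2
  rcases hi.lt_or_eq with h | h
  · rw [hz _ h]; simp [tt]
  · have := hl.last hb
    rcases Nat.eq_zero_or_pos (b N) with h0 | h0
    · rw [← h, h0]; simp [tt]
    · have h1 := hl.ge_one hb (by omega)
      rw [h1 (i + 1) (by omega), rY_small _ le_rfl, zero_mul]

lemma X2_shift (hp : 0 < p) {N : ℕ} {n : ℤ} (i : ℕ) (hi : i + 2 ≤ N) :
    ∑ b ∈ BB N (n - 2), SS p N b * rX p (b (i + 2)) (b (i + 3)) 2
      = ∑ b ∈ BB N n, SS p N b * rY p (b i) (b (i + 1)) 2 := by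
  have h := shift hp N (n - 2) (dl (i + 2) 2) (by simp [dl]) (by intro j hj; simp [dl]; omega) (fun _ => 1)
  rw [dl_sum (by omega), show n - 2 + ((2 : ℕ) : ℤ) = n by push_cast; ring] at h
  simp only [mul_one] at h
  have h1 : ∀ b ∈ BB N n, wtY p N b (dl (i + 2) 2) = SS p N b * rY p (b i) (b (i + 1)) 2 :=
    fun b hb => wtY_dl hp (mem_BB.mp hb).1.2 _ hi
  have h2 : ∀ b ∈ BB N (n - 2), wtX p N b (dl (i + 2) 2) = SS p N b * rX p (b (i + 2)) (b (i + 3)) 2 :=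
    fun b hb => wtX_dl hp (mem_BB.mp hb).1.2 _ hi
  rw [Finset.sum_congr rfl h1, Finset.sum_congr rfl h2] at h
  exact h

lemma X2_zero (hp : 0 < p) {N : ℕ} {n : ℤ} (hn : n + 3 ≤ N) (i : ℕ) (hi : i < 2) :
    ∑ b ∈ BB N n, SS p N b * rX p (b i) (b (i + 1)) 2 = 0 := by
  apply Finset.sum_eq_zero
  intro b hb
  by_cases hl : Legit b
  · rw [hl.ones hb hn (by omega : i ≤ 2), rX_two_small le_rfl, mul_zero]
  · rw [SS_nonlegit (mem_BB.mp hb).1.2 hl, zero_mul]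

lemma DD_pull (hp : 0 < p) {N : ℕ} {n : ℤ} (hn : n + 3 ≤ N) (hN : 3 ≤ N) :
    DD p N (n - 2) = ∑ b ∈ BB N n, SS p N b *
      (∑ i ∈ Finset.range N, rY p (b i) (b (i + 1)) 1 * tt p (b (i + 2)) (b (i + 1))
        - (1 - p) * ∑ i ∈ Finset.range (N + 1), rY p (b i) (b (i + 1)) 2) := by
  obtain ⟨M, rfl⟩ : ∃ M, N = M + 2 := ⟨N - 2, by omega⟩
  have e1 : DD p (M + 2) (n - 2) = ∑ i ∈ Finset.range (M + 2), TT p (M + 2) (n - 2) i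
      - (1 - p) * ∑ i ∈ Finset.range (M + 3), ∑ b ∈ BB (M + 2) (n - 2), SS p (M + 2) b * rX p (b i) (b (i + 1)) 2 := by
    rw [DD, Finset.sum_congr rfl fun i hi => TT_eq hp (Finset.mem_range.mp hi), Finset.sum_comm,
      Finset.sum_comm (s := Finset.range (M + 3)), Finset.mul_sum, ← Finset.sum_sub_distrib]
    refine Finset.sum_congr rfl fun b _ => ?_
    simp only [← Finset.mul_sum]
    ring
  have hn' : n - 2 + 3 ≤ ((M + 2 : ℕ) : ℤ) := by omega
  rw [e1, Finset.sum_range_succ', Finset.sum_range_succ', TT_zero hp hn' hN (by norm_num),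
    TT_zero hp hn' hN (by norm_num), Finset.sum_range_succ' _ (M + 2), Finset.sum_range_succ' _ (M + 1),
    X2_zero hp hn' 0 (by norm_num), X2_zero hp hn' _ (by norm_num)]
  simp only [add_zero]
  have e2 : ∀ i ∈ Finset.range M, TT p (M + 2) (n - 2) (i + 1 + 1) =
      ∑ b ∈ BB (M + 2) n, SS p (M + 2) b * (rY p (b i) (b (i + 1)) 1 * tt p (b (i + 2)) (b (i + 1))) := by
    intro i hi
    simp at hi
    by_cases h : i + 3 ≤ M + 2
    · exact TT_shift hp _ n i h
    · omega
  have e3 : ∀ i ∈ Finset.range (M + 1), ∑ b ∈ BB (M + 2) (n - 2), SS p (M + 2) b * rX p (b (i + 1 + 1)) (b (i + 1 + 1 + 1)) 2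
      = ∑ b ∈ BB (M + 2) n, SS p (M + 2) b * rY p (b i) (b (i + 1)) 2 := by
    intro i hi
    simp at hi
    exact X2_shift hp i (by omega)
  rw [Finset.sum_congr rfl e2, Finset.sum_congr rfl e3, Finset.sum_comm,
      Finset.sum_comm (s := Finset.range (M + 1)), Finset.mul_sum, ← Finset.sum_sub_distrib]
  refine Finset.sum_congr rfl fun b hb => ?_
  by_cases hl : Legit b
  · have hz := (mem_BB.mp hb).1.2
    rw [Finset.sum_range_succ _ (M + 2), Finset.sum_range_succ (fun i => rY p (b i) (b (i + 1)) 2) (M + 1), Finset.sum_range_succ _ (M + 1),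
      Finset.sum_range_succ (fun i => rY p (b i) (b (i + 1)) 1 * tt p (b (i + 2)) (b (i + 1))) M, last_y hp hb hl le_rfl hN, last_y hp hb hl (by omega) hN,
      rY_small2 _ (by have := hl.last hb; rw [show M + 1 + 1 = M + 2 by ring]; omega), hz (M + 2 + 1) (by omega),
      rY_small2 _ (by norm_num)]
    simp only [← Finset.mul_sum]
    ring
  · simp [SS_nonlegit (mem_BB.mp hb).1.2 hl]

theorem DD_rec (hp : 0 < p) (hp1 : p < 1) {N : ℕ} {n : ℤ} (hn : n + 3 ≤ N) (hN : 3 ≤ N) :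
    DD p N n = DD p N (n - 2) + ∑ b ∈ BB N n, SS p N b := by
  rw [DD_pull hp hn hN, ← Finset.sum_add_distrib, DD]
  refine Finset.sum_congr rfl fun b hb => ?_
  by_cases hl : Legit b
  swap
  · simp [SS_nonlegit (mem_BB.mp hb).1.2 hl]
  have hz := (mem_BB.mp hb).1.2
  have k1 : ∑ i ∈ Finset.range N, rX p (b (i + 1)) (b (i + 2)) 1 * tt p (b i) (b (i + 1))
      - ∑ i ∈ Finset.range N, rY p (b i) (b (i + 1)) 1 * tt p (b (i + 2)) (b (i + 1))
      = ∑ i ∈ Finset.range N, p / p ^ (b (i + 1)) * rX p (b (i + 1)) (b (i + 2)) 1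
        - ∑ i ∈ Finset.range N, p / p ^ (b (i + 1)) * rY p (b i) (b (i + 1)) 1 := by
    rw [← Finset.sum_sub_distrib, ← Finset.sum_sub_distrib]
    refine Finset.sum_congr rfl fun i _ => ?_
    rw [tri_id hp _ _ _ (hl _) (hl _)]; ring
  have k2 : ∑ i ∈ Finset.range (N + 1), (phi p (b i) - phi p (b (i + 1))) = 1 := by
    rw [Finset.sum_range_sub', hz (N + 1) (by omega), hl.ones hb hn (by norm_num : 0 ≤ 2)]
    simp [phi]
    field_simp
    ring
  have k3 : ∑ i ∈ Finset.range (N + 1), (phi p (b i) - phi p (b (i + 1)))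
    = ∑ i ∈ Finset.range (N + 1), p / p ^ (b i) * rX p (b i) (b (i + 1)) 1
      - ∑ i ∈ Finset.range (N + 1), p / p ^ (b (i + 1)) * rY p (b i) (b (i + 1)) 1
      - (1 - p) * (∑ i ∈ Finset.range (N + 1), rX p (b i) (b (i + 1)) 2 - ∑ i ∈ Finset.range (N + 1), rY p (b i) (b (i + 1)) 2) := by
    rw [← Finset.sum_sub_distrib, ← Finset.sum_sub_distrib, Finset.mul_sum, ← Finset.sum_sub_distrib]
    exact Finset.sum_congr rfl fun i _ => (edge_phi hp hp1 _ _ (hl i)).symm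
  have k4 : ∑ i ∈ Finset.range (N + 1), p / p ^ (b i) * rX p (b i) (b (i + 1)) 1
      = ∑ i ∈ Finset.range N, p / p ^ (b (i + 1)) * rX p (b (i + 1)) (b (i + 2)) 1 := by
    rw [Finset.sum_range_succ', hl.ones hb hn (by norm_num : 0 ≤ 2), rX_one_one hp]
    · simp
    · rw [hl.ones hb hn (by norm_num : 0 + 1 ≤ 2)]; norm_num
  have k5 : ∑ i ∈ Finset.range (N + 1), p / p ^ (b (i + 1)) * rY p (b i) (b (i + 1)) 1
      = ∑ i ∈ Finset.range N, p / p ^ (b (i + 1)) * rY p (b i) (b (i + 1)) 1 := by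
    rw [Finset.sum_range_succ, hz (N + 1) (by omega), rY_zero _ _ one_ne_zero]; simp
  linear_combination SS p N b * (k1 + k2 - k3 - k4 + k5)

end PF

namespace PF
variable {p : ℝ}

lemma eps_zero_eq (N : ℕ) (n : ℤ) : eps p N 0 n = ∑ b ∈ BB N n, SS p N b := by
  have : (KK N).filter (fun g => ∑ i, g i = 0) = {0} := by
    ext g
    simp [KK, funext_iff]
    intro h i
    rw [h]; omega
  rw [eps, this, Finset.sum_singleton, EE]
  have : kext (0 : Fin N → ℕ) = 0 := by funext j; simp [kext]
  rw [this]; rfl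

open Polynomial in
lemma coeff_prod (F : ℕ → Polynomial ℝ) (h0 : ∀ i, (F i).coeff 0 = 1) (M : ℕ) :
    (∏ i ∈ Finset.range M, F i).coeff 0 = 1 ∧
    (∏ i ∈ Finset.range M, F i).coeff 1 = ∑ i ∈ Finset.range M, (F i).coeff 1 ∧
    (∏ i ∈ Finset.range M, F i).coeff 2 = ∑ j ∈ Finset.range M, ((F j).coeff 1 * ∑ i ∈ Finset.range j, (F i).coeff 1)
      + ∑ i ∈ Finset.range M, (F i).coeff 2 := by
  induction M with
  | zero => simp [coeff_one]
  | succ M ih =>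
    obtain ⟨h1, h2, h3⟩ := ih
    simp only [Finset.prod_range_succ, Finset.sum_range_succ]
    refine ⟨?_, ?_, ?_⟩
    · rw [mul_coeff_zero, h1, h0, one_mul]
    · rw [mul_coeff_one, h1, h2, h0]; ring
    · rw [Polynomial.coeff_mul]
      simp [Finset.Nat.antidiagonal_succ, h1, h2, h3, h0]
      ring

open Polynomial in
lemma eps_two_eq (hp : 0 < p) {N : ℕ} (hN : 3 ≤ N) (n : ℤ) : eps p N 2 n = ∑ b ∈ BB N n, SS p N b *
    (∑ j ∈ Finset.range N, (rX p (b (j + 1)) (b (j + 2)) 1 * ∑ i ∈ Finset.range j, rX p (b (i + 1)) (b (i + 2)) 1)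
      + ∑ i ∈ Finset.range N, rX p (b (i + 1)) (b (i + 2)) 2) := by
  classical
  let F : (ℕ → ℕ) → ℕ → ℝ[X] := fun b i => ∑ k ∈ Finset.range (N + 2), C (rX p (b (i + 1)) (b (i + 2)) k) * X ^ k
  have hF : ∀ b i k, k < N + 2 → (F b i).coeff k = rX p (b (i + 1)) (b (i + 2)) k := by
    intro b i k hk
    simp only [F, finset_sum_coeff, coeff_C_mul_X_pow]
    rw [Finset.sum_eq_single k]
    · simp
    · intro j _ hj; rw [if_neg (Ne.symm hj)]
    · intro h; simp at h; omega
  let M := N * (N + 1) + 3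
  have key : ∑ b ∈ BB N n, C (SS p N b) * ∏ i ∈ Finset.range N, F b i = ∑ k ∈ Finset.range M, C (eps p N k n) * X ^ k := by
    apply Polynomial.funext
    intro y
    have h := theta_eps (p := p) N y n (M := M) (by omega)
    simp only [eval_finset_sum, eval_mul, eval_C, eval_pow, eval_X, eval_prod]
    rw [Finset.sum_congr rfl (fun k _ => mul_comm (eps p N k n) (y ^ k)), ← h, theta]
    refine Finset.sum_congr rfl fun b hb => ?_
    have hz := (mem_BB.mp hb).1.2
    have hX : ∀ i, Xe p y (b (i + 1)) (b (i + 2)) = ∑ k ∈ Finset.range (N + 2), y ^ k * Xk p (b (i + 1)) (b (i + 2)) k :=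
      fun i => Xe_eq y (BB_le hb _)
    by_cases hl : Legit b
    · rw [SS, wtX, Finset.prod_range_succ']
      simp only [Pi.zero_apply, Xk_zero]
      rw [mul_comm _ (edge _ _ _), mul_assoc, ← Finset.prod_mul_distrib]
      congr 1
      refine Finset.prod_congr rfl fun i _ => ?_
      rw [hX, eval_finset_sum, Finset.mul_sum]
      refine Finset.sum_congr rfl fun k _ => ?_
      have := edge_pos hp (hl (i + 1))
      rw [show i + 1 + 1 = i + 2 from rfl] at *
      simp [rX]; field_simp
    · rw [SS_nonlegit hz hl, zero_mul]
      have := wtX_nonlegit (p := p) hz hl 0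
      simp only [Legit, not_forall] at hl
      obtain ⟨j, h1, h2⟩ := hl
      rcases j with _ | j
      · rw [edge, h1, qb_eq_zero (by have : b 1 ≠ 0 := h2; omega)]; simp
      · have : Xe p y (b (j + 1)) (b (j + 2)) = 0 := by
          rw [hX, h1]
          exact Finset.sum_eq_zero fun k _ => by rw [Xk_zero_left h2, mul_zero]
        rw [Finset.prod_eq_zero (i := j) _ this, mul_zero]
        simp
        by_contra hj
        exact h2 (hz _ (by omega))
  have h2 := congrArg (fun P => P.coeff 2) key
  simp only [finset_sum_coeff, coeff_C_mul_X_pow] at h2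
  simp only [coeff_C_mul] at h2
  rw [Finset.sum_eq_single (s := Finset.range M) 2 (by intro k _ hk; rw [if_neg (Ne.symm hk)]) (by intro h; simp [M] at h),
    if_pos rfl] at h2
  rw [← h2]
  refine Finset.sum_congr rfl fun b hb => ?_
  by_cases hl : Legit b
  · congr 1
    rw [(coeff_prod (F b) (fun i => by rw [hF _ _ _ (by omega), rX_k0 hp (hl _)]) N).2.2]
    simp only [hF _ _ 1 (by omega : 1 < N + 2), hF _ _ 2 (by omega : 2 < N + 2)]
  · rw [SS_nonlegit (mem_BB.mp hb).1.2 hl, zero_mul, zero_mul]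

/-- adjacent-pair ratio -/
noncomputable def adj (p : ℝ) (a b f : ℕ) : ℝ :=
  qi p a * qi p (a + 1) / (p ^ a * qi p (a + b - 1)) * rX p b f 1

lemma adj_eq (hp : 0 < p) {a b f : ℕ} (h1 : a = 0 → b = 0) :
    adj p a b f = p⁻¹ * (rX p a b 1 * rX p b f 1) + (1 + p⁻¹) * (rX p b f 1 * tt p a b) := by
  rcases a with _ | a
  · rw [h1 rfl, adj, rX_zero _ _ one_ne_zero]; simp
  rcases b with _ | b
  · rw [adj, rX_zero _ _ one_ne_zero]; simp
  rw [adj, rX_one hp (a := a) (b := b + 1) (by omega), tt, show a + 1 + (b + 1) - 1 = a + b + 1 by omega, show a + (b + 1) = a + b + 1 by ring,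
    qi_succ (a + 1)]
  have := qi_pos hp (a + b)
  rw [qi_succ a, pow_succ]
  field_simp
  ring

noncomputable def HH (p : ℝ) (N : ℕ) (n : ℤ) : ℝ :=
  ∑ b ∈ BB N n, SS p N b * (p * ∑ i ∈ Finset.range (N + 1), rX p (b i) (b (i + 1)) 2
    + p⁻¹ * ∑ j ∈ Finset.range N, (rX p (b (j + 1)) (b (j + 2)) 1 * ∑ i ∈ Finset.range j, rX p (b i) (b (i + 1)) 1)
    + ∑ j ∈ Finset.range N, adj p (b j) (b (j + 1)) (b (j + 2)))

theorem HH_eq (hp : 0 < p) {N : ℕ} {n : ℤ} (hn : n + 3 ≤ N) (hN : 3 ≤ N) :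
    HH p N n = p⁻¹ * eps p N 2 n + (1 + p⁻¹) * DD p N n := by
  rw [eps_two_eq hp hN, DD, HH, Finset.mul_sum, Finset.mul_sum, ← Finset.sum_add_distrib]
  refine Finset.sum_congr rfl fun b hb => ?_
  by_cases hl : Legit b
  swap
  · simp [SS_nonlegit (mem_BB.mp hb).1.2 hl]
  have b0 := hl.ones hb hn (by norm_num : 0 ≤ 2)
  have b1 := hl.ones hb hn (by norm_num : 0 + 1 ≤ 2)
  have e1 : ∑ j ∈ Finset.range N, adj p (b j) (b (j + 1)) (b (j + 2)) =
     p⁻¹ * ∑ j ∈ Finset.range N, (rX p (b j) (b (j + 1)) 1 * rX p (b (j + 1)) (b (j + 2)) 1)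
      + (1 + p⁻¹) * ∑ j ∈ Finset.range N, (rX p (b (j + 1)) (b (j + 2)) 1 * tt p (b j) (b (j + 1))) := by
    rw [Finset.mul_sum, Finset.mul_sum, ← Finset.sum_add_distrib]
    exact Finset.sum_congr rfl fun j _ => adj_eq hp (hl j)
  have e2 : ∑ j ∈ Finset.range N, (rX p (b (j + 1)) (b (j + 2)) 1 * ∑ i ∈ Finset.range j, rX p (b (i + 1)) (b (i + 2)) 1)
      = ∑ j ∈ Finset.range N, (rX p (b (j + 1)) (b (j + 2)) 1 * ∑ i ∈ Finset.range j, rX p (b i) (b (i + 1)) 1)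
        + ∑ j ∈ Finset.range N, (rX p (b j) (b (j + 1)) 1 * rX p (b (j + 1)) (b (j + 2)) 1) := by
    rw [← Finset.sum_add_distrib]
    refine Finset.sum_congr rfl fun j _ => ?_
    have h1 := Finset.sum_range_succ (fun i => rX p (b i) (b (i + 1)) 1) j
    have h2 := Finset.sum_range_succ' (fun i => rX p (b i) (b (i + 1)) 1) j
    have h3 : rX p (b 0) (b (0 + 1)) 1 = 0 := by rw [b0, b1, rX_one_one hp one_ne_zero]
    rw [h1] at h2
    linear_combination - (rX p (b (j + 1)) (b (j + 2)) 1) * (h2 + h3)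
  have e3 : ∑ i ∈ Finset.range (N + 1), rX p (b i) (b (i + 1)) 2 = ∑ i ∈ Finset.range N, rX p (b (i + 1)) (b (i + 2)) 2 := by
    rw [Finset.sum_range_succ', b0, rX_two_small le_rfl, add_zero]
  have hq : p * p⁻¹ = 1 := mul_inv_cancel₀ hp.ne'
  rw [e1, e2, e3]
  linear_combination SS p N b * (∑ i ∈ Finset.range N, rX p (b (i + 1)) (b (i + 2)) 2) * (-hq)

/-- the normalised `f_n` -/
noncomputable def fh (p : ℝ) (n : ℕ) : ℝ :=
  ∑ x ∈ ((Finset.range (n + 1)) ×ˢ (Finset.range (n + 1))).filter (fun x => x.1 + 2 * x.2 ≤ n), PP p (n - x.1 - 2 * x.2)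

noncomputable def e1 (p : ℝ) (n : ℕ) : ℝ := ∑ a ∈ Finset.range (n + 1), PP p (n - a)

lemma fh_eq (n : ℕ) : fh p n = ∑ b ∈ Finset.range (n / 2 + 1), e1 p (n - 2 * b) := by
  simp only [fh, e1]
  rw [Finset.sum_sigma']
  refine Finset.sum_bij' (fun x _ => ⟨x.2, x.1⟩) (fun y _ => (y.2, y.1)) ?_ ?_ ?_ ?_ ?_
  · intro x hx; simp at hx ⊢; omega
  · intro x hx; simp at hx ⊢; omega
  · intro x hx; rfl
  · intro x hx; rfl
  · intro x hx; congr 1; simp; omega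

lemma fh_rec (n : ℕ) : fh p (n + 2) = fh p n + e1 p (n + 2) := by
  rw [fh_eq, fh_eq, show (n + 2) / 2 = n / 2 + 1 by omega, Finset.sum_range_succ']
  congr 1
  refine Finset.sum_congr rfl fun b _ => ?_
  congr 1; omega

lemma e1_rec (n : ℕ) : e1 p (n + 1) = e1 p n + PP p (n + 1) := by
  rw [e1, e1, Finset.sum_range_succ']
  congr 1
  refine Finset.sum_congr rfl fun b _ => ?_
  congr 1; omega

lemma eps1_eq (hp : 0 < p) (hp1 : p < 1) {N : ℕ} (hN : 3 ≤ N) (m : ℕ) (hm : m + 3 ≤ N) : eps p N 1 m = e1 p m := by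
  induction m with
  | zero =>
    have h := eps_rec hp N 0 (n := ((0 : ℕ) : ℤ)) (by omega)
    have h2 := eps_zero hp hp1 hN 0 (by omega)
    have h3 : eps p N 1 (-1) = 0 := eps_neg (by norm_num)
    simp [e1] at *
    rw [h, h2, h3, zero_add]
  | succ m ih =>
    have h := eps_rec hp N 0 (n := ((m + 1 : ℕ) : ℤ)) (by omega)
    have h2 := eps_zero hp hp1 hN (m + 1) (by omega)
    rw [e1_rec, ← ih (by omega), ← h2]
    rw [h]
    congr 1
    · congr 1; push_cast; ring

lemma eps2_zero (hp : 0 < p) {N : ℕ} (hN : 3 ≤ N) : eps p N 2 0 = 0 := by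
  have h3 := eps_rec hp N 1 (n := 0) (by omega)
  have h4 : eps p N 1 (-1) = 0 := eps_neg (by norm_num)
  have h5 : eps p N 2 (-2) = 0 := eps_neg (by norm_num)
  norm_num at h3
  rw [h3, h4, h5, zero_add]

lemma eps2_eq (hp : 0 < p) (hp1 : p < 1) {N : ℕ} (hN : 3 ≤ N) : ∀ (m : ℕ) (_ : m + 4 ≤ N), eps p N 2 (m + 1 : ℕ) = fh p m
  | 0, hm => by
    have h := eps_rec hp N 1 (n := ((0 + 1 : ℕ) : ℤ)) (by omega)
    have h2 := eps1_eq hp hp1 hN 0 (by omega)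
    have h3 : eps p N 2 (-1) = 0 := eps_neg (by norm_num)
    rw [fh_eq]
    norm_num at *
    rw [h, h2, h3, zero_add]
  | 1, hm => by
    have h := eps_rec hp N 1 (n := ((1 + 1 : ℕ) : ℤ)) (by omega)
    have h2 := eps1_eq hp hp1 hN 1 (by omega)
    have h3 := eps2_zero hp hN
    rw [fh_eq]
    norm_num at *
    rw [h, h2, h3, zero_add]
  | m + 2, hm => by
    have h := eps_rec hp N 1 (n := ((m + 2 + 1 : ℕ) : ℤ)) (by omega)
    have h2 := eps1_eq hp hp1 hN (m + 2) (by omega)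
    rw [fh_rec, ← eps2_eq hp hp1 hN m (by omega), ← h2]
    rw [h]
    congr 1
    · congr 1; push_cast; ring
    · congr 1; push_cast; ring

lemma DD_eq (hp : 0 < p) (hp1 : p < 1) {N : ℕ} (hN : 3 ≤ N) : ∀ (m : ℕ) (_ : m + 3 ≤ N),
    DD p N m = fh p m - (if m = 0 then 0 else fh p (m - 1))
  | 0, hm => by
    have h := DD_rec hp hp1 (n := ((0 : ℕ) : ℤ)) (by omega) hN
    rw [DD_neg (n := ((0 : ℕ) : ℤ) - 2) (by simp), ← eps_zero_eq, eps_zero hp hp1 hN 0 (by omega)] at h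
    rw [h, fh_eq]; simp [e1]
  | 1, hm => by
    have h := DD_rec hp hp1 (n := ((1 : ℕ) : ℤ)) (by omega) hN
    rw [DD_neg (n := ((1 : ℕ) : ℤ) - 2) (by simp), ← eps_zero_eq, eps_zero hp hp1 hN 1 (by omega)] at h
    rw [h, fh_eq, fh_eq]; simp [e1, Finset.sum_range_succ]
  | 2, hm => by
    have h := DD_rec hp hp1 (n := ((2 : ℕ) : ℤ)) (by omega) hN
    have h0 := DD_eq hp hp1 hN 0 (by omega)
    rw [← eps_zero_eq, eps_zero hp hp1 hN 2 (by omega)] at h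
    rw [h, fh_eq, fh_eq]
    simp at h0 ⊢
    rw [h0, fh_eq]
    norm_num [e1, Finset.sum_range_succ]; ring
  | m + 3, hm => by
    have h := DD_rec hp hp1 (n := ((m + 3 : ℕ) : ℤ)) (by omega) hN
    have h0 := DD_eq hp hp1 hN (m + 1) (by omega)
    rw [← eps_zero_eq, eps_zero hp hp1 hN (m + 3) (by omega),
      show (((m + 3 : ℕ) : ℤ) - 2) = ((m + 1 : ℕ) : ℤ) by push_cast; ring, h0] at h
    rw [h]
    simp
    rw [show m + 3 = m + 1 + 2 by ring, fh_rec, fh_rec, show m + 1 + 2 = m + 2 + 1 by ring, e1_rec]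
    ring

theorem HH_final (hp : 0 < p) (hp1 : p < 1) {N n : ℕ} (hN : n + 4 ≤ N) :
    HH p N n = (1 + p⁻¹) * fh p n - (if n = 0 then 0 else fh p (n - 1)) := by
  rw [HH_eq hp (by omega) (by omega), DD_eq hp hp1 (by omega) n (by omega)]
  rcases n with _ | n
  · simp
    rw [eps2_zero hp (by omega)]; simp
  · rw [eps2_eq hp hp1 (by omega) n (by omega)]
    simp
    ring

end PF

namespace PF
variable {p : ℝ}

/-- lists of length `a` and sum `b` -/
def comps : ℕ → ℕ → Finset (List ℕ)
  | 0, b => if b = 0 then {[]} else ∅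
  | a + 1, b => (Finset.range (b + 1)).biUnion fun d => (comps a d).image fun t => (b - d) :: t

lemma mem_comps : ∀ {a b : ℕ} {m : List ℕ}, m ∈ comps a b ↔ m.length = a ∧ m.sum = b
  | 0, b, m => by
    rw [comps]
    split_ifs with h
    · subst h
      rw [Finset.mem_singleton, List.length_eq_zero_iff]
      constructor
      · rintro rfl; simp
      · exact fun h => h.1
    · simp only [Finset.notMem_empty, false_iff, List.length_eq_zero_iff]
      rintro ⟨rfl, h2⟩
      simp at h2; omega
  | a + 1, b, m => by
    simp only [comps, Finset.mem_biUnion, Finset.mem_range, Finset.mem_image, mem_comps]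
    constructor
    · rintro ⟨d, hd, t, ⟨h1, h2⟩, rfl⟩
      simp [h1, h2]; omega
    · rintro ⟨h1, h2⟩
      rcases m with _ | ⟨c, t⟩
      · simp at h1
      · simp at h1 h2
        exact ⟨t.sum, by omega, t, ⟨h1, rfl⟩, by rw [← h2]; simp⟩

lemma sum_comps_succ (a b : ℕ) (f : List ℕ → ℝ) :
    ∑ m ∈ comps (a + 1) b, f m = ∑ d ∈ Finset.range (b + 1), ∑ t ∈ comps a d, f ((b - d) :: t) := by
  rw [comps, Finset.sum_biUnion]
  · refine Finset.sum_congr rfl fun d _ => ?_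
    rw [Finset.sum_image]
    intro x _ y _ h
    simpa using h
  · intro d hd d' hd' hne
    rw [Function.onFun, Finset.disjoint_left]
    simp only [Finset.mem_image, mem_comps]
    rintro _ ⟨t, ⟨_, h1⟩, rfl⟩ ⟨t', ⟨_, h2⟩, h3⟩
    simp at h3
    apply hne
    rw [← h1, ← h2, h3.2]

/-- inversion statistic -/
def invn : List ℕ → ℕ
  | [] => 0
  | _ :: t => t.sum + invn t

def zl : ℕ → List ℕ → List (ℕ × ℕ)
  | _, [] => []
  | k, c :: t => if c = 0 then (k, t.sum) :: zl (k + 1) t else zl (k + 1) t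

noncomputable def W0 (p : ℝ) (a b : ℕ) : ℝ := ∑ m ∈ comps a b, p ^ invn m

lemma W0_succ (a b : ℕ) : W0 p (a + 1) b = ∑ d ∈ Finset.range (b + 1), p ^ d * W0 p a d := by
  rw [W0, sum_comps_succ]
  refine Finset.sum_congr rfl fun d _ => ?_
  rw [W0, Finset.mul_sum]
  refine Finset.sum_congr rfl fun t ht => ?_
  rw [invn, (mem_comps.mp ht).2, pow_add]

lemma W0_eq (a b : ℕ) : W0 p a b = qb p (a + b - 1) b := by
  induction a generalizing b with
  | zero =>
    rcases b with _ | b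
    · simp [W0, comps, invn]
    · rw [qb_eq_zero (by omega)]; simp [W0, comps]
  | succ a ih =>
    rw [W0_succ]
    induction b with
    | zero => simp [ih]
    | succ b ihb =>
      rw [Finset.sum_range_succ, ihb, ih, show a + 1 + (b + 1) - 1 = a + b + 1 by omega, qb_succ_succ,
        show a + 1 + b - 1 = a + b by omega, show a + (b + 1) - 1 = a + b by omega]

lemma comps_sum_eq {a b : ℕ} {m : List ℕ} (h : m ∈ comps a b) : m.sum = b := (mem_comps.mp h).2

/-- single zeros -/
noncomputable def zs1 (p : ℝ) (ψ : ℕ → ℝ) (k : ℕ) (m : List ℕ) : ℝ :=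
  ((zl k m).map fun x => (p ^ x.2)⁻¹ * ψ x.1).sum

lemma zs1_cons (ψ : ℕ → ℝ) (k c : ℕ) (t : List ℕ) :
    zs1 p ψ k (c :: t) = (if c = 0 then (p ^ t.sum)⁻¹ * ψ k else 0) + zs1 p ψ (k + 1) t := by
  rw [zs1, zl]; split_ifs <;> simp [zs1]

lemma single_zero (hp : 0 < p) (ψ : ℕ → ℝ) (k a b : ℕ) :
    ∑ m ∈ comps (a + 1) b, p ^ invn m * zs1 p ψ k m = W0 p a b * ∑ i ∈ Finset.range (a + 1), ψ (k + i) := by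
  induction a generalizing k b with
  | zero =>
    rw [sum_comps_succ, Finset.sum_range_succ']
    simp [comps, W0, zs1_cons, invn]
    rcases b with _ | b <;> simp [zs1, zl, invn]
  | succ a ih =>
    rw [sum_comps_succ]
    have : ∀ d ∈ Finset.range (b + 1), ∑ t ∈ comps (a + 1) d, p ^ invn ((b - d) :: t) * zs1 p ψ k ((b - d) :: t)
        = (if d = b then W0 p (a + 1) d * ψ k else 0) +
          p ^ d * W0 p a d * ∑ i ∈ Finset.range (a + 1), ψ (k + 1 + i) := by
      intro d hd
      rw [mul_assoc, ← ih, Finset.mul_sum]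
      simp at hd
      by_cases e : d = b
      · rw [if_pos e, W0, Finset.sum_mul, ← Finset.sum_add_distrib]
        refine Finset.sum_congr rfl fun t ht => ?_
        rw [zs1_cons, invn, comps_sum_eq ht, pow_add, if_pos (by omega)]
        field_simp
      · rw [if_neg e, zero_add]
        refine Finset.sum_congr rfl fun t ht => ?_
        rw [zs1_cons, invn, comps_sum_eq ht, pow_add, if_neg (by omega)]
        ring
    rw [Finset.sum_congr rfl this, Finset.sum_add_distrib, Finset.sum_ite_eq' (Finset.range (b + 1)) b, if_pos (by simp),
      ← Finset.sum_mul, ← W0_succ, Finset.sum_range_succ' _ (a + 1), mul_add, add_comm]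
    congr 2
    refine Finset.sum_congr rfl fun i _ => ?_
    congr 1; omega

/-- sum of products over pairs of entries -/
def psum : List ℝ → ℝ
  | [] => 0
  | x :: l => x * l.sum + psum l

noncomputable def zs2 (p : ℝ) (ψ : ℕ → ℝ) (k : ℕ) (m : List ℕ) : ℝ :=
  psum ((zl k m).map fun x => (p ^ x.2)⁻¹ * ψ x.1)

lemma zs2_cons (ψ : ℕ → ℝ) (k c : ℕ) (t : List ℕ) :
    zs2 p ψ k (c :: t) = (if c = 0 then (p ^ t.sum)⁻¹ * ψ k * zs1 p ψ (k + 1) t else 0) + zs2 p ψ (k + 1) t := by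
  rw [zs2, zl]; split_ifs <;> simp [zs1, zs2, psum]

noncomputable def pPsi (ψ : ℕ → ℝ) : ℕ → ℕ → ℝ
  | _, 0 => 0
  | k, a + 1 => ψ k * (∑ i ∈ Finset.range a, ψ (k + 1 + i)) + pPsi ψ (k + 1) a

lemma pair_zero_small (ψ : ℕ → ℝ) (k b : ℕ) {m : List ℕ} (hm : m ∈ comps 1 b) : zs2 p ψ k m = 0 := by
  obtain ⟨c, rfl⟩ := List.length_eq_one_iff.mp (mem_comps.mp hm).1
  by_cases h : c = 0 <;> simp [zs2, zl, psum, h]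

lemma pair_zero (hp : 0 < p) (ψ : ℕ → ℝ) (k a b : ℕ) :
    ∑ m ∈ comps (a + 2) b, p ^ invn m * zs2 p ψ k m = W0 p a b * pPsi ψ k (a + 2) := by
  induction a generalizing k b with
  | zero =>
    rw [sum_comps_succ, Finset.sum_eq_single b]
    · have := single_zero hp ψ (k + 1) 0 b
      have e : ∑ t ∈ comps 1 b, p ^ invn ((b - b) :: t) * zs2 p ψ k ((b - b) :: t)
         = ψ k * ∑ t ∈ comps 1 b, p ^ invn t * zs1 p ψ (k + 1) t := by
        rw [Finset.mul_sum]
        refine Finset.sum_congr rfl fun t ht => ?_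
        rw [zs2_cons, pair_zero_small _ _ _ ht, invn, comps_sum_eq ht, pow_add, if_pos (by omega)]
        field_simp; ring
      rw [zero_add, e, this]; simp [pPsi]; ring
    · intro d hd hne
      refine Finset.sum_eq_zero fun t ht => ?_
      simp at hd
      rw [zs2_cons, pair_zero_small _ _ _ ht, if_neg (by omega)]; simp
    · simp
  | succ a ih =>
    rw [sum_comps_succ]
    have : ∀ d ∈ Finset.range (b + 1), ∑ t ∈ comps (a + 2) d, p ^ invn ((b - d) :: t) * zs2 p ψ k ((b - d) :: t)
        = (if d = b then ψ k * (W0 p (a + 1) d * ∑ i ∈ Finset.range (a + 2), ψ (k + 1 + i)) else 0) +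
          p ^ d * W0 p a d * pPsi ψ (k + 1) (a + 2) := by
      intro d hd
      rw [mul_assoc, ← ih]
      simp at hd
      by_cases e : d = b
      · rw [if_pos e, ← single_zero hp, Finset.mul_sum, Finset.mul_sum, ← Finset.sum_add_distrib]
        refine Finset.sum_congr rfl fun t ht => ?_
        rw [zs2_cons, invn, comps_sum_eq ht, pow_add, if_pos (by omega)]
        field_simp
      · rw [if_neg e, zero_add, Finset.mul_sum]
        refine Finset.sum_congr rfl fun t ht => ?_
        rw [zs2_cons, invn, comps_sum_eq ht, pow_add, if_neg (by omega)]
        ring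
    rw [show a + 1 + 1 = a + 2 from rfl, Finset.sum_congr rfl this, Finset.sum_add_distrib, Finset.sum_ite_eq' (Finset.range (b + 1)) b, if_pos (by simp),
      ← Finset.sum_mul, ← W0_succ]
    rw [show pPsi ψ k (a + 1 + 2) = ψ k * (∑ i ∈ Finset.range (a+2), ψ (k + 1 + i)) + pPsi ψ (k + 1) (a+2) from rfl]
    ring

end PF

namespace PF
variable {p : ℝ}

lemma qb_one (n : ℕ) : qb p n 1 = qi p n := by
  induction n with
  | zero => simp
  | succ n ih =>
    rw [qb_succ_succ, ih, add_comm n 1, qi_add]; simp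

lemma sum_inv (hp : 0 < p) (a : ℕ) : ∑ i ∈ Finset.range (a + 1), (p⁻¹) ^ i = qi p (a + 1) / p ^ a := by
  induction a with
  | zero => simp
  | succ a ih =>
    rw [Finset.sum_range_succ, ih, add_comm (a + 1) 1, qi_add 1 (a + 1), qi_one, inv_pow, pow_one, pow_succ]; field_simp; ring

lemma pPsi_eq (hp : 0 < p) (k a : ℕ) :
    pPsi (fun i => (p⁻¹) ^ i) k (a + 2) * p ^ (2 * k) * p ^ ((a + 2).choose 2) = p ^ (a.choose 2) * qb p (a + 2) 2 := by
  induction a generalizing k with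
  | zero =>
    simp [pPsi]
    field_simp; ring
  | succ a ih =>
    rw [show a + 1 + 2 = (a + 2) + 1 from rfl, show pPsi (fun i => (p⁻¹) ^ i) k (a + 2 + 1) = p⁻¹ ^ k * (∑ i ∈ Finset.range (a+2), p⁻¹ ^ (k + 1 + i)) + pPsi (fun i => (p⁻¹) ^ i) (k + 1) (a+2) from rfl]
    have h1 := ih (k + 1)
    have h2 := sum_inv hp (a + 1)
    have h3 : ∑ i ∈ Finset.range (a+2), p⁻¹ ^ (k + 1 + i) = p⁻¹ ^ (k + 1) * (qi p (a + 2) / p ^ (a + 1)) := by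
      rw [← h2, Finset.mul_sum]
      exact Finset.sum_congr rfl fun i _ => by rw [pow_add]
    rw [h3, qb_succ_succ' hp (a + 1) 1, qb_one, choose_pred (a + 2)]
    have h4 : pPsi (fun i => (p⁻¹) ^ i) (k + 1) (a+2) = p ^ (a.choose 2) * qb p (a + 2) 2 / (p ^ (2 * (k + 1)) * p ^ ((a + 2).choose 2)) := by
      rw [← h1]; field_simp
    rw [h4, choose_pred2 a, choose_pred a, inv_pow, inv_pow]
    field_simp
    ring

/-- same letter pairs -/
lemma pair_edge (hp : 0 < p) {a b : ℕ} (h : a = 0 → b = 0) :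
    p ^ (a.choose 2) * ∑ m ∈ comps a b, p ^ invn m * zs2 p (fun i => (p⁻¹) ^ i) 0 m = edge p a b * rX p a b 2 := by
  have hE := (edge_pos hp h).ne'
  rw [rX, mul_div_cancel₀ _ hE]
  rcases a with _ | _ | a
  · rw [Xk_big (by norm_num), Finset.sum_eq_zero]; · simp
    intro m hm
    obtain rfl := List.length_eq_zero_iff.mp (mem_comps.mp hm).1
    simp [zs2, zl, psum]
  · rw [Xk_big (by norm_num), Finset.sum_eq_zero]; · simp
    intro m hm
    rw [pair_zero_small _ _ _ hm, mul_zero]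
  · have := pPsi_eq hp 0 a
    simp only [mul_zero, pow_zero, mul_one] at this
    rw [pair_zero hp, Xk, W0_eq]
    rw [show a + 1 + 1 - 2 = a by omega, ← this]; ring

lemma single_edge (hp : 0 < p) {a b : ℕ} (h : a = 0 → b = 0) :
    p ^ (a.choose 2) * ∑ m ∈ comps a b, p ^ invn m * zs1 p (fun i => (p⁻¹) ^ i) 0 m = edge p a b * rX p a b 1 := by
  have hE := (edge_pos hp h).ne'
  rw [rX, mul_div_cancel₀ _ hE]
  rcases a with _ | a
  · rw [Xk_big (by norm_num), Finset.sum_eq_zero]; · simp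
    intro m hm
    obtain rfl := List.length_eq_zero_iff.mp (mem_comps.mp hm).1
    simp [zs1, zl]
  · rw [single_zero hp, Xk, W0_eq]
    simp only [Nat.add_sub_cancel, zero_add]
    rw [sum_inv hp, qb_one, choose_pred]
    field_simp; ring

lemma plain_edge (a b : ℕ) : p ^ (a.choose 2) * ∑ m ∈ comps a b, p ^ invn m = edge p a b := by
  rw [edge, ← W0_eq]; rfl

def split : ℕ → List ℕ → List ℕ
  | _, [] => []
  | k, c :: t => if k < c then k :: (c - 1 - k) :: t else c :: split (k - c) t

lemma split_sum (hp : 0 < p) (φ : List ℕ → ℝ) (a b : ℕ) :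
    ∑ m ∈ comps a (b + 1), ∑ k ∈ Finset.range (b + 1), p ^ invn m * (p⁻¹) ^ k * φ (split k m)
      = (p⁻¹) ^ b * qi p a * ∑ m ∈ comps (a + 1) b, p ^ invn m * φ m := by
  induction a generalizing b φ with
  | zero => simp [comps]
  | succ a ih =>
    rw [sum_comps_succ]
    have step : ∀ d ∈ Finset.range (b + 1 + 1), ∑ t ∈ comps a d, ∑ k ∈ Finset.range (b + 1),
        p ^ invn ((b + 1 - d) :: t) * (p⁻¹) ^ k * φ (split k ((b + 1 - d) :: t))
        = (∑ t ∈ comps a d, ∑ k ∈ Finset.range (b + 1 - d), p ^ (d + invn t) * (p⁻¹) ^ k * φ (k :: (b - d - k) :: t))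
          + p ^ d * (p⁻¹) ^ (b + 1 - d) * ∑ t ∈ comps a d, ∑ k ∈ Finset.range d, p ^ invn t * (p⁻¹) ^ k * φ ((b + 1 - d) :: split k t) := by
      intro d hd
      rw [Finset.mul_sum, ← Finset.sum_add_distrib]
      refine Finset.sum_congr rfl fun t ht => ?_
      simp only [Finset.mem_range] at hd
      conv_lhs => rw [show b + 1 = (b + 1 - d) + d by omega]
      rw [Finset.sum_range_add, Finset.mul_sum]
      have ed : b + 1 - d + d - d = b + 1 - d := by omega
      rw [ed]
      congr 1
      · refine Finset.sum_congr rfl fun k hk => ?_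
        rw [Finset.mem_range] at hk
        rw [split, if_pos hk, invn, comps_sum_eq ht, show b + 1 - d - 1 - k = b - d - k by omega]
      · refine Finset.sum_congr rfl fun k hk => ?_
        rw [split, if_neg (by omega), invn, comps_sum_eq ht, Nat.add_sub_cancel_left, pow_add, pow_add]
        ring
    rw [Finset.sum_congr rfl step, Finset.sum_add_distrib, add_comm a 1, qi_add 1 a, qi_one, pow_one, mul_add, mul_one, add_mul]
    congr 1
    · rw [Finset.sum_range_succ]
      have z : ∑ t ∈ comps a (b + 1), ∑ k ∈ Finset.range (b + 1 - (b + 1)), p ^ (b + 1 + invn t) * (p⁻¹) ^ k * φ (k :: (b - (b + 1) - k) :: t) = 0 := by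
        simp
      rw [z, add_zero, add_comm 1 a, sum_comps_succ, Finset.mul_sum]
      have e2 : ∀ d ∈ Finset.range (b + 1), p⁻¹ ^ b * ∑ t ∈ comps (a + 1) d, p ^ invn ((b - d) :: t) * φ ((b - d) :: t)
          = ∑ d' ∈ Finset.range (d + 1), ∑ t ∈ comps a d', (p⁻¹) ^ (b - d) * p ^ (d' + invn t) * φ ((b - d) :: (d - d') :: t) := by
        intro d hd
        rw [Finset.mem_range] at hd
        rw [sum_comps_succ, Finset.mul_sum]
        refine Finset.sum_congr rfl fun d' hd' => ?_
        rw [Finset.mem_range] at hd'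
        rw [Finset.mul_sum]
        refine Finset.sum_congr rfl fun t ht => ?_
        rw [invn, invn, List.sum_cons, comps_sum_eq ht, show d - d' + d' + (d' + invn t) = d + (d' + invn t) by omega, pow_add p d]
        have : p⁻¹ ^ b = p⁻¹ ^ (b - d) * p⁻¹ ^ d := by rw [← pow_add]; congr 1; omega
        rw [this, inv_pow p d]; field_simp
      rw [Finset.sum_congr rfl e2]
      have e1 : ∀ d ∈ Finset.range (b + 1), (∑ t ∈ comps a d, ∑ k ∈ Finset.range (b + 1 - d), p ^ (d + invn t) * (p⁻¹) ^ k * φ (k :: (b - d - k) :: t))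
          = ∑ k ∈ Finset.range (b + 1 - d), ∑ t ∈ comps a d, p⁻¹ ^ k * p ^ (d + invn t) * φ (k :: (b - d - k) :: t) := by
        intro d _
        rw [Finset.sum_comm]
        exact Finset.sum_congr rfl fun k _ => Finset.sum_congr rfl fun t _ => by ring
      rw [Finset.sum_congr rfl e1, Finset.sum_sigma' (Finset.range (b + 1)) (fun d => Finset.range (b + 1 - d)), Finset.sum_sigma' (Finset.range (b + 1)) (fun d => Finset.range (d + 1))]
      refine Finset.sum_nbij' (fun x => ⟨b - x.2, x.1⟩) (fun x => ⟨x.2, b - x.1⟩) ?_ ?_ ?_ ?_ ?_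
      · rintro ⟨d, k⟩ h; simp at h ⊢; omega
      · rintro ⟨d, k⟩ h; simp at h ⊢; omega
      · rintro ⟨d, k⟩ h; simp at h ⊢; omega
      · rintro ⟨d, k⟩ h; simp at h ⊢; omega
      · rintro ⟨d, k⟩ h
        simp only [Finset.mem_sigma, Finset.mem_range] at h
        dsimp only
        rw [show b - (b - k) = k by omega, show b - d - k = b - k - d by omega]
    · rw [Finset.sum_range_succ']
      simp only [Finset.range_zero, Finset.sum_empty, Finset.sum_const_zero, mul_zero, add_zero]
      rw [add_comm 1 a, sum_comps_succ, Finset.mul_sum]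
      refine Finset.sum_congr rfl fun d hd => ?_
      rw [Finset.mem_range] at hd
      have := ih (fun t => φ ((b + 1 - (d + 1)) :: t)) d
      rw [this]
      rw [show b + 1 - (d + 1) = b - d by omega]
      have h5 : ∑ t ∈ comps (a + 1) d, p ^ invn ((b - d) :: t) * φ ((b - d) :: t) = p ^ d * ∑ t ∈ comps (a + 1) d, p ^ invn t * φ ((b - d) :: t) := by
        rw [Finset.mul_sum]
        refine Finset.sum_congr rfl fun t ht => ?_
        rw [invn, comps_sum_eq ht, pow_add]; ring
      have : p⁻¹ ^ b = p⁻¹ ^ (b - d) * p⁻¹ ^ d := by rw [← pow_add]; congr 1; omega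
      rw [h5, this, pow_succ]; ring

/-- adjacent letters -/
lemma adj_edge (hp : 0 < p) (a b f : ℕ) :
    p ^ (a.choose 2) * p ^ (b.choose 2) * ∑ m' ∈ comps b f, p ^ invn m' *
      zs1 p (fun k => (p⁻¹) ^ k * ∑ m ∈ comps a b, p ^ invn m * zs1 p (fun i => (p⁻¹) ^ i) 0 (split k m)) 0 m'
      = edge p a b * edge p b f * adj p a b f := by
  rcases b with _ | b
  · rw [adj, rX_zero _ _ (by norm_num), Finset.sum_eq_zero]; · simp
    intro m hm
    obtain rfl := List.length_eq_zero_iff.mp (mem_comps.mp hm).1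
    simp [zs1, zl]
  rw [single_zero hp]
  have h1 : ∑ k ∈ Finset.range (b + 1), (p⁻¹ ^ (0 + k) * ∑ m ∈ comps a (b + 1), p ^ invn m * zs1 p (fun i => (p⁻¹) ^ i) 0 (split (0 + k) m))
      = p⁻¹ ^ b * qi p a * ∑ m ∈ comps (a + 1) b, p ^ invn m * zs1 p (fun i => (p⁻¹) ^ i) 0 m := by
    rw [← split_sum hp, Finset.sum_comm]
    refine Finset.sum_congr rfl fun k _ => ?_
    rw [zero_add, Finset.mul_sum]
    exact Finset.sum_congr rfl fun m _ => by ring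
  rw [h1, single_zero hp]
  simp only [zero_add]
  rw [sum_inv hp, adj]
  have hE := (edge_pos hp (a := b + 1) (b := f) (by simp)).ne'
  have h2 : edge p (b + 1) f * rX p (b + 1) f 1 = p ^ (b.choose 2) * qi p (b + 1) * W0 p b f := by
    rw [rX, mul_div_cancel₀ _ hE, Xk, W0_eq, qb_one, Nat.add_sub_cancel]
  rw [show edge p a (b + 1) * edge p (b + 1) f * (qi p a * qi p (a + 1) / (p ^ a * qi p (a + (b + 1) - 1)) * rX p (b + 1) f 1) = edge p a (b + 1) * (qi p a * qi p (a + 1) / (p ^ a * qi p (a + (b + 1) - 1))) * (edge p (b + 1) f * rX p (b + 1) f 1) by ring, h2]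
  rcases a with _ | a
  · simp
  have h3 := qb_diag hp a b
  have h4 : W0 p (a + 1) b = qb p (a + b) b := by rw [W0_eq]; congr 1; omega
  have h5 := (qi_pos hp (a + b)).ne'
  rw [h4, edge, choose_pred b, show a + 1 + (b + 1) - 1 = a + b + 1 by omega]
  rw [show a + (b + 1) = a + b + 1 by omega, show (a + b + 1) = a + b + 1 from rfl] at h3
  have h6 : qb p (a + b + 1) (b + 1) = qb p (a + b) b * qi p (a + b + 1) / qi p (b + 1) := by
    rw [← h3]; have := (qi_pos hp b).ne'; field_simp
  have := (qi_pos hp b).ne'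
  rw [h6, inv_pow]
  field_simp
  ring
end PF

namespace PF

def bound : List ℕ → ℕ
  | [] => 0
  | y :: _ => y + 1

def Valid : List ℕ → Prop
  | [] => True
  | x :: B => x ≤ bound B ∧ Valid B

def bump : List ℕ → List ℕ
  | [] => []
  | c :: t => (c + 1) :: t

def mvec (j : ℕ) : List ℕ → List ℕ
  | [] => []
  | y :: B => if y = j then 0 :: mvec j B else if y = j + 1 then bump (mvec j B) else mvec j B

lemma bump_length (m : List ℕ) : (bump m).length = m.length := by cases m <;> simp [bump]

lemma invn_bump (m : List ℕ) : invn (bump m) = invn m := by cases m <;> simp [bump, invn]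

lemma bump_sum {m : List ℕ} (h : m ≠ []) : (bump m).sum = m.sum + 1 := by
  cases m
  · simp at h
  · simp [bump]; omega

lemma mvec_length (j : ℕ) (L : List ℕ) : (mvec j L).length = L.count j := by
  induction L with
  | nil => simp [mvec]
  | cons y B ih =>
    rw [mvec, List.count_cons]
    split_ifs with h1 h2 h3 h3
    · simp [ih]
    · simp [h1] at h2
    · simp at h3; omega
    · simp [bump_length, ih]
    · simp at *; omega
    · simp [ih]

lemma mem_of_bound {j : ℕ} : ∀ {B : List ℕ}, Valid B → j < bound B → j ∈ B
  | [], _, h => by simp [bound] at h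
  | y :: B, hv, h => by
    simp only [bound] at h
    by_cases e : j = y
    · simp [e]
    · exact List.mem_cons_of_mem _ (mem_of_bound hv.2 (lt_of_lt_of_le (by omega) hv.1))

lemma mvec_ne {j : ℕ} {B : List ℕ} (hv : Valid B) (h : j < bound B) : mvec j B ≠ [] := by
  intro e
  have := mvec_length j B
  rw [e] at this
  have h2 := List.count_pos_iff.mpr (mem_of_bound hv h)
  simp at this; omega

lemma mvec_sum (j : ℕ) : ∀ {L : List ℕ}, Valid L → (mvec j L).sum = L.count (j + 1)
  | [], _ => by simp [mvec]
  | y :: B, hv => by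
    have ih := mvec_sum j hv.2
    rw [mvec, List.count_cons]
    split_ifs with h1 h2 h3 h3
    · simp at h2; omega
    · simp [ih]
    · rw [bump_sum (mvec_ne hv.2 (lt_of_lt_of_le (by omega) hv.1)), ih]
    · simp at h3; omega
    · simp at *; omega
    · simp [ih]

def dinv : List ℕ → ℕ
  | [] => 0
  | y :: B => B.count y + B.count (y + 1) + dinv B

lemma dinv_eq (K : ℕ) : ∀ {L : List ℕ}, Valid L → (∀ x ∈ L, x < K) →
    dinv L = ∑ j ∈ Finset.range K, ((L.count j).choose 2 + invn (mvec j L))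
  | [], _, _ => by simp [dinv, mvec, invn]
  | y :: B, hv, hK => by
    have ih := dinv_eq K hv.2 (fun x hx => hK x (List.mem_cons_of_mem _ hx))
    have hy : y < K := hK y (by simp)
    have : ∀ j ∈ Finset.range K, (((y :: B).count j).choose 2 + invn (mvec j (y :: B)))
        = ((B.count j).choose 2 + invn (mvec j B)) + if j = y then B.count y + B.count (y + 1) else 0 := by
      intro j _
      rw [mvec, List.count_cons]
      by_cases h1 : y = j
      · subst h1
        simp only [beq_self_eq_true, if_true, invn, mvec_sum _ hv.2, choose_pred]
        omega
      · have h2 : ¬ (j = y) := fun e => h1 e.symm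
        simp only [beq_iff_eq, if_neg h1, if_neg h2]
        split_ifs <;> simp [invn_bump]
    rw [Finset.sum_congr rfl this, Finset.sum_add_distrib, ← ih, Finset.sum_ite_eq' (Finset.range K) y, if_pos (by simpa using hy), dinv]
    omega

/-- insert letters `J+1` -/
def expand (J : ℕ) : List ℕ → List ℕ → List ℕ
  | [], _ => []
  | x :: u, [] => x :: expand J u []
  | x :: u, c :: t => if x = J then List.replicate c (J + 1) ++ J :: expand J u t else x :: expand J u (c :: t)

lemma filter_expand (J : ℕ) : ∀ (u m : List ℕ), (∀ x ∈ u, x ≤ J) → (expand J u m).filter (fun x => x ≠ J + 1) = u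
  | [], _, _ => by simp [expand]
  | x :: u, [], h => by
    have hx : x ≤ J := h x (by simp)
    have := filter_expand J u [] (fun y hy => h y (List.mem_cons_of_mem _ hy))
    rw [expand, List.filter_cons_of_pos (by simp; omega), this]
  | x :: u, c :: t, h => by
    have hx : x ≤ J := h x (by simp)
    have hu := (fun y hy => h y (List.mem_cons_of_mem x hy))
    rw [expand]
    split_ifs with e
    · rw [List.filter_append, List.filter_cons_of_pos (by simp), filter_expand J u t hu, e]
      simp
    · rw [List.filter_cons_of_pos (by simp; omega), filter_expand J u (c :: t) hu]

lemma mvec_rep (J c : ℕ) (R : List ℕ) : mvec J (List.replicate c (J + 1) ++ J :: R) = c :: mvec J R := by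
  induction c with
  | zero => simp [mvec]
  | succ c ih => rw [List.replicate_succ, List.cons_append, mvec, if_neg (by omega), if_pos rfl, ih, bump]

lemma mvec_expand (J : ℕ) : ∀ (u m : List ℕ), (∀ x ∈ u, x ≤ J) → m.length = u.count J → mvec J (expand J u m) = m
  | [], m, _, h => by simp at h; simp [expand, mvec, h]
  | x :: u, [], h, hl => by
    have hx : x ≤ J := h x (by simp)
    rw [List.count_cons] at hl
    have hxJ : x ≠ J := by rintro rfl; simp at hl
    have := mvec_expand J u [] (fun y hy => h y (List.mem_cons_of_mem _ hy)) (by simp at hl ⊢; omega)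
    rw [expand, mvec, if_neg hxJ, if_neg (by omega), this]
  | x :: u, c :: t, h, hl => by
    have hx : x ≤ J := h x (by simp)
    have hu := (fun y hy => h y (List.mem_cons_of_mem x hy))
    rw [List.count_cons] at hl
    rw [expand]
    split_ifs with e
    · rw [mvec_rep, mvec_expand J u t hu (by simp [e] at hl; omega)]
    · rw [mvec, if_neg e, if_neg (by omega), mvec_expand J u (c :: t) hu (by simp [e] at hl ⊢; omega)]

lemma mvec_filter {j J : ℕ} (h : j < J) (L : List ℕ) : mvec j (L.filter (fun x => x ≠ J + 1)) = mvec j L := by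
  induction L with
  | nil => rfl
  | cons y B ih =>
    by_cases e : y = J + 1
    · rw [List.filter_cons_of_neg (by simp [e]), ih, mvec, if_neg (by omega), if_neg (by omega)]
    · rw [List.filter_cons_of_pos (by simp [e]), mvec, mvec, ih]

lemma Valid_rep (J c : ℕ) (R : List ℕ) (h : Valid (J :: R)) : Valid (List.replicate c (J + 1) ++ J :: R) ∧ J + 1 ≤ bound (List.replicate c (J + 1) ++ J :: R) := by
  induction c with
  | zero => simpa [bound] using h
  | succ c ih =>
    rw [List.replicate_succ, List.cons_append]
    exact ⟨⟨ih.2, ih.1⟩, by simp [bound]⟩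

lemma Valid_expand (J : ℕ) : ∀ (u m : List ℕ), Valid u → Valid (expand J u m) ∧ bound u ≤ bound (expand J u m)
  | [], m, _ => by simp [expand, Valid]
  | x :: u, [], h => by
    have := Valid_expand J u [] h.2
    exact ⟨⟨h.1.trans this.2, this.1⟩, le_rfl⟩
  | x :: u, c :: t, h => by
    rw [expand]
    split_ifs with e
    · subst e
      have := Valid_expand x u t h.2
      exact Valid_rep x c _ ⟨h.1.trans this.2, this.1⟩
    · have := Valid_expand J u (c :: t) h.2
      exact ⟨⟨h.1.trans this.2, this.1⟩, le_rfl⟩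

lemma bound_filter (J : ℕ) : ∀ (L : List ℕ), Valid L → min (bound L) (J + 1) ≤ bound (L.filter (fun x => x ≠ J + 1))
  | [], _ => by simp [bound]
  | y :: B, h => by
    by_cases e : y = J + 1
    · have := bound_filter J B h.2
      rw [List.filter_cons_of_neg (by simp [e])]
      have h1 := h.1
      change min (y + 1) (J + 1) ≤ _
      omega
    · rw [List.filter_cons_of_pos (by simp [e])]
      simp [bound]

lemma Valid_filter (J : ℕ) : ∀ (L : List ℕ), Valid L → (∀ x ∈ L, x ≤ J + 1) → Valid (L.filter (fun x => x ≠ J + 1))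
  | [], _, _ => by simp [Valid]
  | y :: B, h, hJ => by
    have ih := Valid_filter J B h.2 (fun x hx => hJ x (List.mem_cons_of_mem _ hx))
    by_cases e : y = J + 1
    · rw [List.filter_cons_of_neg (by simp [e])]; exact ih
    · rw [List.filter_cons_of_pos (by simp [e])]
      refine ⟨le_trans ?_ (bound_filter J B h.2), ih⟩
      have := hJ y (by simp)
      have := h.1
      omega

lemma head_filter (J : ℕ) : ∀ (L : List ℕ), Valid L → (∀ x ∈ L, x ≤ J + 1) → J + 1 ≤ bound L →
    ∃ u, L.filter (fun x => x ≠ J + 1) = J :: u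
  | [], _, _, h => by simp [bound] at h
  | y :: B, h, hJ, hb => by
    by_cases e : y = J + 1
    · rw [List.filter_cons_of_neg (by simp [e])]
      exact head_filter J B h.2 (fun x hx => hJ x (List.mem_cons_of_mem _ hx)) (by have := h.1; omega)
    · rw [List.filter_cons_of_pos (by simp [e])]
      have := hJ y (by simp)
      simp only [bound] at hb
      exact ⟨_, by rw [show y = J by omega]⟩

lemma expand_filter (J : ℕ) : ∀ (L : List ℕ), Valid L → (∀ x ∈ L, x ≤ J + 1) →
    expand J (L.filter (fun x => x ≠ J + 1)) (mvec J L) = L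
  | [], _, _ => by simp [expand]
  | y :: B, h, hJ => by
    have hJ' := (fun x hx => hJ x (List.mem_cons_of_mem y hx))
    have ih := expand_filter J B h.2 hJ'
    by_cases e : y = J + 1
    · rw [List.filter_cons_of_neg (by simp [e]), mvec, if_neg (by omega), if_pos e]
      have hb : J + 1 ≤ bound B := e ▸ h.1
      obtain ⟨u, hu⟩ := head_filter J B h.2 hJ' hb
      rw [hu] at ih ⊢
      obtain ⟨c, t, hm⟩ := List.exists_cons_of_ne_nil (mvec_ne h.2 (show J < bound B by omega))
      rw [hm] at ih ⊢
      rw [expand, if_pos rfl] at ih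
      rw [bump, expand, if_pos rfl, List.replicate_succ, List.cons_append, ih, e]
    · rw [List.filter_cons_of_pos (by simp [e]), mvec, if_neg e]
      split_ifs with e2
      · rw [expand, if_pos e2, ih, e2]; rfl
      · rcases hm : mvec J B with _ | ⟨c, t⟩
        · rw [expand, ← hm, ih]
        · rw [expand, if_neg e2, ← hm, ih]

def Lset (b : ℕ → ℕ) : ℕ → Finset (List ℕ)
  | 0 => {List.replicate (b 0) 0}
  | J + 1 => (Lset b J ×ˢ comps (b J) (b (J + 1))).image fun x => expand J x.1 x.2

lemma Valid_rep0 (c : ℕ) : Valid (List.replicate c 0) := by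
  induction c with
  | zero => simp [Valid]
  | succ c ih => rw [List.replicate_succ]; exact ⟨Nat.zero_le _, ih⟩

lemma count_filter' {j J : ℕ} (h : j ≠ J + 1) (L : List ℕ) : (L.filter (fun x => x ≠ J + 1)).count j = L.count j := by
  rw [List.count_filter]; simpa using h

lemma mem_Lset {b : ℕ → ℕ} : ∀ {J : ℕ} {L : List ℕ}, L ∈ Lset b J ↔
    Valid L ∧ (∀ x ∈ L, x ≤ J) ∧ ∀ j ≤ J, L.count j = b j
  | 0, L => by
    rw [Lset, Finset.mem_singleton]
    constructor
    · rintro rfl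
      refine ⟨Valid_rep0 _, fun x hx => by simp [List.eq_of_mem_replicate hx], fun j hj => ?_⟩
      obtain rfl : j = 0 := by omega
      simp
    · rintro ⟨_, h1, h2⟩
      have : L = List.replicate L.length 0 := List.eq_replicate_of_mem fun x hx => by simpa using h1 x hx
      have h3 := h2 0 le_rfl
      rw [this, List.count_replicate_self] at h3
      rw [this, h3]
  | J + 1, L => by
    simp only [Lset, Finset.mem_image, Finset.mem_product, mem_Lset, mem_comps, Prod.exists]
    constructor
    · rintro ⟨u, m, ⟨⟨h1, h2, h3⟩, h4, h5⟩, rfl⟩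
      have hf := filter_expand J u m h2
      have hv := (Valid_expand J u m h1).1
      have hm := mvec_expand J u m h2 (by rw [h4, h3 J le_rfl])
      refine ⟨hv, fun x hx => ?_, fun j hj => ?_⟩
      · by_cases e : x = J + 1
        · omega
        · have : x ∈ u := by rw [← hf]; simp [hx, e]
          have := h2 x this; omega
      · rcases Nat.lt_or_eq_of_le hj with h | rfl
        · rw [← count_filter' (J := J) (by omega), hf, h3 j (by omega)]
        · rw [← mvec_sum J hv, hm, h5]
    · rintro ⟨hv, h2, h3⟩
      refine ⟨L.filter (fun x => x ≠ J + 1), mvec J L, ⟨⟨Valid_filter J L hv h2, ?_, ?_⟩, ?_, ?_⟩, expand_filter J L hv h2⟩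
      · intro x hx
        simp at hx
        have := h2 x hx.1; omega
      · intro j hj
        rw [count_filter' (by omega), h3 j (by omega)]
      · rw [mvec_length, h3 J (by omega)]
      · rw [mvec_sum J hv, h3 (J + 1) le_rfl]

lemma sum_Lset (b : ℕ → ℕ) (g : ℕ → List ℕ → ℝ) (J : ℕ) :
    ∑ L ∈ Lset b J, ∏ j ∈ Finset.range J, g j (mvec j L) = ∏ j ∈ Finset.range J, ∑ m ∈ comps (b j) (b (j + 1)), g j m := by
  induction J with
  | zero => simp [Lset]
  | succ J ih =>
    have key : ∀ x ∈ Lset b J ×ˢ comps (b J) (b (J + 1)), (expand J x.1 x.2).filter (fun x => x ≠ J + 1) = x.1 ∧ mvec J (expand J x.1 x.2) = x.2 := by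
      rintro ⟨u, m⟩ h
      rw [Finset.mem_product, mem_Lset, mem_comps] at h
      exact ⟨filter_expand J u m h.1.2.1, mvec_expand J u m h.1.2.1 (by rw [h.2.1, h.1.2.2 J le_rfl])⟩
    rw [Lset, Finset.sum_image, Finset.prod_range_succ, ← ih, Finset.sum_mul_sum, Finset.sum_product]
    · refine Finset.sum_congr rfl fun u hu => Finset.sum_congr rfl fun m hm => ?_
      have := key (u, m) (Finset.mk_mem_product hu hm)
      rw [Finset.prod_range_succ, this.2]
      congr 1
      refine Finset.prod_congr rfl fun j hj => ?_
      rw [Finset.mem_range] at hj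
      rw [← mvec_filter hj, this.1]
    · intro x hx y hy h
      dsimp only at h
      have h1 := key x hx
      have h2 := key y hy
      rw [h] at h1
      exact Prod.ext (h1.1.symm.trans h2.1) (h1.2.symm.trans h2.2)

lemma Lset_legit {b : ℕ → ℕ} {J : ℕ} {L : List ℕ} (h : L ∈ Lset b J) {j : ℕ} (hj : j < J) (h0 : b j = 0) : b (j + 1) = 0 := by
  rw [mem_Lset] at h
  have h1 := mvec_length j L
  rw [h.2.2 j hj.le, h0] at h1
  have h2 := mvec_sum j h.1
  rw [List.length_eq_zero_iff.mp h1, h.2.2 (j + 1) hj] at h2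
  simpa using h2.symm

end PF

namespace PF
variable {p : ℝ}

def V (j : ℕ) : ℕ → ℕ → List ℕ → List (ℕ × ℕ)
  | _, _, [] => []
  | pr, k, x :: B =>
    if x = j then (if pr ≤ j then (k, B.count (j + 1)) :: V j x (k + 1) B else V j x (k + 1) B)
    else V j x k B

lemma mvec_big {j : ℕ} : ∀ {B : List ℕ}, Valid B → j + 2 ≤ bound B → ∃ c t, mvec j B = (c + 1) :: t
  | [], _, h => by simp [bound] at h
  | y :: B, hv, h => by
    simp only [bound] at h
    have h1 := hv.1
    rw [mvec, if_neg (by omega)]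
    split_ifs with e
    · obtain ⟨c, t, hm⟩ := List.exists_cons_of_ne_nil (mvec_ne hv.2 (show j < bound B by omega))
      exact ⟨c, t, by rw [hm, bump]⟩
    · exact mvec_big hv.2 (by omega)

lemma zl_bump2 (k : ℕ) (m : List ℕ) : zl k (bump (bump m)) = zl k (bump m) := by
  cases m <;> simp [bump, zl]

lemma V_eq (j : ℕ) : ∀ (L : List ℕ) (pr k : ℕ), Valid (pr :: L) →
    V j pr k L = zl k (if pr = j + 1 then bump (mvec j L) else mvec j L)
  | [], pr, k, _ => by simp [V, mvec, bump, zl]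
  | x :: B, pr, k, hv => by
    have h1 : pr ≤ x + 1 := hv.1
    have hvB := hv.2
    rw [V, mvec]
    by_cases e : x = j
    · rw [if_pos e, V_eq j B x (k + 1) hvB, if_neg (by omega : ¬ x = j + 1), if_pos e]
      by_cases e2 : pr ≤ j
      · rw [if_pos e2, if_neg (by omega), zl, if_pos rfl, mvec_sum j hvB.2]
      · rw [if_neg e2, if_pos (by omega), bump, zl, if_neg (by omega)]
    · rw [if_neg e, V_eq j B x k hvB, if_neg e]
      by_cases e3 : x = j + 1
      · rw [if_pos e3]
        split_ifs
        · rw [zl_bump2]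
        · rfl
      · rw [if_neg e3]
        split_ifs with e4
        · obtain ⟨c, t, hm⟩ := mvec_big (j := j) hvB.2 (by have := hvB.1; omega)
          rw [hm]; simp [bump, zl]
        · rfl

lemma V_full (j : ℕ) (L : List ℕ) (hv : Valid L) : V j 0 0 L = zl 0 (mvec j L) := by
  rw [V_eq j L 0 0 ⟨Nat.zero_le _, hv⟩, if_neg (by omega)]

noncomputable def gp (p : ℝ) (ψ : ℕ → ℝ) (j pr k : ℕ) (L : List ℕ) (v : ℕ) : ℝ :=
  if v < L.length ∧ L.getD v 0 = j ∧ (pr :: L).getD v 0 ≤ j then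
    (p ^ ((L.drop (v + 1)).count (j + 1)))⁻¹ * ψ (k + (L.take v).count j) else 0

lemma gp_zero (ψ : ℕ → ℝ) (j pr k x : ℕ) (B : List ℕ) :
    gp p ψ j pr k (x :: B) 0 = if x = j ∧ pr ≤ j then (p ^ (B.count (j + 1)))⁻¹ * ψ k else 0 := by
  simp [gp]

lemma gp_succ (ψ : ℕ → ℝ) (j pr k x : ℕ) (B : List ℕ) (v : ℕ) :
    gp p ψ j pr k (x :: B) (v + 1) = gp p ψ j x (if x = j then k + 1 else k) B v := by
  unfold gp
  simp only [List.length_cons, Nat.add_lt_add_iff_right, List.getD_cons_succ, List.drop_succ_cons, List.take_succ_cons, List.count_cons]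
  split_ifs <;> simp_all [add_assoc, add_comm, add_left_comm]

lemma gp_sum1 (ψ : ℕ → ℝ) (j : ℕ) : ∀ (L : List ℕ) (pr k : ℕ),
    ∑ v ∈ Finset.range L.length, gp p ψ j pr k L v = ((V j pr k L).map fun x => (p ^ x.2)⁻¹ * ψ x.1).sum
  | [], _, _ => by simp [V]
  | x :: B, pr, k => by
    rw [List.length_cons, Finset.sum_range_succ']
    simp only [gp_succ, gp_zero]
    rw [gp_sum1 ψ j B, V]
    split_ifs <;> simp_all [add_comm]

lemma gp_sum2 (ψ : ℕ → ℝ) (j : ℕ) : ∀ (L : List ℕ) (pr k : ℕ),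
    ∑ v ∈ Finset.range L.length, gp p ψ j pr k L v * ∑ v' ∈ Finset.range L.length, (if v < v' then gp p ψ j pr k L v' else 0)
      = psum ((V j pr k L).map fun x => (p ^ x.2)⁻¹ * ψ x.1)
  | [], _, _ => by simp [V, psum]
  | x :: B, pr, k => by
    rw [List.length_cons, Finset.sum_range_succ']
    simp only [Finset.sum_range_succ' _ B.length, gp_succ, gp_zero, Nat.add_lt_add_iff_right, Nat.not_lt_zero, if_false, add_zero, Nat.succ_pos, if_true]
    rw [gp_sum2 ψ j B, gp_sum1 ψ j B, V]
    split_ifs <;> simp_all [psum, add_comm]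

lemma mvec_split {j : ℕ} : ∀ (L : List ℕ) (v : ℕ), Valid L → v < L.length → L.getD v 0 = j + 1 →
    mvec j (L.set v j) = split ((L.take v).count (j + 1)) (mvec j L)
  | [], v, _, h, _ => by simp at h
  | x :: B, 0, hv, _, h => by
    simp at h
    have h1 := hv.1
    obtain ⟨c, t, hm⟩ := List.exists_cons_of_ne_nil (mvec_ne hv.2 (show j < bound B by omega))
    simp [mvec, h, hm, bump, split]
  | x :: B, v + 1, hv, hl, h => by
    simp only [List.getD_cons_succ] at h
    have ih := mvec_split B v hv.2 (by simpa using hl) h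
    rw [List.set_cons_succ, List.take_succ_cons, List.count_cons, mvec, mvec, ih]
    by_cases e : x = j
    · simp [e, split]
    · by_cases e2 : x = j + 1
      · have h1 := hv.1
        obtain ⟨c, t, hm⟩ := List.exists_cons_of_ne_nil (mvec_ne hv.2 (show j < bound B by omega))
        simp only [if_neg e, if_pos e2, hm, bump]
        simp only [e2, beq_self_eq_true, if_true]
        rw [split, split]
        by_cases e3 : (B.take v).count (j + 1) < c
        · rw [if_pos e3, if_pos (by omega)]
          simp only [List.cons.injEq, true_and, and_true]; omega
        · rw [if_neg e3, if_neg (by omega)]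
          simp only [List.cons.injEq, true_and]; congr 1; omega
      · simp [e, e2]

lemma Valid_set : ∀ (L : List ℕ) (pr v j : ℕ), Valid (pr :: L) → v < L.length → L.getD v 0 = j + 1 →
    (pr :: L).getD v 0 ≤ j + 1 → Valid (pr :: L.set v j)
  | [], _, _, _, _, h, _, _ => by simp at h
  | x :: B, pr, 0, j, hv, _, h, hp => by
    simp at h hp
    subst h
    exact ⟨hp, (Nat.le_succ j).trans hv.2.1, hv.2.2⟩
  | x :: B, pr, v + 1, j, hv, hl, h, hp => by
    exact ⟨hv.1, Valid_set B x v j hv.2 (by simpa using hl) (by simpa using h) (by simpa using hp)⟩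

end PF

namespace PF
variable {p : ℝ}

def ss (L : List ℕ) (v : ℕ) : ℕ := (L.take v).count (L.getD v 0) + (L.drop (v + 1)).count (L.getD v 0 + 1)
def vly (L : List ℕ) (v : ℕ) : Prop := v < L.length ∧ (0 :: L).getD v 0 ≤ L.getD v 0
def del (x₁ x₂ v₁ v₂ : ℕ) : ℕ := if x₂ + 2 < x₁ ∨ (x₁ = x₂ + 2 ∧ v₁ < v₂) then 1 else 0
instance (L : List ℕ) (v : ℕ) : Decidable (vly L v) := by unfold vly; infer_instance

lemma cnt_set : ∀ (l : List ℕ) (i a b : ℕ), i < l.length →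
    (l.set i a).count b + (if l.getD i 0 = b then 1 else 0) = l.count b + (if a = b then 1 else 0)
  | [], _, _, _, h => by simp at h
  | x :: l, 0, a, b, _ => by
    simp only [List.set_cons_zero, List.count_cons, List.getD_cons_zero, beq_iff_eq]; omega
  | x :: l, i + 1, a, b, h => by
    have := cnt_set l i a b (by simpa using h)
    simp only [List.set_cons_succ, List.count_cons, List.getD_cons_succ, beq_iff_eq]
    omega

lemma getD_set' (L : List ℕ) (v₁ v a : ℕ) (h : v₁ < L.length) :
    (L.set v₁ a).getD v 0 = if v = v₁ then a else L.getD v 0 := by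
  split_ifs with e
  · subst e; simp [List.getD, h]
  · simp [List.getD, List.getElem?_set_ne (Ne.symm e)]

lemma pred_set (L : List ℕ) (v₁ v a : ℕ) (h : v₁ < L.length) :
    (0 :: L.set v₁ a).getD v 0 = if v = v₁ + 1 then a else (0 :: L).getD v 0 := by
  rw [← List.set_cons_succ, getD_set' _ _ _ _ (by simpa using h)]

lemma cnt_take (L : List ℕ) (v₁ v j c : ℕ) (h : v₁ < L.length) (hx : L.getD v₁ 0 = j + 1) :
    ((L.set v₁ j).take v).count c + (if v₁ < v ∧ c = j + 1 then 1 else 0) =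
      (L.take v).count c + (if v₁ < v ∧ c = j then 1 else 0) := by
  by_cases e : v₁ < v
  · rw [List.take_set]
    have := cnt_set (L.take v) v₁ j c (by simp; omega)
    have e2 : (L.take v).getD v₁ 0 = j + 1 := by rw [← hx]; simp [List.getD, e]
    rw [e2] at this
    simp only [e, true_and]
    simp only [eq_comm (a := c)]
    exact this
  · rw [List.take_set_of_le (by omega)]; simp [e]

lemma cnt_drop (L : List ℕ) (v₁ v j c : ℕ) (h : v₁ < L.length) (hx : L.getD v₁ 0 = j + 1) :
    ((L.set v₁ j).drop v).count c + (if v ≤ v₁ ∧ c = j + 1 then 1 else 0) =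
      (L.drop v).count c + (if v ≤ v₁ ∧ c = j then 1 else 0) := by
  by_cases e : v ≤ v₁
  · rw [List.drop_set, if_neg (by omega)]
    have := cnt_set (L.drop v) (v₁ - v) j c (by simp; omega)
    have e2 : (L.drop v).getD (v₁ - v) 0 = j + 1 := by rw [← hx]; simp [List.getD, e]
    rw [e2] at this
    simp only [e, true_and]
    simp only [eq_comm (a := c)]
    exact this
  · rw [List.drop_set_of_lt (by omega)]; simp [e]

noncomputable abbrev gp0 (p : ℝ) (j : ℕ) (L : List ℕ) (v : ℕ) : ℝ := gp p (fun i => p⁻¹ ^ i) j 0 0 L v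

lemma gp0_eq (j : ℕ) (L : List ℕ) (v : ℕ) : gp0 p j L v = if vly L v ∧ L.getD v 0 = j then p⁻¹ ^ ss L v else 0 := by
  rw [gp0, gp]
  by_cases h : vly L v ∧ L.getD v 0 = j
  · obtain ⟨⟨h1, h2⟩, h3⟩ := h
    rw [if_pos ⟨h1, h3, h3 ▸ h2⟩, if_pos ⟨⟨h1, h2⟩, h3⟩, ss, h3, zero_add, pow_add, inv_pow]
    simp [mul_comm]
  · rw [if_neg h, if_neg]
    rintro ⟨h1, h2, h3⟩
    exact h ⟨⟨h1, h2 ▸ h3⟩, h2⟩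

lemma gp0_sum (j : ℕ) (L : List ℕ) (v : ℕ) : ∑ i ∈ Finset.range j, gp0 p i L v = if vly L v ∧ L.getD v 0 < j then p⁻¹ ^ ss L v else 0 := by
  simp only [gp0_eq]
  by_cases h : vly L v
  · simp only [h, true_and]
    rw [Finset.sum_ite_eq (Finset.range j) (L.getD v 0)]
    simp
  · simp [h]

lemma pointwise (hp : 0 < p) (L : List ℕ) (v₁ v₂ j : ℕ) (h : v₁ < L.length) (hx : L.getD v₁ 0 = j + 1) :
    (if vly (L.set v₁ j) v₂ ∧ ((L.set v₁ j).getD v₂ 0 < j + 1 ∨ (L.set v₁ j).getD v₂ 0 = j + 1 ∧ v₁ < v₂) then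
      p⁻¹ ^ (ss (L.set v₁ j) v₂ + del (j + 1) ((L.set v₁ j).getD v₂ 0) v₁ v₂) else 0)
    = p * (if v₁ < v₂ then gp0 p (j + 1) L v₂ else 0) + p⁻¹ * ∑ i ∈ Finset.range j, gp0 p i L v₂ + gp0 p j (L.set v₁ j) v₂ := by
  rw [gp0_sum, gp0_eq, gp0_eq]
  by_cases e : v₂ = v₁
  · subst e
    have e1 : (L.set v₂ j).getD v₂ 0 = j := by rw [getD_set' _ _ _ _ h, if_pos rfl]
    rw [e1, hx]
    simp [del]
  · have e1 : (L.set v₁ j).getD v₂ 0 = L.getD v₂ 0 := by rw [getD_set' _ _ _ _ h, if_neg e]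
    have hs : ss (L.set v₁ j) v₂ = ((L.set v₁ j).take v₂).count (L.getD v₂ 0) + ((L.set v₁ j).drop (v₂ + 1)).count (L.getD v₂ 0 + 1) := by
      rw [ss, e1]
    have c1 := cnt_take L v₁ v₂ j (L.getD v₂ 0) h hx
    have c2 := cnt_drop L v₁ (v₂ + 1) j (L.getD v₂ 0 + 1) h hx
    have hs' : ss L v₂ = (L.take v₂).count (L.getD v₂ 0) + (L.drop (v₂ + 1)).count (L.getD v₂ 0 + 1) := rfl
    have hv : L.getD v₂ 0 ≠ j → (vly (L.set v₁ j) v₂ ↔ vly L v₂) := by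
      intro hy
      unfold vly
      rw [pred_set _ _ _ _ h, e1, List.length_set]
      by_cases e3 : v₂ = v₁ + 1
      · rw [if_pos e3]
        have : (0 :: L).getD v₂ 0 = j + 1 := by rw [e3, List.getD_cons_succ, hx]
        rw [this]; omega
      · rw [if_neg e3]
    rw [e1]
    generalize L.getD v₂ 0 = y at *
    rcases lt_trichotomy y j with hy | hy | hy
    · simp only [hv (by omega : y ≠ j)]
      by_cases hvv : vly L v₂
      · have key : ss (L.set v₁ j) v₂ + del (j + 1) y v₁ v₂ = ss L v₂ + 1 := by
          have d1 : ¬ (v₁ < v₂ ∧ y = j + 1) := by omega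
          have d2 : ¬ (v₁ < v₂ ∧ y = j) := by omega
          have d3 : ¬ (v₂ + 1 ≤ v₁ ∧ y + 1 = j + 1) := by omega
          rw [if_neg d1, if_neg d2] at c1
          rw [if_neg d3] at c2
          rw [hs, hs', del]
          by_cases h5 : v₂ + 1 ≤ v₁ ∧ y + 1 = j
          · rw [if_pos h5] at c2
            rw [if_neg (by omega)]
            omega
          · rw [if_neg h5] at c2
            rw [if_pos (by omega)]
            omega
        rw [if_pos ⟨hvv, Or.inl (by omega)⟩, key]
        have b1 : ¬ y = j + 1 := by omega
        have b2 : ¬ y = j := by omega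
        simp [b1, b2, hvv, hy, pow_succ, mul_comm]
      · simp [hvv, hy.ne]
    · subst hy
      simp [del]
    · rcases Nat.lt_or_eq_of_le hy with hy | hy
      · have a1 : ¬ y < j + 1 := by omega
        have a2 : ¬ y = j + 1 := by omega
        have a3 : ¬ y < j := by omega
        have a4 : ¬ y = j := by omega
        simp [a1, a2, a3, a4]
      · simp only [hv (by omega : y ≠ j)]
        by_cases hvv : vly L v₂ ∧ v₁ < v₂
        · obtain ⟨hvv, h5⟩ := hvv
          have key : ss (L.set v₁ j) v₂ + del (j + 1) y v₁ v₂ + 1 = ss L v₂ := by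
            rw [hs, hs', del]
            split_ifs at c1 c2 ⊢ <;> omega
          rw [if_pos ⟨hvv, Or.inr ⟨hy.symm, h5⟩⟩, ← key, if_pos h5, if_pos ⟨hvv, hy.symm⟩, if_neg (by omega), if_neg (by omega), pow_succ]
          field_simp
          simp
        · have a1 : ¬ y < j + 1 := by omega
          have a3 : ¬ y < j := by omega
          have a4 : ¬ y = j := by omega
          by_cases h6 : v₁ < v₂
          · have h7 : ¬ vly L v₂ := fun h7 => hvv ⟨h7, h6⟩
            simp [h7]
          · simp [a1, a3, a4, h6]

/-- admissible pairs of positions -/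
def adm (L : List ℕ) (v₁ v₂ : ℕ) : Prop :=
  vly L v₁ ∧ 1 ≤ L.getD v₁ 0 ∧ vly (L.set v₁ (L.getD v₁ 0 - 1)) v₂ ∧
    ((L.set v₁ (L.getD v₁ 0 - 1)).getD v₂ 0 < L.getD v₁ 0 ∨ (L.set v₁ (L.getD v₁ 0 - 1)).getD v₂ 0 = L.getD v₁ 0 ∧ v₁ < v₂)
instance (L : List ℕ) (v w : ℕ) : Decidable (adm L v w) := by unfold adm; infer_instance

def ex (L : List ℕ) (v₁ v₂ : ℕ) : ℕ :=
  ss L v₁ + ss (L.set v₁ (L.getD v₁ 0 - 1)) v₂ + del (L.getD v₁ 0) ((L.set v₁ (L.getD v₁ 0 - 1)).getD v₂ 0) v₁ v₂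

noncomputable def GLs (p : ℝ) (L : List ℕ) : ℝ :=
  ∑ v₁ ∈ Finset.range L.length, ∑ v₂ ∈ Finset.range L.length, if adm L v₁ v₂ then p⁻¹ ^ ex L v₁ v₂ else 0

noncomputable abbrev ph (p : ℝ) : ℕ → ℝ := fun i => p⁻¹ ^ i

lemma GL_inner (hp : 0 < p) (N : ℕ) (L : List ℕ) (hN : ∀ x ∈ L, x ≤ N) (v₁ v₂ : ℕ) (h : v₁ < L.length) :
    (if adm L v₁ v₂ then p⁻¹ ^ ex L v₁ v₂ else 0) = ∑ j ∈ Finset.range N, gp0 p (j + 1) L v₁ *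
      (p * (if v₁ < v₂ then gp0 p (j + 1) L v₂ else 0) + p⁻¹ * ∑ i ∈ Finset.range j, gp0 p i L v₂ + gp0 p j (L.set v₁ j) v₂) := by
  have e1 : ∀ j, gp0 p (j + 1) L v₁ = if L.getD v₁ 0 = j + 1 then (if vly L v₁ then p⁻¹ ^ ss L v₁ else 0) else 0 := by
    intro j
    rw [gp0_eq]; split_ifs <;> simp_all
  rcases hx : L.getD v₁ 0 with _ | j
  · rw [Finset.sum_eq_zero]
    · rw [if_neg]; rintro ⟨_, h2, _⟩; omega
    · intro j _; rw [e1, hx, if_neg (by omega), zero_mul]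
  · have hj : j < N := by
      have := hN (L.getD v₁ 0) (by simp [List.getD, h])
      omega
    rw [Finset.sum_eq_single j]
    · rw [← pointwise hp L v₁ v₂ j h hx, e1, hx, if_pos rfl]
      unfold adm ex
      simp only [hx, Nat.add_sub_cancel]
      by_cases hv : vly L v₁
      · simp only [hv, true_and, if_true]
        rw [if_congr (and_iff_right (by omega)) rfl rfl, mul_ite, mul_zero, ← pow_add, add_assoc]
      · simp [hv]
    · intro i _ hi
      rw [e1, hx, if_neg (by omega), zero_mul]
    · simp [hj]

lemma gp0_total {L : List ℕ} (hv : Valid L) (ψ : ℕ → ℝ) (j : ℕ) :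
    ∑ v ∈ Finset.range L.length, gp p ψ j 0 0 L v = zs1 p ψ 0 (mvec j L) := by
  rw [gp_sum1, V_full j L hv]; rfl

lemma GL_eq (hp : 0 < p) (N : ℕ) {L : List ℕ} (hv : Valid L) (hN : ∀ x ∈ L, x ≤ N) :
    GLs p L = ∑ j ∈ Finset.range N, (p * zs2 p (ph p) 0 (mvec (j + 1) L)
      + p⁻¹ * (zs1 p (ph p) 0 (mvec (j + 1) L) * ∑ i ∈ Finset.range j, zs1 p (ph p) 0 (mvec i L))
      + zs1 p (fun k => p⁻¹ ^ k * zs1 p (ph p) 0 (split k (mvec j L))) 0 (mvec (j + 1) L)) := by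
  rw [GLs]
  rw [Finset.sum_congr rfl fun v₁ h1 => Finset.sum_congr rfl fun v₂ _ => GL_inner hp N L hN v₁ v₂ (Finset.mem_range.mp h1)]
  rw [Finset.sum_congr rfl fun v₁ _ => Finset.sum_comm, Finset.sum_comm]
  refine Finset.sum_congr rfl fun j _ => ?_
  simp only [mul_add, Finset.sum_add_distrib]
  congr 1
  · congr 1
    · have := gp_sum2 (p := p) (ph p) (j + 1) L 0 0
      rw [V_full _ L hv] at this
      rw [zs2, ← this, Finset.mul_sum]
      refine Finset.sum_congr rfl fun v _ => ?_
      rw [Finset.mul_sum, Finset.mul_sum]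
      exact Finset.sum_congr rfl fun v' _ => by ring
    · rw [← gp0_total hv, Finset.sum_mul, Finset.mul_sum]
      refine Finset.sum_congr rfl fun v _ => ?_
      rw [Finset.sum_congr rfl fun i _ => (gp0_total hv (ph p) i).symm, Finset.sum_comm, Finset.mul_sum, Finset.mul_sum]
      exact Finset.sum_congr rfl fun v' _ => by ring
  · rw [← gp0_total hv]
    refine Finset.sum_congr rfl fun v h1 => ?_
    rw [Finset.mem_range] at h1
    rw [← Finset.mul_sum, gp0, gp, gp]
    split_ifs with h2
    · have hv2 := (Valid_set L 0 v j ⟨Nat.zero_le _, hv⟩ h1 h2.2.1 h2.2.2).2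
      have := gp0_total (p := p) hv2 (ph p) j
      rw [List.length_set] at this
      rw [this, mvec_split L v hv h1 h2.2.1, zero_add]; ring
    · simp
end PF

namespace PF
variable {p : ℝ}

noncomputable def em (p : ℝ) (b : ℕ → ℕ) (j : ℕ) (m : List ℕ) : ℝ := p ^ ((b j).choose 2) * p ^ invn m

lemma em_sum (b : ℕ → ℕ) (j : ℕ) : ∑ m ∈ comps (b j) (b (j + 1)), em p b j m = edge p (b j) (b (j + 1)) := by
  rw [← plain_edge, Finset.mul_sum]; rfl

lemma prod_swap2 {J i i' : ℕ} (hi : i < J) (hi' : i' < J) (hne : i ≠ i') (R E : ℕ → ℝ)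
    (h : ∀ j, j ≠ i → j ≠ i' → R j = E j) :
    (∏ j ∈ Finset.range J, R j) * (E i * E i') = (∏ j ∈ Finset.range J, E j) * (R i * R i') := by
  have h1 : i ∈ Finset.range J := by simpa
  have h2 : i' ∈ (Finset.range J).erase i := by simp [hi', hne.symm]
  rw [← Finset.mul_prod_erase _ R h1, ← Finset.mul_prod_erase _ E h1, ← Finset.mul_prod_erase _ R h2,
    ← Finset.mul_prod_erase _ E h2]
  have : ∏ x ∈ ((Finset.range J).erase i).erase i', R x = ∏ x ∈ ((Finset.range J).erase i).erase i', E x := by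
    refine Finset.prod_congr rfl fun x hx => ?_
    simp only [Finset.mem_erase] at hx
    exact h x hx.2.1 hx.1
  rw [this]; ring

lemma sum_two (b : ℕ → ℕ) {J i i' : ℕ} (hi : i < J) (hi' : i' < J) (hne : i ≠ i') (F G : List ℕ → ℝ) :
    (∑ L ∈ Lset b J, (∏ j ∈ Finset.range J, em p b j (mvec j L)) * (F (mvec i L) * G (mvec i' L))) *
      (edge p (b i) (b (i + 1)) * edge p (b i') (b (i' + 1))) =
    (∏ j ∈ Finset.range J, edge p (b j) (b (j + 1))) *
      ((∑ m ∈ comps (b i) (b (i + 1)), em p b i m * F m) * (∑ m ∈ comps (b i') (b (i' + 1)), em p b i' m * G m)) := by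
  let g : ℕ → List ℕ → ℝ := fun j m => em p b j m * ((if j = i then F m else 1) * (if j = i' then G m else 1))
  have e1 : ∀ L, (∏ j ∈ Finset.range J, g j (mvec j L)) = (∏ j ∈ Finset.range J, em p b j (mvec j L)) * (F (mvec i L) * G (mvec i' L)) := by
    intro L
    simp only [g, Finset.prod_mul_distrib]
    rw [Finset.prod_ite_eq' (Finset.range J) i, Finset.prod_ite_eq' (Finset.range J) i']
    simp [hi, hi']
  rw [Finset.sum_congr rfl fun L _ => (e1 L).symm, sum_Lset]
  have := prod_swap2 hi hi' hne (fun j => ∑ m ∈ comps (b j) (b (j + 1)), g j m) (fun j => edge p (b j) (b (j + 1))) (by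
    intro j h1 h2
    simp [g, h1, h2, em_sum])
  rw [this]
  simp [g, hne, hne.symm]

lemma prod_swap1 {J i : ℕ} (hi : i < J) (R E : ℕ → ℝ)
    (h : ∀ j, j ≠ i → R j = E j) :
    (∏ j ∈ Finset.range J, R j) * E i = (∏ j ∈ Finset.range J, E j) * R i := by
  have h1 : i ∈ Finset.range J := by simpa
  rw [← Finset.mul_prod_erase _ R h1, ← Finset.mul_prod_erase _ E h1]
  have : ∏ x ∈ (Finset.range J).erase i, R x = ∏ x ∈ (Finset.range J).erase i, E x := by
    refine Finset.prod_congr rfl fun x hx => ?_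
    simp only [Finset.mem_erase] at hx
    exact h x hx.1
  rw [this]; ring

lemma sum_one (b : ℕ → ℕ) {J i : ℕ} (hi : i < J) (F : List ℕ → ℝ) :
    (∑ L ∈ Lset b J, (∏ j ∈ Finset.range J, em p b j (mvec j L)) * F (mvec i L)) * edge p (b i) (b (i + 1)) =
    (∏ j ∈ Finset.range J, edge p (b j) (b (j + 1))) * (∑ m ∈ comps (b i) (b (i + 1)), em p b i m * F m) := by
  let g : ℕ → List ℕ → ℝ := fun j m => em p b j m * (if j = i then F m else 1)
  have e1 : ∀ L, (∏ j ∈ Finset.range J, g j (mvec j L)) = (∏ j ∈ Finset.range J, em p b j (mvec j L)) * F (mvec i L) := by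
    intro L
    simp only [g, Finset.prod_mul_distrib]
    rw [Finset.prod_ite_eq' (Finset.range J) i]
    simp [hi]
  rw [Finset.sum_congr rfl fun L _ => (e1 L).symm, sum_Lset]
  have := prod_swap1 hi (fun j => ∑ m ∈ comps (b j) (b (j + 1)), g j m) (fun j => edge p (b j) (b (j + 1))) (by
    intro j h1
    simp [g, h1, em_sum])
  rw [this]
  simp [g]

lemma zs1_delta (ψ : ℕ → ℝ) (K : ℕ) : ∀ (m : List ℕ) (k : ℕ), k + m.length ≤ K →
    zs1 p ψ k m = ∑ i ∈ Finset.range K, ψ i * zs1 p (fun x => if x = i then 1 else 0) k m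
  | [], k, _ => by simp [zs1, zl]
  | c :: t, k, h => by
    simp only [List.length_cons] at h
    rw [zs1_cons, zs1_delta ψ K t (k + 1) (by omega)]
    simp only [zs1_cons, mul_add, Finset.sum_add_distrib]
    congr 1
    split_ifs
    · rw [Finset.sum_eq_single k]
      · simp [mul_comm]
      · intro i _ hi; simp [hi.symm]
      · intro hk; simp at hk; omega
    · simp

lemma SS_prod (N : ℕ) (b : ℕ → ℕ) : SS p N b = ∏ j ∈ Finset.range (N + 1), edge p (b j) (b (j + 1)) := by
  rw [SS, wtX]
  refine Finset.prod_congr rfl fun j _ => ?_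
  simp [Xk_zero]

lemma sum_adj (hp : 0 < p) {b : ℕ → ℕ} (hb : Legit b) {N j : ℕ} (hj : j < N) :
    ∑ L ∈ Lset b (N + 1), (∏ j ∈ Finset.range (N + 1), em p b j (mvec j L)) *
      zs1 p (fun k => p⁻¹ ^ k * zs1 p (ph p) 0 (split k (mvec j L))) 0 (mvec (j + 1) L) =
    SS p N b * adj p (b j) (b (j + 1)) (b (j + 2)) := by
  have E1 := edge_pos hp (hb j)
  have E2 := edge_pos hp (hb (j + 1))
  have hE : edge p (b j) (b (j + 1)) * edge p (b (j + 1)) (b (j + 2)) ≠ 0 := by positivity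
  apply mul_right_cancel₀ hE
  have hl : ∀ L ∈ Lset b (N + 1), (mvec (j + 1) L).length = b (j + 1) := by
    intro L hL
    rw [mvec_length, (mem_Lset.mp hL).2.2 (j + 1) (by omega)]
  rw [Finset.sum_congr rfl fun L hL => by
    rw [zs1_delta _ (b (j + 1)) (mvec (j + 1) L) 0 (by rw [hl L hL]; omega), Finset.mul_sum]]
  rw [Finset.sum_comm, Finset.sum_mul]
  have := fun k => sum_two (p := p) b (J := N + 1) (i := j) (i' := j + 1) (by omega) (by omega) (by omega)
    (fun m => p⁻¹ ^ k * zs1 p (ph p) 0 (split k m)) (zs1 p (fun x => if x = k then 1 else 0) 0)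
  rw [Finset.sum_congr rfl fun k _ => this k, ← Finset.mul_sum, ← SS_prod, mul_assoc]
  congr 1
  rw [mul_comm, ← adj_edge hp]
  rw [Finset.sum_congr rfl fun k _ => Finset.mul_sum _ _ _, Finset.sum_comm, Finset.mul_sum]
  refine Finset.sum_congr rfl fun m' hm' => ?_
  rw [zs1_delta _ (b (j + 1)) m' 0 (by rw [(mem_comps.mp hm').1]; omega), Finset.mul_sum, Finset.mul_sum]
  refine Finset.sum_congr rfl fun k _ => ?_
  simp only [em]
  have : ∀ m, p ^ (b j).choose 2 * p ^ invn m * (p⁻¹ ^ k * zs1 p (ph p) 0 (split k m)) =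
    p ^ (b j).choose 2 * p⁻¹ ^ k * (p ^ invn m * zs1 p (ph p) 0 (split k m)) := fun m => by ring
  simp only [this, ← Finset.mul_sum]
  ring

lemma em_mul (b : ℕ → ℕ) (j : ℕ) (F : List ℕ → ℝ) : ∑ m ∈ comps (b j) (b (j + 1)), em p b j m * F m =
    p ^ ((b j).choose 2) * ∑ m ∈ comps (b j) (b (j + 1)), p ^ invn m * F m := by
  rw [Finset.mul_sum]; exact Finset.sum_congr rfl fun m _ => by rw [em]; ring

lemma sum_pair (hp : 0 < p) {b : ℕ → ℕ} (hb : Legit b) {N j : ℕ} (hj : j ≤ N) :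
    ∑ L ∈ Lset b (N + 1), (∏ j ∈ Finset.range (N + 1), em p b j (mvec j L)) * zs2 p (ph p) 0 (mvec j L) =
    SS p N b * rX p (b j) (b (j + 1)) 2 := by
  have E1 := edge_pos hp (hb j)
  apply mul_right_cancel₀ E1.ne'
  rw [sum_one b (by omega), em_mul, pair_edge hp (hb j), ← SS_prod]; ring

lemma sum_singles (hp : 0 < p) {b : ℕ → ℕ} (hb : Legit b) {N i j : ℕ} (hj : j ≤ N) (hi : i < j) :
    ∑ L ∈ Lset b (N + 1), (∏ j ∈ Finset.range (N + 1), em p b j (mvec j L)) *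
      (zs1 p (ph p) 0 (mvec j L) * zs1 p (ph p) 0 (mvec i L)) =
    SS p N b * (rX p (b j) (b (j + 1)) 1 * rX p (b i) (b (i + 1)) 1) := by
  have E1 := edge_pos hp (hb j)
  have E2 := edge_pos hp (hb i)
  apply mul_right_cancel₀ (mul_pos E1 E2).ne'
  rw [sum_two b (by omega) (by omega) (by omega), em_mul, em_mul, single_edge hp (hb j), single_edge hp (hb i), ← SS_prod]
  ring

lemma dinv_prod {b : ℕ → ℕ} {N : ℕ} (hz : b (N + 1) = 0) {L : List ℕ} (hL : L ∈ Lset b (N + 1)) :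
    p ^ dinv L = ∏ j ∈ Finset.range (N + 1), em p b j (mvec j L) ∧ (∀ x ∈ L, x ≤ N) := by
  obtain ⟨h1, h2, h3⟩ := mem_Lset.mp hL
  have h4 : ∀ x ∈ L, x ≤ N := by
    intro x hx
    have := h2 x hx
    rcases Nat.lt_or_eq_of_le this with h | h
    · omega
    · subst h
      have := List.count_pos_iff.mpr hx
      rw [h3 _ le_rfl] at this; omega
  refine ⟨?_, h4⟩
  rw [dinv_eq (N + 1) h1 (fun x hx => by have := h4 x hx; omega), ← Finset.prod_pow_eq_pow_sum]
  refine Finset.prod_congr rfl fun j hj => ?_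
  rw [pow_add, em, h3 j (by simp at hj; omega)]

lemma sum_list (hp : 0 < p) {N : ℕ} {b : ℕ → ℕ} (hz : ∀ j, N < j → b j = 0) (h0 : Legit b → b 0 = 1) :
    ∑ L ∈ Lset b (N + 1), p ^ dinv L * GLs p L = SS p N b * (p*(∑ i ∈ Finset.range (N+1), rX p (b i) (b (i+1)) 2)
      + p⁻¹*(∑ j ∈ Finset.range N, (rX p (b (j+1)) (b (j+2)) 1 * ∑ i ∈ Finset.range j, rX p (b i) (b (i+1)) 1))
      + ∑ j ∈ Finset.range N, adj p (b j) (b (j+1)) (b (j+2))) := by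
  by_cases hb : Legit b
  swap
  · rw [SS_nonlegit hz hb, zero_mul, Finset.sum_eq_zero]
    intro L hL
    exfalso; apply hb
    intro j hj
    by_cases h : j < N + 1
    · exact Lset_legit hL h hj
    · exact hz _ (by omega)
  have h2 : rX p (b 0) (b 1) 2 = 0 := by
    rw [h0 hb, rX, Xk_big (by omega)]; simp
  rw [Finset.sum_range_succ', zero_add, h2, add_zero]
  rw [Finset.sum_congr rfl fun L hL => by
    rw [GL_eq hp N (mem_Lset.mp hL).1 (dinv_prod (p := p) (hz _ (by omega)) hL).2,
    (dinv_prod (p := p) (hz _ (by omega)) hL).1, Finset.mul_sum]]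
  rw [Finset.sum_comm, Finset.mul_sum, Finset.mul_sum, ← Finset.sum_add_distrib, ← Finset.sum_add_distrib, Finset.mul_sum]
  refine Finset.sum_congr rfl fun j hj => ?_
  rw [Finset.mem_range] at hj
  simp only [mul_add, Finset.sum_add_distrib]
  rw [sum_adj hp hb hj]
  congr 2
  · rw [mul_left_comm, ← sum_pair hp hb (by omega), Finset.mul_sum]
    exact Finset.sum_congr rfl fun L _ => by ring
  · rw [mul_left_comm, Finset.mul_sum, Finset.mul_sum,
      Finset.sum_congr rfl fun i hi => (sum_singles hp hb (show j + 1 ≤ N by omega) (show i < j + 1 by simp at hi; omega)).symm,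
      Finset.sum_comm, Finset.mul_sum]
    refine Finset.sum_congr rfl fun L _ => ?_
    rw [Finset.mul_sum, Finset.mul_sum, Finset.mul_sum, Finset.mul_sum]
    exact Finset.sum_congr rfl fun i _ => by ring
end PF

namespace PF
variable {p : ℝ}

lemma sum_count (N : ℕ) : ∀ (L : List ℕ), (∀ x ∈ L, x ≤ N) → ∑ j ∈ Finset.range (N + 1), L.count j = L.length ∧
    ∑ j ∈ Finset.range (N + 1), j * L.count j = L.sum
  | [], _ => by simp
  | x :: L, h => by
    obtain ⟨h1, h2⟩ := sum_count N L (fun y hy => h y (by simp [hy]))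
    have hx := h x (by simp)
    constructor
    · simp only [List.count_cons, Finset.sum_add_distrib, h1, List.length_cons, beq_iff_eq]
      simp [Nat.lt_succ_of_le hx]
    · simp only [List.count_cons, mul_add, Finset.sum_add_distrib, h2, List.sum_cons, beq_iff_eq]
      simp [Nat.lt_succ_of_le hx, add_comm]

noncomputable def LL (N n : ℕ) : Finset (List ℕ) := (BB N n).biUnion fun b => Lset b (N + 1)

lemma mem_LL {N n : ℕ} {L : List ℕ} : L ∈ LL N n ↔ Valid L ∧ L.length = N + 1 ∧ (∀ x ∈ L, x ≤ N) ∧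
    2 * L.sum + 2 * n = N * (N + 1) := by
  rw [LL, Finset.mem_biUnion]
  constructor
  · rintro ⟨b, hb, hL⟩
    rw [mem_BB] at hb
    obtain ⟨⟨h1, h2⟩, h3⟩ := hb
    have h4 := (dinv_prod (p := 1) (h2 _ (by omega)) hL).2
    obtain ⟨g1, g2, g3⟩ := mem_Lset.mp hL
    obtain ⟨c1, c2⟩ := sum_count N L h4
    have e : ∀ j ∈ Finset.range (N + 1), L.count j = b j := fun j hj => g3 j (by simp at hj; omega)
    rw [Finset.sum_congr rfl e] at c1
    rw [Finset.sum_congr rfl fun j hj => by rw [e j hj]] at c2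
    refine ⟨g1, c1.symm.trans h1, h4, ?_⟩
    rw [← c2]
    zify
    rw [← h3]
  · rintro ⟨h1, h2, h3, h4⟩
    obtain ⟨c1, c2⟩ := sum_count N L h3
    refine ⟨fun j => L.count j, mem_BB.mpr ⟨⟨by omega, ?_⟩, ?_⟩, mem_Lset.mpr ⟨h1, fun x hx => by have := h3 x hx; omega, fun _ _ => rfl⟩⟩
    · intro j hj
      apply List.count_eq_zero_of_not_mem
      intro hj'
      have := h3 j hj'; omega
    · rw [← c2] at h4
      zify at h4
      rw [← h4]

theorem LL_sum (hp : 0 < p) {N n : ℕ} (hn : n + 4 ≤ N) : ∑ L ∈ LL N n, p ^ dinv L * GLs p L = HH p N n := by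
  rw [LL, Finset.sum_biUnion, HH]
  · refine Finset.sum_congr rfl fun b hb => ?_
    exact sum_list hp (mem_BB.mp hb).1.2 fun hl => hl.ones hb (by omega) (by omega)
  · intro b hb b' hb' hne
    rw [Function.onFun, Finset.disjoint_left]
    intro L h1 h2
    apply hne
    funext j
    by_cases h : j ≤ N + 1
    · rw [← (mem_Lset.mp h1).2.2 j h, ← (mem_Lset.mp h2).2.2 j h]
    · rw [(mem_BB.mp hb).1.2 j (by omega), (mem_BB.mp hb').1.2 j (by omega)]

end PF

namespace PF
open YoungDiagram

def Fit (N : ℕ) (μ : YoungDiagram) : Prop := ∀ v ≤ N, μ.colLen v + v ≤ N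

def lw (N : ℕ) (μ : YoungDiagram) : List ℕ := (List.range (N + 1)).map fun v => N - (μ.colLen v + v)

lemma lw_length (N : ℕ) (μ : YoungDiagram) : (lw N μ).length = N + 1 := by simp [lw]

lemma lw_getD {N : ℕ} (μ : YoungDiagram) {v : ℕ} (h : v ≤ N) : (lw N μ).getD v 0 = N - (μ.colLen v + v) := by
  have : v < N + 1 := by omega
  simp [lw, List.getD, this]

lemma lw_drop {N : ℕ} (μ : YoungDiagram) {v : ℕ} (h : v ≤ N) :
    (lw N μ).drop v = (N - (μ.colLen v + v)) :: (lw N μ).drop (v + 1) := by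
  rw [List.drop_eq_getElem_cons (by rw [lw_length]; omega)]
  simp [lw]

lemma colLen_le (μ : YoungDiagram) (v : ℕ) : μ.colLen (v + 1) ≤ μ.colLen v := μ.colLen_anti _ _ (Nat.le_succ v)

lemma lt_col_iff {μ : YoungDiagram} {u v : ℕ} : u < μ.colLen v ↔ v < μ.rowLen u := by
  rw [← mem_iff_lt_colLen, mem_iff_lt_rowLen]

lemma Fit.last {N : ℕ} {μ : YoungDiagram} (h : Fit N μ) : μ.colLen N = 0 := by
  have := h N le_rfl; omega

lemma key_count {N : ℕ} {μ : YoungDiagram} (hF : Fit N μ) {i : ℕ} (hi : i ≤ N) : ∀ (k v : ℕ), v + k = N →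
    ((Finset.range (μ.colLen v)).filter (fun u => u + μ.rowLen u = i)).card + (if μ.colLen v + v < i then 1 else 0) =
    ((lw N μ).drop (v + 1)).count (N - i)
  | 0, v, h => by
    have hv : v = N := by omega
    subst hv
    rw [hF.last, List.drop_of_length_le (by rw [lw_length])]
    simp; omega
  | k + 1, v, h => by
    have ih := key_count hF hi k (v + 1) (by omega)
    rw [lw_drop μ (by omega : v + 1 ≤ N), List.count_cons, ← ih]
    have hle := colLen_le μ v
    have hf := hF (v + 1) (by omega)
    have e : (Finset.range (μ.colLen v)).filter (fun u => u + μ.rowLen u = i) =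
        (Finset.range (μ.colLen (v + 1))).filter (fun u => u + μ.rowLen u = i) ∪
        (if μ.colLen (v + 1) + (v + 1) ≤ i ∧ i ≤ μ.colLen v + v then {i - (v + 1)} else ∅) := by
      ext u
      have h1 : u < μ.colLen v ↔ v < μ.rowLen u := lt_col_iff
      have h2 : u < μ.colLen (v + 1) ↔ v + 1 < μ.rowLen u := lt_col_iff
      simp only [Finset.mem_filter, Finset.mem_union, Finset.mem_range]
      split_ifs with c
      · have h3 : i - (v + 1) < μ.colLen v ↔ v < μ.rowLen (i - (v + 1)) := lt_col_iff
        have h4 : i - (v + 1) < μ.colLen (v + 1) ↔ v + 1 < μ.rowLen (i - (v + 1)) := lt_col_iff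
        simp only [Finset.mem_singleton]
        by_cases hu : u = i - (v + 1)
        · subst hu; omega
        · omega
      · simp only [Finset.notMem_empty, or_false]; omega
    rw [e, Finset.card_union_of_disjoint]
    · split_ifs <;> simp at * <;> omega
    · rw [Finset.disjoint_left]
      intro u hu hu'
      split_ifs at hu' with c
      · simp at hu hu'; omega
      · simp at hu'

lemma col_filter (μ : YoungDiagram) (P : ℕ × ℕ → Prop) [DecidablePred P] (v : ℕ) :
    (μ.cells.filter (fun c => P c ∧ c.2 = v)).card = ((Finset.range (μ.colLen v)).filter fun u => P (u, v)).card := by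
  symm
  refine Finset.card_bij (fun u _ => (u, v)) ?_ ?_ ?_
  · intro u hu
    simp only [Finset.mem_filter, Finset.mem_range, mem_cells] at hu ⊢
    exact ⟨mem_iff_lt_colLen.mpr hu.1, hu.2, trivial⟩
  · intro a _ b _ h; simpa using h
  · rintro ⟨u, w⟩ hu
    simp only [Finset.mem_filter, Finset.mem_range, mem_cells] at hu ⊢
    obtain ⟨h1, h2, rfl⟩ := hu
    exact ⟨u, ⟨mem_iff_lt_colLen.mp h1, h2⟩, rfl⟩

lemma row_filter (μ : YoungDiagram) (P : ℕ × ℕ → Prop) [DecidablePred P] (u : ℕ) :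
    (μ.cells.filter (fun c => P c ∧ c.1 = u)).card = ((Finset.range (μ.rowLen u)).filter fun v => P (u, v)).card := by
  symm
  refine Finset.card_bij (fun v _ => (u, v)) ?_ ?_ ?_
  · intro v hv
    simp only [Finset.mem_filter, Finset.mem_range, mem_cells] at hv ⊢
    exact ⟨mem_iff_lt_rowLen.mpr hv.1, hv.2, trivial⟩
  · intro a _ b _ h; simpa using h
  · rintro ⟨w, v⟩ hu
    simp only [Finset.mem_filter, Finset.mem_range, mem_cells] at hu ⊢
    obtain ⟨h1, h2, rfl⟩ := hu
    exact ⟨v, ⟨mem_iff_lt_rowLen.mp h1, h2⟩, rfl⟩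

lemma Fit.col_zero {N : ℕ} {μ : YoungDiagram} (h : Fit N μ) {v : ℕ} (hv : N ≤ v) : μ.colLen v = 0 := by
  have := μ.colLen_anti _ _ hv
  rw [h.last] at this; omega

lemma card_filter_cols {N : ℕ} {μ : YoungDiagram} (hF : Fit N μ) (P : ℕ × ℕ → Prop) [DecidablePred P] :
    (μ.cells.filter P).card = ∑ v ∈ Finset.range (N + 1), ((Finset.range (μ.colLen v)).filter fun u => P (u, v)).card := by
  rw [Finset.card_eq_sum_card_fiberwise (f := Prod.snd) (t := Finset.range (N + 1))]
  · refine Finset.sum_congr rfl fun v _ => ?_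
    rw [← col_filter, Finset.filter_filter]
  · rintro ⟨u, v⟩ hc
    simp only [Finset.coe_filter, mem_cells, Set.mem_setOf_eq, Finset.coe_range, Set.mem_Iio] at hc ⊢
    by_contra hv
    have := mem_iff_lt_colLen.mp hc.1
    rw [hF.col_zero (by omega)] at this; omega

lemma hook_eq (μ : YoungDiagram) {u v : ℕ} (h : (u, v) ∈ μ) :
    hookDiff μ.cells (u, v) = ((μ.colLen v + v : ℕ) : ℤ) - ((u + μ.rowLen u : ℕ) : ℤ) := by
  have h1 := mem_iff_lt_colLen.mp h
  have h2 := mem_iff_lt_rowLen.mp h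
  rw [hookDiff]
  have e1 : (μ.cells.filter fun d => d.2 = v ∧ u < d.1) = μ.cells.filter fun d => u < d.1 ∧ d.2 = v :=
    Finset.filter_congr fun d _ => and_comm
  have e2 : (μ.cells.filter fun d => d.1 = u ∧ v < d.2) = μ.cells.filter fun d => v < d.2 ∧ d.1 = u :=
    Finset.filter_congr fun d _ => and_comm
  have e3 : ∀ a b, ((Finset.range b).filter fun x => a < x).card = b - (a + 1) := by
    intro a b
    have : ((Finset.range b).filter fun x => a < x) = Finset.Ico (a + 1) b := by ext x; simp; omega
    rw [this, Nat.card_Ico]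
  simp only [e1, e2]
  rw [col_filter μ (fun d => u < d.1), row_filter μ (fun d => v < d.2), e3, e3]
  omega

/-- cells of hook difference 1 in column `v` -/
lemma hook_one {N : ℕ} {μ : YoungDiagram} (hF : Fit N μ) {v : ℕ} (hv : v ≤ N) :
    ((Finset.range (μ.colLen v)).filter fun u => hookDiff μ.cells (u, v) = 1).card =
      ((lw N μ).drop (v + 1)).count ((lw N μ).getD v 0 + 1) := by
  have hf := hF v hv
  have e : ((Finset.range (μ.colLen v)).filter fun u => hookDiff μ.cells (u, v) = 1) =
      (Finset.range (μ.colLen v)).filter fun u => u + μ.rowLen u + 1 = μ.colLen v + v := by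
    refine Finset.filter_congr fun u hu => ?_
    rw [hook_eq μ (mem_iff_lt_colLen.mpr (by simpa using hu))]
    omega
  rw [e, lw_getD μ hv]
  rcases Nat.eq_zero_or_pos (μ.colLen v + v) with h | h
  · rw [Finset.filter_false_of_mem (by intro u _; omega), Finset.card_empty, eq_comm, List.count_eq_zero]
    intro hm
    have := List.mem_of_mem_drop hm
    simp [lw] at this
    omega
  · have := key_count hF (i := μ.colLen v + v - 1) (by omega) (N - v) v (by omega)
    rw [if_neg (by omega), add_zero] at this
    rw [show N - (μ.colLen v + v) + 1 = N - (μ.colLen v + v - 1) by omega, ← this]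
    congr 1
    exact Finset.filter_congr fun u _ => by omega

lemma hook_zero {N : ℕ} {μ : YoungDiagram} (hF : Fit N μ) {v : ℕ} (hv : v ≤ N) :
    ((Finset.range (μ.colLen v)).filter fun u => hookDiff μ.cells (u, v) = 0).card =
      ((lw N μ).drop (v + 1)).count ((lw N μ).getD v 0) := by
  have hf := hF v hv
  have e : ((Finset.range (μ.colLen v)).filter fun u => hookDiff μ.cells (u, v) = 0) =
      (Finset.range (μ.colLen v)).filter fun u => u + μ.rowLen u = μ.colLen v + v := by
    refine Finset.filter_congr fun u hu => ?_
    rw [hook_eq μ (mem_iff_lt_colLen.mpr (by simpa using hu))]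
    omega
  have := key_count hF hf (N - v) v (by omega)
  rw [if_neg (by omega), add_zero] at this
  rw [e, lw_getD μ hv, this]

lemma dinv_drop {N : ℕ} (μ : YoungDiagram) : ∀ (k v : ℕ), v + k = N + 1 → dinv ((lw N μ).drop v) =
    ∑ w ∈ Finset.Ico v (N + 1), (((lw N μ).drop (w + 1)).count ((lw N μ).getD w 0) + ((lw N μ).drop (w + 1)).count ((lw N μ).getD w 0 + 1))
  | 0, v, h => by
    rw [List.drop_of_length_le (by rw [lw_length]; omega)]
    simp [dinv, show v = N + 1 by omega]
  | k + 1, v, h => by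
    rw [lw_drop μ (by omega), dinv, dinv_drop μ k (v + 1) (by omega), Finset.sum_eq_sum_Ico_succ_bot (show v < N + 1 by omega),
      lw_getD μ (by omega)]

lemma first_term {N : ℕ} {μ : YoungDiagram} (hF : Fit N μ) :
    (μ.cells.filter fun c => hookDiff μ.cells c ≠ 0 ∧ hookDiff μ.cells c ≠ 1).card + dinv (lw N μ) = μ.card := by
  have e : dinv (lw N μ) = (μ.cells.filter fun c => ¬ (hookDiff μ.cells c ≠ 0 ∧ hookDiff μ.cells c ≠ 1)).card := by
    have := dinv_drop (N := N) μ (N + 1) 0 (by omega)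
    rw [List.drop_zero] at this
    rw [this, card_filter_cols hF, ← Finset.range_eq_Ico]
    refine Finset.sum_congr rfl fun v hv => ?_
    have hv : v ≤ N := by simp at hv; omega
    rw [← hook_zero hF hv, ← hook_one hF hv, ← Finset.card_union_of_disjoint, ← Finset.filter_or]
    · congr 1
      exact Finset.filter_congr fun u _ => by tauto
    · rw [Finset.disjoint_filter]
      intro u _ h1 h2; omega
  rw [e, Finset.card_filter_add_card_filter_not]

lemma count_take (N : ℕ) (μ : YoungDiagram) (c : ℕ) : ∀ v, v ≤ N + 1 → ((lw N μ).take v).count c =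
    ((Finset.range v).filter fun w => N - (μ.colLen w + w) = c).card
  | 0, _ => by simp
  | v + 1, h => by
    rw [List.take_succ_eq_append_getElem (by rw [lw_length]; omega), List.count_append, count_take N μ c v (by omega),
      Finset.range_add_one, Finset.filter_insert]
    have : (lw N μ)[v]'(by rw [lw_length]; omega) = N - (μ.colLen v + v) := by simp [lw]
    rw [this]
    split_ifs with h1
    · rw [Finset.card_insert_of_notMem (by simp)]; simp [h1]
    · simp [h1]

lemma second_term {N : ℕ} {μ : YoungDiagram} (hF : Fit N μ) {b : ℕ × ℕ} (hb2 : b.2 ≤ N) (h1 : b.1 = μ.colLen b.2)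
    (h2 : μ.rowLen b.1 = b.2) :
    (μ.cells.filter fun c => (hookDiff μ.cells c = 0 ∧ c.1 = b.1) ∨ (hookDiff μ.cells c = 1 ∧ c.2 = b.2)).card =
      ss (lw N μ) b.2 := by
  rw [Finset.filter_or, Finset.card_union_of_disjoint, col_filter μ (fun c => hookDiff μ.cells c = 1), hook_one hF hb2, ss, row_filter μ (fun c => hookDiff μ.cells c = 0), h2,
    count_take N μ _ _ (by omega), lw_getD μ hb2]
  · congr 2
    refine Finset.filter_congr fun v hv => ?_
    simp at hv
    rw [hook_eq μ (mem_iff_lt_rowLen.mpr (by omega)), h2]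
    have a1 := hF v (by omega)
    have a2 := hF b.2 hb2
    omega
  · rw [Finset.disjoint_filter]
    intro u _ h1 h2; omega

end PF

namespace PF
open YoungDiagram

lemma yd_ext {μ ν : YoungDiagram} (h : ∀ v, μ.colLen v = ν.colLen v) : μ = ν := by
  apply YoungDiagram.ext
  ext ⟨u, v⟩
  rw [mem_cells, mem_cells, mem_iff_lt_colLen, mem_iff_lt_colLen, h]

lemma col_eq {μ : YoungDiagram} {v k : ℕ} (h : ∀ u, (u, v) ∈ μ ↔ u < k) : μ.colLen v = k := by
  have h1 := fun u => (mem_iff_lt_colLen (μ := μ) (i := u) (j := v)).symm.trans (h u)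
  have a := h1 k
  have b := h1 (μ.colLen v)
  omega

lemma row_eq {μ : YoungDiagram} {u k : ℕ} (h : ∀ v, (u, v) ∈ μ ↔ v < k) : μ.rowLen u = k := by
  have h1 := fun v => (mem_iff_lt_rowLen (μ := μ) (i := u) (j := v)).symm.trans (h v)
  have a := h1 k
  have b := h1 (μ.rowLen u)
  omega

lemma fit_of_card {N : ℕ} {μ : YoungDiagram} (h : μ.card ≤ N) : Fit N μ := by
  intro v hv
  rcases Nat.eq_zero_or_pos (μ.colLen v) with h0 | h0
  · omega
  refine le_trans ?_ h
  have hd : Disjoint ((Finset.range (μ.colLen v)).image fun u => (u, v)) ((Finset.range v).image fun w => ((0 : ℕ), w)) := by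
    rw [Finset.disjoint_left]
    intro c h1 h2
    simp only [Finset.mem_image, Finset.mem_range] at h1 h2
    obtain ⟨a, _, rfl⟩ := h1
    obtain ⟨b, hb, e⟩ := h2
    simp at e; omega
  have hc := Finset.card_union_of_disjoint hd
  rw [Finset.card_image_of_injective _ (fun a b e => by simpa using e), Finset.card_image_of_injective _ (fun a b e => by simpa using e),
    Finset.card_range, Finset.card_range] at hc
  rw [← hc]
  apply Finset.card_le_card
  intro c hc
  simp only [Finset.mem_union, Finset.mem_image, Finset.mem_range] at hc
  rw [mem_cells]
  rcases hc with ⟨a, ha, rfl⟩ | ⟨a, ha, rfl⟩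
  · exact mem_iff_lt_colLen.mpr ha
  · rw [mem_iff_lt_colLen]
    exact lt_of_lt_of_le h0 (μ.colLen_anti _ _ (by omega))

lemma lw_valid_drop {N : ℕ} {μ : YoungDiagram} (hF : Fit N μ) : ∀ (k v : ℕ), v + k = N + 1 → Valid ((lw N μ).drop v)
  | 0, v, h => by
    rw [List.drop_of_length_le (by rw [lw_length]; omega)]; trivial
  | k + 1, v, h => by
    rw [lw_drop μ (by omega)]
    refine ⟨?_, lw_valid_drop hF k (v + 1) (by omega)⟩
    rcases k with _ | k
    · rw [List.drop_of_length_le (by rw [lw_length]; omega)]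
      simp [bound]; omega
    · rw [lw_drop μ (by omega)]
      have := colLen_le μ v
      have := hF (v + 1) (by omega)
      simp only [bound]; omega

lemma lw_sum_eq (N : ℕ) (μ : YoungDiagram) : (lw N μ).sum = ∑ v ∈ Finset.range (N + 1), (N - (μ.colLen v + v)) := by
  rw [lw]
  generalize N + 1 = K
  induction K with
  | zero => simp
  | succ k ih => rw [List.range_succ, List.map_append, List.sum_append, ih, Finset.sum_range_succ]; simp

lemma card_cols {N : ℕ} {μ : YoungDiagram} (hF : Fit N μ) : μ.card = ∑ v ∈ Finset.range (N + 1), μ.colLen v := by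
  have := card_filter_cols hF (fun _ => True)
  simpa using this

lemma lw_sum {N : ℕ} {μ : YoungDiagram} (hF : Fit N μ) : 2 * (lw N μ).sum + 2 * μ.card = N * (N + 1) := by
  rw [lw_sum_eq, card_cols hF, ← mul_add, ← Finset.sum_add_distrib]
  have e : ∑ v ∈ Finset.range (N + 1), (N - (μ.colLen v + v) + μ.colLen v) = ∑ v ∈ Finset.range (N + 1), (N - v) := by
    refine Finset.sum_congr rfl fun v hv => ?_
    have := hF v (by simp at hv; omega)
    omega
  have e2 : ∑ v ∈ Finset.range (N + 1), (N - v) = ∑ v ∈ Finset.range (N + 1), v := by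
    have := Finset.sum_range_reflect (fun v => v) (N + 1)
    simpa using this
  rw [e, e2, mul_comm, Finset.sum_range_id_mul_two, Nat.add_sub_cancel, mul_comm]

lemma lw_LL {N n : ℕ} {μ : YoungDiagram} (hF : Fit N μ) (hn : μ.card = n) : lw N μ ∈ LL N n := by
  refine mem_LL.mpr ⟨by simpa using lw_valid_drop hF (N + 1) 0 (by omega), lw_length N μ, ?_, by rw [← hn]; exact lw_sum hF⟩
  intro x hx
  simp only [lw, List.mem_map] at hx
  obtain ⟨v, _, rfl⟩ := hx
  omega

structure Add (μ ν : YoungDiagram) (b : ℕ × ℕ) : Prop where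
  nm : b ∉ μ
  cells : ν.cells = insert b μ.cells

lemma Add.mem {μ ν : YoungDiagram} {b : ℕ × ℕ} (h : Add μ ν b) {c : ℕ × ℕ} : c ∈ ν ↔ c = b ∨ c ∈ μ := by
  rw [← mem_cells, h.cells, Finset.mem_insert, mem_cells]

lemma Add.col {μ ν : YoungDiagram} {b : ℕ × ℕ} (h : Add μ ν b) : b.1 = μ.colLen b.2 := by
  obtain ⟨u, v⟩ := b
  have h1 := h.nm
  rw [mem_iff_lt_colLen] at h1
  by_contra hne
  have h2 : (μ.colLen v, v) ∈ ν := by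
    refine ν.up_left_mem (i2 := u) (j2 := v) (by simp at hne ⊢; omega) le_rfl (h.mem.mpr (Or.inl rfl))
  rcases h.mem.mp h2 with e | e
  · simp at e; exact hne e.symm
  · rw [mem_iff_lt_colLen] at e; omega

lemma Add.row {μ ν : YoungDiagram} {b : ℕ × ℕ} (h : Add μ ν b) : μ.rowLen b.1 = b.2 := by
  obtain ⟨u, v⟩ := b
  have h1 := h.nm
  rw [mem_iff_lt_rowLen] at h1
  by_contra hne
  have h2 : (u, μ.rowLen u) ∈ ν := by
    refine ν.up_left_mem (i2 := u) (j2 := v) le_rfl (by simp at hne ⊢; omega) (h.mem.mpr (Or.inl rfl))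
  rcases h.mem.mp h2 with e | e
  · simp at e; exact hne e
  · rw [mem_iff_lt_rowLen] at e; omega

lemma Add.colLen {μ ν : YoungDiagram} {b : ℕ × ℕ} (h : Add μ ν b) (v : ℕ) :
    ν.colLen v = μ.colLen v + if v = b.2 then 1 else 0 := by
  apply col_eq
  intro u
  have hc := h.col
  obtain ⟨u', v'⟩ := b
  rw [h.mem, mem_iff_lt_colLen]
  simp only [Prod.mk.injEq] at hc ⊢
  split_ifs with e
  · subst e; omega
  · simp [e]

lemma Add.card {μ ν : YoungDiagram} {b : ℕ × ℕ} (h : Add μ ν b) : ν.card = μ.card + 1 := by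
  rw [YoungDiagram.card, h.cells, Finset.card_insert_of_notMem (by rw [mem_cells]; exact h.nm)]

lemma lw_pred {N : ℕ} (μ : YoungDiagram) {v : ℕ} (hv : v ≤ N) :
    (0 :: lw N μ).getD v 0 = if v = 0 then 0 else N - (μ.colLen (v - 1) + (v - 1)) := by
  rcases v with _ | v
  · simp
  · rw [List.getD_cons_succ, lw_getD μ (by omega)]; simp

lemma vly_iff {N : ℕ} {μ : YoungDiagram} (hF : Fit N μ) {v : ℕ} :
    vly (lw N μ) v ↔ v ≤ N ∧ (v = 0 ∨ μ.colLen v + 1 ≤ μ.colLen (v - 1)) := by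
  rw [vly, lw_length]
  by_cases hv : v ≤ N
  · rw [lw_pred μ hv, lw_getD μ hv]
    have := hF v hv
    have := hF (v - 1) (by omega)
    split_ifs <;> omega
  · omega

lemma Add.cond {μ ν : YoungDiagram} {b : ℕ × ℕ} (h : Add μ ν b) : b.2 = 0 ∨ μ.colLen b.2 + 1 ≤ μ.colLen (b.2 - 1) := by
  rcases Nat.eq_zero_or_pos b.2 with e | e
  · exact Or.inl e
  · right
    have h1 := ν.colLen_anti (b.2 - 1) b.2 (by omega)
    rw [h.colLen, h.colLen, if_pos rfl, if_neg (by omega)] at h1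
    omega

lemma Add.le {μ ν : YoungDiagram} {b : ℕ × ℕ} (h : Add μ ν b) : b.1 + b.2 ≤ μ.card := by
  have := fit_of_card (N := μ.card + 1) (μ := ν) (by rw [h.card])
  have hb : (b.1, b.2) ∈ ν := h.mem.mpr (Or.inl rfl)
  have h1 := mem_iff_lt_colLen.mp hb
  have h2 := Add.cond h
  have h3 := h.col
  by_cases hv : b.2 ≤ μ.card + 1
  · have := this b.2 hv; omega
  · have h4 := ν.colLen_anti (μ.card + 1) b.2 (by omega)
    have := this (μ.card + 1) le_rfl
    omega

lemma Add.vly {N : ℕ} {μ ν : YoungDiagram} {b : ℕ × ℕ} (h : Add μ ν b) (hN : μ.card ≤ N) : vly (lw N μ) b.2 := by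
  rw [vly_iff (fit_of_card hN)]
  have := h.le
  exact ⟨by omega, h.cond⟩

lemma Add.level {N : ℕ} {μ ν : YoungDiagram} {b : ℕ × ℕ} (h : Add μ ν b) (hN : μ.card ≤ N) :
    (lw N μ).getD b.2 0 = N - (b.1 + b.2) := by
  have := h.le
  rw [lw_getD _ (by omega), h.col]

lemma Add.set {N : ℕ} {μ ν : YoungDiagram} {b : ℕ × ℕ} (h : Add μ ν b) (hN : μ.card < N) :
    lw N ν = (lw N μ).set b.2 ((lw N μ).getD b.2 0 - 1) := by
  have hl := h.le
  apply List.ext_getElem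
  · simp [lw_length]
  · intro i h1 h2
    rw [lw_length] at h1
    rw [List.getElem_set]
    have hg := lw_getD μ (show b.2 ≤ N by omega)
    generalize (lw N μ).getD b.2 0 = y at *
    simp only [lw, List.getElem_map, List.getElem_range, h.colLen]
    have := h.col
    split_ifs <;> first | omega | (subst_vars; omega)

/-- Young diagram from column lengths -/
def ydOf (f : ℕ → ℕ) (N : ℕ) (hf : ∀ v, f (v + 1) ≤ f v) (h0 : ∀ v, N < v → f v = 0) : YoungDiagram where
  cells := (Finset.range (f 0) ×ˢ Finset.range (N + 1)).filter fun c => c.1 < f c.2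
  isLowerSet := by
    have ha : Antitone f := antitone_nat_of_succ_le hf
    rintro ⟨a, b⟩ ⟨a', b'⟩ hle hab
    simp only [Prod.mk_le_mk] at hle
    simp only [Finset.coe_filter, Finset.mem_product, Finset.mem_range, Set.mem_setOf_eq] at hab ⊢
    have h1 := ha hle.2
    omega

lemma ydOf_col (f : ℕ → ℕ) (N : ℕ) (hf : ∀ v, f (v + 1) ≤ f v) (h0 : ∀ v, N < v → f v = 0) (v : ℕ) :
    (ydOf f N hf h0).colLen v = f v := by
  apply col_eq
  intro u
  rw [← mem_cells]
  simp only [ydOf, Finset.mem_filter, Finset.mem_product, Finset.mem_range]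
  have ha : Antitone f := antitone_nat_of_succ_le hf
  have h1 := ha (Nat.zero_le v)
  have h2 := h0 v
  constructor
  · tauto
  · intro h; refine ⟨⟨by omega, ?_⟩, h⟩
    by_contra hv
    have := h2 (by omega); omega

lemma exists_add {μ : YoungDiagram} (v : ℕ) (h : v = 0 ∨ μ.colLen v + 1 ≤ μ.colLen (v - 1)) :
    ∃ ν, Add μ ν (μ.colLen v, v) := by
  refine ⟨⟨insert (μ.colLen v, v) μ.cells, ?_⟩, ⟨by rw [mem_iff_lt_colLen]; omega, rfl⟩⟩
  rintro ⟨a, b⟩ ⟨a', b'⟩ hle hab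
  simp only [Prod.mk_le_mk] at hle
  simp only [Finset.coe_insert, Set.mem_insert_iff, Prod.mk.injEq, Finset.mem_coe, mem_cells, mem_iff_lt_colLen] at hab ⊢
  rcases hab with ⟨rfl, rfl⟩ | hab
  · by_cases e : b' = b
    · subst e; omega
    · right
      have := μ.colLen_anti b' (b - 1) (by omega)
      omega
  · right
    have := μ.colLen_anti b' b hle.2
    omega

lemma getD_valid : ∀ (L : List ℕ), Valid L → ∀ v, v < L.length → L.getD v 0 ≤ L.getD (v + 1) 0 + 1 ∧ L.getD v 0 + v + 1 ≤ L.length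
  | [], _, v, h => by simp at h
  | x :: L, hv, 0, _ => by
    rcases L with _ | ⟨y, L⟩
    · have := hv.1; simp [bound] at this ⊢; omega
    · have := hv.1
      have ih := getD_valid (y :: L) hv.2 0 (by simp)
      simp [bound] at this ih ⊢; omega
  | x :: L, hv, v + 1, h => by
    have := getD_valid L hv.2 v (by simpa using h)
    simp only [List.getD_cons_succ, List.length_cons]; omega

lemma exists_yd {N n : ℕ} {L : List ℕ} (hL : L ∈ LL N n) : ∃ μ, Fit N μ ∧ lw N μ = L ∧ μ.card = n := by
  obtain ⟨h1, h2, h3, h4⟩ := mem_LL.mp hL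
  let f : ℕ → ℕ := fun v => if v ≤ N then N - (L.getD v 0 + v) else 0
  have hg := getD_valid L h1
  rw [h2] at hg
  have hf : ∀ v, f (v + 1) ≤ f v := by
    intro v
    simp only [f]
    split_ifs with a b
    · have := hg v (by omega); omega
    · omega
    · omega
    · omega
  let μ := ydOf f N hf (fun v hv => by simp only [f]; rw [if_neg (by omega)])
  have hc : ∀ v ≤ N, μ.colLen v = N - (L.getD v 0 + v) := by
    intro v hv
    rw [ydOf_col]; simp only [f]; rw [if_pos hv]
  have hF : Fit N μ := by
    intro v hv
    rw [hc v hv]; omega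
  have hlw : lw N μ = L := by
    apply List.ext_getElem
    · rw [lw_length, h2]
    · intro i a b
      rw [lw_length] at a
      simp only [lw, List.getElem_map, List.getElem_range]
      have := hg i a
      rw [hc i (by omega)]
      have : L.getD i 0 = L[i] := by simp [List.getD, b]
      omega
  refine ⟨μ, hF, hlw, ?_⟩
  have := lw_sum hF
  rw [hlw] at this
  omega

end PF

namespace PF
open YoungDiagram

lemma pf_lower {n : ℕ} (P : PairFlag n) : IsLowerSet (↑(insert P.α P.Γ₁.cells) : Set (ℕ × ℕ)) := by
  intro c d hdc hc
  simp only [Finset.coe_insert, Set.mem_insert_iff, Finset.mem_coe, mem_cells] at hc ⊢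
  rcases hc with rfl | hc
  · by_cases e : d = P.α
    · exact Or.inl e
    · right
      have h3 : d ∈ P.Γ₃ := by
        have ha : P.α ∈ P.Γ₃ := by rw [← mem_cells, P.cells₃]; simp
        exact P.Γ₃.isLowerSet hdc ha
      rw [← mem_cells, P.cells₃, Finset.mem_insert, Finset.mem_insert] at h3
      rcases h3 with h | h | h
      · exact absurd h e
      · exfalso
        subst h
        have h1 := hdc.1
        have h2 := hdc.2
        have := P.min
        omega
      · exact h
  · exact Or.inr (P.Γ₁.isLowerSet hdc hc)

def gam2 {n : ℕ} (P : PairFlag n) : YoungDiagram := ⟨insert P.α P.Γ₁.cells, pf_lower P⟩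

lemma add1 {n : ℕ} (P : PairFlag n) : Add P.Γ₁ (gam2 P) P.α := ⟨P.not_mem_α, rfl⟩

lemma add2 {n : ℕ} (P : PairFlag n) : Add (gam2 P) P.Γ₃ P.β := by
  refine ⟨?_, ?_⟩
  · rw [(add1 P).mem]
    rintro (h | h)
    · exact P.ne h.symm
    · exact P.not_mem_β h
  · rw [P.cells₃, Finset.insert_comm]; rfl

lemma pos_eq {n N : ℕ} (hN : n + 4 ≤ N) (P : PairFlag n) :
    posOne P.Γ₁.cells (insert P.α P.Γ₁.cells) P.α P.β + dinv (lw N P.Γ₁) = n + ex (lw N P.Γ₁) P.α.2 P.β.2 := by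
  have a1 := add1 P
  have a2 := add2 P
  have c1 := P.card₁
  have c2 : (gam2 P).card = n + 1 := by rw [a1.card, c1]
  have l1 := a1.le
  have l2 := a2.le
  have f1 := first_term (N := N) (fit_of_card (μ := P.Γ₁) (by omega))
  have f2 := second_term (N := N) (fit_of_card (μ := P.Γ₁) (by omega)) (b := P.α) (by omega) a1.col a1.row
  have f3 := second_term (N := N) (fit_of_card (μ := gam2 P) (by omega)) (b := P.β) (by omega) a2.col a2.row
  have f4 := a1.level (N := N) (by omega)
  have f5 := a2.level (N := N) (by omega)
  have f6 := a1.set (N := N) (by omega)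
  rw [posOne, f2]
  change _ + _ + ((gam2 P).cells.filter fun c =>
        (hookDiff (gam2 P).cells c = 0 ∧ c.1 = P.β.1) ∨ (hookDiff (gam2 P).cells c = 1 ∧ c.2 = P.β.2)).card + _ + _ = _
  rw [f3, ex, ← f6, f5, f4, del]
  have e : (P.α.1 + P.α.2 + 2 < P.β.1 + P.β.2 ∨ P.β.1 + P.β.2 = P.α.1 + P.α.2 + 2 ∧ P.α.2 < P.β.2) ↔
    (N - (P.β.1 + P.β.2) + 2 < N - (P.α.1 + P.α.2) ∨ N - (P.α.1 + P.α.2) = N - (P.β.1 + P.β.2) + 2 ∧ P.α.2 < P.β.2) := by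
    omega
  rw [if_congr e rfl rfl]
  omega

noncomputable def Sset (N n : ℕ) : Finset (List ℕ × ℕ × ℕ) :=
  (LL N n ×ˢ (Finset.range (N + 1) ×ˢ Finset.range (N + 1))).filter fun s => adm s.1 s.2.1 s.2.2

lemma mem_S {n N : ℕ} (hN : n + 4 ≤ N) (P : PairFlag n) : (lw N P.Γ₁, P.α.2, P.β.2) ∈ Sset N n := by
  have a1 := add1 P
  have a2 := add2 P
  have c1 := P.card₁
  have c2 : (gam2 P).card = n + 1 := by rw [a1.card, c1]
  have l1 := a1.le
  have l2 := a2.le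
  have f4 := a1.level (N := N) (by omega)
  have f5 := a2.level (N := N) (by omega)
  have f6 := a1.set (N := N) (by omega)
  simp only [Sset, Finset.mem_filter, Finset.mem_product, Finset.mem_range]
  refine ⟨⟨lw_LL (fit_of_card (by omega)) c1, by omega, by omega⟩, a1.vly (by omega), by omega, ?_, ?_⟩
  · rw [← f6]; exact a2.vly (by omega)
  · rw [← f6, f4, f5]
    have := P.min
    omega

lemma lw_inj {N : ℕ} {μ ν : YoungDiagram} (hμ : Fit N μ) (hν : Fit N ν) (h : lw N μ = lw N ν) : μ = ν := by
  apply yd_ext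
  intro v
  by_cases hv : v ≤ N
  · have h1 := lw_getD μ hv
    rw [h, lw_getD ν hv] at h1
    have := hμ v hv
    have := hν v hv
    omega
  · rw [hμ.col_zero (by omega), hν.col_zero (by omega)]

lemma psi_inj {n N : ℕ} (hN : n + 4 ≤ N) {P Q : PairFlag n}
    (h : (lw N P.Γ₁, P.α.2, P.β.2) = (lw N Q.Γ₁, Q.α.2, Q.β.2)) : P = Q := by
  simp only [Prod.mk.injEq] at h
  obtain ⟨h1, h2, h3⟩ := h
  have e1 : P.Γ₁ = Q.Γ₁ := lw_inj (fit_of_card (by have := P.card₁; omega)) (fit_of_card (by have := Q.card₁; omega)) h1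
  have e2 : P.α = Q.α := Prod.ext (by rw [(add1 P).col, (add1 Q).col, e1, h2]) h2
  have e3 : gam2 P = gam2 Q := by apply YoungDiagram.ext; simp only [gam2, e1, e2]
  have e4 : P.β = Q.β := Prod.ext (by rw [(add2 P).col, (add2 Q).col, e3, h3]) h3
  have e5 : P.Γ₃ = Q.Γ₃ := by apply YoungDiagram.ext; rw [P.cells₃, Q.cells₃, e1, e2, e4]
  cases P; cases Q
  simp only at e1 e2 e4 e5
  subst e1 e2 e4 e5
  rfl

lemma psi_surj {n N : ℕ} (hN : n + 4 ≤ N) {s : List ℕ × ℕ × ℕ} (hs : s ∈ Sset N n) :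
    ∃ P : PairFlag n, (lw N P.Γ₁, P.α.2, P.β.2) = s := by
  obtain ⟨L, v₁, v₂⟩ := s
  simp only [Sset, Finset.mem_filter, Finset.mem_product, Finset.mem_range] at hs
  obtain ⟨⟨hL, hv1, hv2⟩, g1, g2, g3, g4⟩ := hs
  obtain ⟨μ, hF, rfl, hc⟩ := exists_yd hL
  obtain ⟨ν, a1⟩ := exists_add v₁ ((vly_iff hF).mp g1).2
  have c2 : ν.card = n + 1 := by rw [a1.card, hc]
  have f6 := a1.set (N := N) (by omega)
  simp only at f6
  rw [← f6] at g3 g4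
  obtain ⟨ρ, a2⟩ := exists_add v₂ ((vly_iff (fit_of_card (by omega))).mp g3).2
  have l1 := a1.le
  have l2 := a2.le
  have f4 := a1.level (N := N) (by omega)
  have f5 := a2.level (N := N) (by omega)
  simp only at f4 f5 l1 l2
  rw [f4, f5] at g4
  have hb := a2.nm
  rw [a1.mem] at hb
  push Not at hb
  refine ⟨⟨μ, ρ, (μ.colLen v₁, v₁), (ν.colLen v₂, v₂), hc, a1.nm, hb.2, hb.1.symm, ?_, ?_⟩, rfl⟩
  · rw [a2.cells, a1.cells, Finset.insert_comm]
  · simp only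
    omega

open Polynomial in
lemma finsum_S {n N : ℕ} (hN : n + 4 ≤ N) : (∑ᶠ P : PairFlag n,
        (X : Polynomial ℤ) ^ posOne P.Γ₁.cells (insert P.α P.Γ₁.cells) P.α P.β) =
      ∑ s ∈ Sset N n, (X : Polynomial ℤ) ^ (n + ex s.1 s.2.1 s.2.2 - dinv s.1) := by
  rw [finsum_eq_of_bijective (fun P : PairFlag n => (⟨(lw N P.Γ₁, P.α.2, P.β.2), mem_S hN P⟩ : {s // s ∈ Sset N n}))
    (g := fun s => (X : Polynomial ℤ) ^ (n + ex s.1.1 s.1.2.1 s.1.2.2 - dinv s.1.1)), finsum_eq_sum_of_fintype]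
  · exact Finset.sum_coe_sort (Sset N n) (fun s => (X : Polynomial ℤ) ^ (n + ex s.1 s.2.1 s.2.2 - dinv s.1))
  · constructor
    · intro P Q h
      exact psi_inj hN (congrArg Subtype.val h)
    · rintro ⟨s, hs⟩
      obtain ⟨P, hP⟩ := psi_surj hN hs
      exact ⟨P, Subtype.ext hP⟩
  · intro P
    have := pos_eq hN P
    simp only
    congr 1
    omega

lemma S_le {n N : ℕ} (hN : n + 4 ≤ N) {s : List ℕ × ℕ × ℕ} (hs : s ∈ Sset N n) : dinv s.1 ≤ n + ex s.1 s.2.1 s.2.2 := by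
  obtain ⟨P, rfl⟩ := psi_surj hN hs
  have := pos_eq hN P
  simp only; omega

lemma S_sum {n N : ℕ} (hN : n + 4 ≤ N) {q : ℝ} (hq : 1 < q) :
    ∑ s ∈ Sset N n, q ^ (n + ex s.1 s.2.1 s.2.2 - dinv s.1) = q ^ n * HH q⁻¹ N n := by
  have hq0 : 0 < q := by linarith
  rw [← LL_sum (by positivity) hN, Sset, Finset.sum_filter, Finset.sum_product, Finset.mul_sum]
  refine Finset.sum_congr rfl fun L hL => ?_
  obtain ⟨h1, h2, h3, h4⟩ := mem_LL.mp hL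
  rw [GLs, h2, Finset.sum_product, Finset.mul_sum, Finset.mul_sum]
  refine Finset.sum_congr rfl fun v hv => ?_
  rw [Finset.mul_sum, Finset.mul_sum]
  refine Finset.sum_congr rfl fun w hw => ?_
  simp only
  split_ifs with ha
  · have := S_le hN (s := (L, v, w)) (by
      simp only [Sset, Finset.mem_filter, Finset.mem_product]
      exact ⟨⟨hL, hv, hw⟩, ha⟩)
    simp only at this
    rw [pow_sub₀ _ hq0.ne' this, pow_add, inv_inv, inv_pow]
    ring
  · simp

open Polynomial in
lemma fPoly_eval {q : ℝ} (hq : 1 < q) (n : ℕ) : Polynomial.aeval q (fPoly n) = q ^ n * fh q⁻¹ n := by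
  have hq0 : 0 < q := by linarith
  rw [fPoly, fh, map_sum, Finset.mul_sum]
  refine Finset.sum_congr rfl fun x hx => ?_
  rw [map_sum, PP, Finset.mul_sum]
  refine Finset.sum_congr rfl fun ν _ => ?_
  have : Multiset.card ν.parts ≤ n := by
    have h1 : Multiset.card ν.parts • 1 ≤ ν.parts.sum := Multiset.card_nsmul_le_sum (fun x hx => ν.parts_pos hx)
    rw [ν.parts_sum] at h1
    simp at h1; omega
  rw [map_pow, aeval_X, pow_sub₀ _ hq0.ne' this, inv_pow]

open Polynomial in
theorem main_sum (n : ℕ) : (∑ᶠ P : PairFlag n,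
        (X : Polynomial ℤ) ^ posOne P.Γ₁.cells (insert P.α P.Γ₁.cells) P.α P.β)
      = (1 + X) * fPoly n - X * (if n = 0 then 0 else fPoly (n - 1)) := by
  rw [finsum_S (N := n + 4) le_rfl]
  apply Polynomial.map_injective (Int.castRingHom ℝ) (RingHom.injective_int _)
  apply Polynomial.eq_of_infinite_eval_eq
  refine Set.Infinite.mono (s := Set.Ioi (1 : ℝ)) ?_ (Set.Ioi_infinite 1)
  intro q hq
  have hq : 1 < q := hq
  have hq0 : 0 < q := by linarith
  simp only [Set.mem_setOf_eq]
  have hev : ∀ f : Polynomial ℤ, eval q (f.map (Int.castRingHom ℝ)) = aeval q f := fun f => by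
    rw [eval_map, aeval_def]; rfl
  rw [hev, hev, map_sum]
  simp only [map_pow, aeval_X]
  rw [S_sum le_rfl hq, HH_final (by positivity) (inv_lt_one_of_one_lt₀ hq) le_rfl, map_sub, map_mul, map_mul, fPoly_eval hq]
  rcases n with _ | n
  · simp
  · simp only [map_add, map_one, aeval_X, Nat.add_one_ne_zero, if_false, Nat.add_sub_cancel, fPoly_eval hq]
    simp only [inv_inv]
    ring

end PF

/-- For every pair `(Γ₁,Γ₃) ⊢ [n,n+2]`, the intermediate set `Γ₂ = Γ₁ ∪ {α}` is a Young
diagram, and the sum over all pairs of `q^{pos_{1+}(Γ₁,Γ₂,Γ₃)}` equals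
`(1+q)·f_n(q) − q·f_{n−1}(q)`. -/
theorem statement1 (n : ℕ) :
    (∀ P : PairFlag n, IsLowerSet (↑(insert P.α P.Γ₁.cells) : Set (ℕ × ℕ))) ∧
    (∑ᶠ P : PairFlag n,
        (X : Polynomial ℤ) ^ posOne P.Γ₁.cells (insert P.α P.Γ₁.cells) P.α P.β)
      = (1 + X) * fPoly n - X * (if n = 0 then 0 else fPoly (n - 1)) := by
  exact ⟨PF.pf_lower, PF.main_sum n⟩
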